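/- arXiv:1002.1870 — 12 statements merged into one kernel-verified Lean document; each statement's English description precedes it below -/
import Mathlib

section
/- Let M ⊆ ℝⁿ be a semialgebraic set and let f : M → ℝ be a function with f ≥ 0 on M whose graph {(x, f(x)) : x ∈ M} is a semialgebraic subset of ℝⁿ⁺¹. Let D ⊆ M be the set of points of M at which f is not continuous (with respect to the subspace topology on M). Then there exists a continuous function g : M → ℝ whose graph is a semialgebraic subset of ℝⁿ⁺¹, such that 0 ≤ g(x) ≤ f(x) for all x ∈ M, and such that for every x ∈ M with g(x) = 0, either f(x) = 0 or x lies in the closure of D in ℝⁿ. -/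
/-- A subset of `ℝᵏ` is semialgebraic if it is a finite union of sets of the form
`{x : p(x) = 0, q₁(x) > 0, …, qₘ(x) > 0}` for real polynomials `p, q₁, …, qₘ`. -/
def IsSemialgebraic {k : ℕ} (A : Set (Fin k → ℝ)) : Prop :=
  ∃ (N : ℕ) (p : Fin N → MvPolynomial (Fin k) ℝ) (m : Fin N → ℕ)
    (q : (i : Fin N) → Fin (m i) → MvPolynomial (Fin k) ℝ),
    A = ⋃ i, {x | MvPolynomial.eval x (p i) = 0 ∧
                  ∀ j, 0 < MvPolynomial.eval x (q i j)}

section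

open Polynomial Set Filter

/-- A broken-line automorphism of `ℝ` that moves `c` up to `c'`, supported on `(a, b)`. -/
lemma exists_orderIso_apply_eq_of_le {a b c c' : ℝ} (hac : a < c) (hcc : c ≤ c') (hcb : c' < b) :
    ∃ ψ : ℝ ≃o ℝ, ψ c = c' ∧ ∀ t ∉ Ioo a b, ψ t = t := by
  set k₁ := (c' - a) / (c - a)
  set k₂ := (b - c') / (b - c)
  have hca : 0 < c - a := by linarith
  have hbc : 0 < b - c := by linarith
  have hk₁ : 1 ≤ k₁ := by rw [one_le_div hca]; linarith
  have hk₂ : 0 < k₂ := div_pos (by linarith) hbc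
  have hk₂' : k₂ ≤ 1 := by rw [div_le_one hbc]; linarith
  have e₁ : k₁ * (c - a) = c' - a := div_mul_cancel₀ _ hca.ne'
  have e₂ : k₂ * (b - c) = b - c' := div_mul_cancel₀ _ hbc.ne'
  let f : ℝ → ℝ := fun t => max t (min (a + k₁ * (t - a)) (b - k₂ * (b - t)))
  have hout : ∀ t ∉ Ioo a b, f t = t := by
    intro t ht
    apply max_eq_left
    rcases le_or_gt t a with h | h
    · exact min_le_of_left_le (by nlinarith)
    · have : b ≤ t := by by_contra h'; exact ht ⟨h, not_le.1 h'⟩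
      exact min_le_of_right_le (by nlinarith)
  have hmono : StrictMono f := by
    intro s t hst
    have h₁ : a + k₁ * (s - a) < a + k₁ * (t - a) := by nlinarith
    have h₂ : b - k₂ * (b - s) < b - k₂ * (b - t) := by nlinarith
    exact max_lt_max hst (min_lt_min h₁ h₂)
  have hcont : Continuous f := by fun_prop
  have hsurj : Function.Surjective f := by
    refine hcont.surjective (tendsto_atTop_mono (fun t => le_max_left _ _) tendsto_id) ?_
    refine tendsto_id.congr' ?_
    filter_upwards [eventually_le_atBot a] with t ht
    exact (hout t fun h => (h.1.trans_le ht).false).symm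
  refine ⟨hmono.orderIsoOfSurjective f hsurj, ?_, hout⟩
  have : f c = c' := by
    simp only [f, e₁, e₂]
    rw [min_eq_left (by linarith), max_eq_right (by linarith)]
    ring
  exact this

lemma exists_orderIso_apply_eq {a b c c' : ℝ} (hc : c ∈ Ioo a b) (hc' : c' ∈ Ioo a b) :
    ∃ ψ : ℝ ≃o ℝ, ψ c = c' ∧ ∀ t ∉ Ioo a b, ψ t = t := by
  rcases le_total c c' with h | h
  · exact exists_orderIso_apply_eq_of_le hc.1 h hc'.2
  · obtain ⟨ψ, h₁, h₂⟩ := exists_orderIso_apply_eq_of_le hc'.1 h hc.2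
    exact ⟨ψ.symm, by rw [← h₁, ψ.symm_apply_apply], fun t ht => by
      conv_lhs => rw [← h₂ t ht]
      exact ψ.symm_apply_apply t⟩

/-- Two points not separated by a finite set `W` can be exchanged by an automorphism of `ℝ` that
moves no point across `W`. -/
lemma exists_orderIso_avoiding {W : Set ℝ} (hW : W.Finite) {c c' : ℝ}
    (h : ∀ w ∈ W, w ∉ uIcc c c') :
    ∃ ψ : ℝ ≃o ℝ, ψ c = c' ∧ ∀ s, ψ s = s ∨ ∀ w ∈ W, w ∉ uIcc s (ψ s) := by
  have near : ∀ u ∉ W, ∃ ε > 0, ∀ w ∈ W, w ∉ Metric.closedBall u ε := by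
    intro u hu
    obtain ⟨ε, hε, hs⟩ :=
      Metric.nhds_basis_closedBall.mem_iff.1 (hW.isClosed.isOpen_compl.mem_nhds hu)
    exact ⟨ε, hε, fun w hw hw' => hs hw' hw⟩
  have hmin : min c c' ∉ W := fun hm => h _ hm ⟨le_rfl, min_le_max⟩
  have hmax : max c c' ∉ W := fun hm => h _ hm ⟨min_le_max, le_rfl⟩
  obtain ⟨ε₁, hε₁, h₁⟩ := near _ hmin
  obtain ⟨ε₂, hε₂, h₂⟩ := near _ hmax
  obtain ⟨ψ, hψ, hout⟩ := exists_orderIso_apply_eq (a := min c c' - ε₁) (b := max c c' + ε₂)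
    (c := c) (c' := c')
    ⟨by linarith [min_le_left c c'], by linarith [le_max_left c c']⟩
    ⟨by linarith [min_le_right c c'], by linarith [le_max_right c c']⟩
  refine ⟨ψ, hψ, fun s => ?_⟩
  by_cases hs : s ∈ Ioo (min c c' - ε₁) (max c c' + ε₂)
  · right
    have hψs : ψ s ∈ Ioo (min c c' - ε₁) (max c c' + ε₂) := by
      have ha := hout (min c c' - ε₁) (by simp)
      have hb := hout (max c c' + ε₂) (by simp)
      constructor
      · rw [← ha]; exact ψ.strictMono hs.1
      · rw [← hb]; exact ψ.strictMono hs.2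
    intro w hw hws
    have hlo : min c c' - ε₁ < w := (lt_min hs.1 hψs.1).trans_le hws.1
    have hhi : w < max c c' + ε₂ := hws.2.trans_lt (max_lt hs.2 hψs.2)
    have g₁ := h₁ w hw
    have g₂ := h₂ w hw
    have g := h w hw
    rw [Metric.mem_closedBall, Real.dist_eq, abs_le] at g₁ g₂
    rw [uIcc, mem_Icc] at g
    change ¬ (min c c' ≤ w ∧ w ≤ max c c') at g
    by_cases q₁ : min c c' ≤ w
    · have q₂ : max c c' < w := by
        by_contra q; exact g ⟨q₁, not_lt.1 q⟩
      exact g₂ ⟨by linarith, by linarith⟩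
    · exact g₁ ⟨by linarith, by linarith⟩
  · exact Or.inl (hout s hs)

lemma sign_eval_eq_of_forall_ne_zero {p : ℝ[X]} {a b : ℝ} (h : ∀ z ∈ uIcc a b, p.eval z ≠ 0) :
    SignType.sign (p.eval a) = SignType.sign (p.eval b) := by
  by_contra hne
  have : (0 : ℝ) ∈ uIcc (p.eval a) (p.eval b) := by
    have ha := h a left_mem_uIcc
    have hb := h b right_mem_uIcc
    rw [mem_uIcc]
    rcases lt_or_gt_of_ne ha with ha | ha <;> rcases lt_or_gt_of_ne hb with hb | hb
    · simp [sign_neg ha, sign_neg hb] at hne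
    · exact Or.inl ⟨ha.le, hb.le⟩
    · exact Or.inr ⟨hb.le, ha.le⟩
    · simp [sign_pos ha, sign_pos hb] at hne
  obtain ⟨z, hz, hz0⟩ := intermediate_value_uIcc p.continuous.continuousOn this
  exact h z hz hz0

lemma exists_derivative_eval_mul {p : ℝ[X]} {a b : ℝ} (hab : a < b) :
    ∃ z ∈ Ioo a b, p.eval b - p.eval a = p.derivative.eval z * (b - a) := by
  obtain ⟨z, hz, h⟩ := exists_deriv_eq_slope (fun x => p.eval x) hab p.continuous.continuousOn
    p.differentiable.differentiableOn
  refine ⟨z, hz, ?_⟩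
  rw [Polynomial.deriv] at h
  rw [h, div_mul_cancel₀ _ (by linarith)]

lemma sign_eval_sub_eval {p : ℝ[X]} {t r : ℝ} (h : ∀ z ∈ uIcc t r, p.derivative.eval z ≠ 0) :
    SignType.sign (p.eval t - p.eval r) =
      SignType.sign (p.derivative.eval t) * SignType.sign (t - r) := by
  have key : ∀ z ∈ uIcc t r,
      SignType.sign (p.derivative.eval z) = SignType.sign (p.derivative.eval t) := fun z hz =>
    sign_eval_eq_of_forall_ne_zero fun w hw =>
      h w (uIcc_subset_uIcc hz left_mem_uIcc hw)
  rcases lt_trichotomy t r with htr | rfl | htr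
  · obtain ⟨z, hz, e⟩ := exists_derivative_eval_mul (p := p) htr
    rw [← key z (Ioo_subset_Icc_self.trans Icc_subset_uIcc hz), ← sign_mul]
    congr 1; linarith
  · simp
  · obtain ⟨z, hz, e⟩ := exists_derivative_eval_mul (p := p) htr
    rw [← key z (Ioo_subset_Icc_self.trans Icc_subset_uIcc' hz), ← sign_mul, e]

lemma exists_root_left {φ : ℝ ≃o ℝ} {P Q : ℝ[X]} {Z : Set ℝ} (hZ : Z.Finite)
    (hZP : ∀ z ∈ Z, SignType.sign (P.eval z) = SignType.sign (Q.eval (φ z)))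
    (hd : ∀ t, SignType.sign (P.derivative.eval t) = SignType.sign (Q.derivative.eval (φ t)))
    (hZd : ∀ t, P.derivative.eval t = 0 → t ∈ Z) {t : ℝ} (ht : t ∉ Z)
    (hPd : 0 < P.derivative.eval t) (hP : P.eval t ≤ 0) (hQ : 0 < Q.eval (φ t)) :
    ∃ r, Q.eval r = 0 ∧ ∀ z ∈ Z, φ z ∉ uIcc (φ t) r := by
  have hQZ : ∀ s, Q.derivative.eval (φ s) = 0 → s ∈ Z := fun s hs =>
    hZd s (by rw [← sign_eq_zero_iff, hd, hs, sign_zero])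
  have hQd : 0 < Q.derivative.eval (φ t) := by
    rwa [← sign_eq_one_iff, ← hd, sign_eq_one_iff]
  obtain ⟨u, hut, hu, hgap⟩ : ∃ u < φ t, Q.eval u < 0 ∧ ∀ z ∈ Z, φ z ∉ Ioc u (φ t) := by
    by_cases hex : (Z ∩ Iio t).Nonempty
    · obtain ⟨a, ⟨haZ, hat⟩, hmax⟩ := (hZ.inter_of_left (Iio t)).exists_maximalFor id _ hex
      have hgap : ∀ z ∈ Z, z ∉ Ioc a t := by
        intro z hz hz'
        have hzt : z < t := lt_of_le_of_ne hz'.2 fun e => ht (e ▸ hz)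
        exact (hmax ⟨hz, hzt⟩ hz'.1.le).not_gt hz'.1
      refine ⟨φ a, φ.strictMono hat, ?_, fun z hz h => hgap z hz
        ⟨φ.lt_iff_lt.1 h.1, φ.le_iff_le.1 h.2⟩⟩
      rw [← sign_eq_neg_one_iff, ← hZP a haZ, sign_eq_neg_one_iff]
      obtain ⟨z, hz, e⟩ := exists_derivative_eval_mul (p := P) hat
      have hz' : 0 < P.derivative.eval z := by
        rw [← sign_eq_one_iff, sign_eval_eq_of_forall_ne_zero (b := t), sign_eq_one_iff]
        · exact hPd
        · intro w hw hw0
          rw [uIcc_of_le hz.2.le] at hw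
          exact hgap w (hZd w hw0) ⟨hz.1.trans_le hw.1, hw.2⟩
      nlinarith [mul_pos hz' (sub_pos.2 hat)]
    · have hgap : ∀ z ∈ Z, ¬ z ≤ t := fun z hz hzt =>
        hex ⟨z, hz, lt_of_le_of_ne hzt fun e => ht (e ▸ hz)⟩
      have hdeg : 0 < Q.degree := by
        by_contra hdeg
        rw [eq_C_of_degree_le_zero (not_lt.1 hdeg)] at hQd
        simp at hQd
      obtain ⟨u, hu, hut⟩ := (((Q.abs_tendsto_atBot hdeg).eventually_gt_atTop
        (Q.eval (φ t))).and (eventually_lt_atBot (φ t))).exists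
      refine ⟨u, hut, ?_, fun z hz h => hgap z hz (φ.le_iff_le.1 h.2)⟩
      obtain ⟨z, hz, e⟩ := exists_derivative_eval_mul (p := Q) hut
      have hz' : 0 < Q.derivative.eval z := by
        rw [← sign_eq_one_iff, sign_eval_eq_of_forall_ne_zero (b := φ t), sign_eq_one_iff]
        · exact hQd
        · intro w hw hw0
          rw [uIcc_of_le hz.2.le] at hw
          refine hgap _ (hQZ (φ.symm w) (by rwa [φ.apply_symm_apply])) ?_
          rw [φ.symm_apply_le]; exact hw.2
      have : Q.eval u < Q.eval (φ t) := by nlinarith [mul_pos hz' (sub_pos.2 hut)]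
      by_contra hu0
      rw [abs_of_nonneg (not_lt.1 hu0)] at hu
      linarith
  obtain ⟨r, hr, hr0⟩ := intermediate_value_Icc hut.le Q.continuous.continuousOn
    (show (0 : ℝ) ∈ Icc (Q.eval u) (Q.eval (φ t)) from ⟨hu.le, hQ.le⟩)
  refine ⟨r, hr0, fun z hz h => hgap z hz ?_⟩
  rw [uIcc_of_ge hr.2] at h
  refine ⟨lt_of_lt_of_le (lt_of_le_of_ne hr.1 ?_) h.1, h.2⟩
  rintro rfl
  exact hu.ne hr0

/-- Conjugation by `t ↦ -t`. -/
def OrderIso.negConj (φ : ℝ ≃o ℝ) : ℝ ≃o ℝ :=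
  (OrderIso.neg ℝ).trans (φ.dual.trans (OrderIso.neg ℝ).symm)

lemma OrderIso.negConj_apply (φ : ℝ ≃o ℝ) (t : ℝ) : φ.negConj t = -φ (-t) := rfl

lemma exists_root_of_nonpos_of_pos {φ : ℝ ≃o ℝ} {P Q : ℝ[X]} {Z : Set ℝ} (hZ : Z.Finite)
    (hZP : ∀ z ∈ Z, SignType.sign (P.eval z) = SignType.sign (Q.eval (φ z)))
    (hd : ∀ t, SignType.sign (P.derivative.eval t) = SignType.sign (Q.derivative.eval (φ t)))
    (hZd : ∀ t, P.derivative.eval t = 0 → t ∈ Z) {t : ℝ} (ht : t ∉ Z)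
    (hP : P.eval t ≤ 0) (hQ : 0 < Q.eval (φ t)) :
    ∃ r, Q.eval r = 0 ∧ ∀ z ∈ Z, φ z ∉ uIcc (φ t) r := by
  rcases lt_trichotomy (P.derivative.eval t) 0 with h | h | h
  · obtain ⟨r, hr, hgap⟩ := exists_root_left (φ := φ.negConj) (P := P.comp (-X)) (Q := Q.comp (-X))
      (Z := Neg.neg ⁻¹' Z) (t := -t) (hZ.preimage neg_injective.injOn)
      (fun z hz => by simpa [OrderIso.negConj_apply] using hZP _ hz)
      (fun s => by simpa [OrderIso.negConj_apply, derivative_comp, Left.sign_neg] using hd (-s))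
      (fun s hs => hZd _ (by simpa [derivative_comp] using hs))
      (by simpa using ht) (by simpa [derivative_comp] using h) (by simpa using hP)
      (by simpa [OrderIso.negConj_apply] using hQ)
    refine ⟨-r, by simpa using hr, fun z hz hmem => hgap (-z) (by simpa using hz) ?_⟩
    simp only [OrderIso.negConj_apply, neg_neg, mem_uIcc] at hmem ⊢
    rcases hmem with hmem | hmem
    · right; constructor <;> linarith
    · left; constructor <;> linarith
  · exact absurd (hZd t h) ht
  · exact exists_root_left hZ hZP hd hZd ht h hP hQ

lemma exists_root_of_sign_ne {φ : ℝ ≃o ℝ} {P Q : ℝ[X]} {Z : Set ℝ} (hZ : Z.Finite)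
    (hZP : ∀ z ∈ Z, SignType.sign (P.eval z) = SignType.sign (Q.eval (φ z)))
    (hd : ∀ t, SignType.sign (P.derivative.eval t) = SignType.sign (Q.derivative.eval (φ t)))
    (hZd : ∀ t, P.derivative.eval t = 0 → t ∈ Z) {t : ℝ} (ht : t ∉ Z)
    (hne : SignType.sign (P.eval t) ≠ SignType.sign (Q.eval (φ t))) (hQ : Q.eval (φ t) ≠ 0) :
    ∃ r, Q.eval r = 0 ∧ ∀ z ∈ Z, φ z ∉ uIcc (φ t) r := by
  rcases lt_or_gt_of_ne hQ with hQ | hQ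
  · have hP : 0 ≤ P.eval t := by
      by_contra hP
      exact hne (by rw [sign_neg hQ, sign_neg (not_le.1 hP)])
    simpa using exists_root_of_nonpos_of_pos (φ := φ) (P := -P) (Q := -Q) hZ
      (fun z hz => by simpa [Left.sign_neg] using hZP z hz)
      (fun s => by simpa [Left.sign_neg] using hd s)
      (fun s hs => hZd s (by simpa using hs)) ht (by simpa using hP) (by simpa using hQ)
  · have hP : P.eval t ≤ 0 := by
      by_contra hP
      exact hne (by rw [sign_pos hQ, sign_pos (not_le.1 hP)])
    exact exists_root_of_nonpos_of_pos hZ hZP hd hZd ht hP hQ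

/-- The order automorphism `φ` of `ℝ` matches the signs of `p` with those of `q`. -/
def SignAgree (φ : ℝ ≃o ℝ) (p q : ℝ[X]) : Prop :=
  ∀ t, SignType.sign (p.eval t) = SignType.sign (q.eval (φ t))

lemma SignAgree.eval_eq_zero_iff {φ : ℝ ≃o ℝ} {p q : ℝ[X]} (h : SignAgree φ p q) (t : ℝ) :
    p.eval t = 0 ↔ q.eval (φ t) = 0 := by
  rw [← sign_eq_zero_iff, h t, sign_eq_zero_iff]

lemma SignAgree.symm {φ : ℝ ≃o ℝ} {p q : ℝ[X]} (h : SignAgree φ p q) : SignAgree φ.symm q p :=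
  fun t => by rw [h, φ.apply_symm_apply]

lemma SignAgree.eq_zero {φ : ℝ ≃o ℝ} {p q : ℝ[X]} (h : SignAgree φ p q) (hp : p = 0) : q = 0 :=
  Polynomial.funext fun t => by
    have := (h.eval_eq_zero_iff (φ.symm t)).1 (by simp [hp])
    simpa using this

/-- The inductive step of the Cohen–Hörmander elimination: sign-matching extends from a family
containing the derivatives to a new pair `(P, Q)` whose signs match at the roots of the family. -/
theorem exists_signAgree_extend {L : Set (ℝ[X] × ℝ[X])} (hL : L.Finite) {P Q : ℝ[X]}
    (hder : (derivative P, derivative Q) ∈ L) (hP : derivative P ≠ 0)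
    (hroot : ∀ φ : ℝ ≃o ℝ, (∀ pq ∈ L, SignAgree φ pq.1 pq.2) → ∀ pq ∈ L, pq.1 ≠ 0 → ∀ t,
      pq.1.eval t = 0 → SignType.sign (P.eval t) = SignType.sign (Q.eval (φ t)))
    (hex : ∃ φ : ℝ ≃o ℝ, ∀ pq ∈ L, SignAgree φ pq.1 pq.2) :
    ∃ φ : ℝ ≃o ℝ, (∀ pq ∈ L, SignAgree φ pq.1 pq.2) ∧ SignAgree φ P Q := by
  have hfin : ∀ g : ℝ[X] × ℝ[X] → ℝ[X],
      (⋃ pq ∈ L, {z | g pq ≠ 0 ∧ (g pq).eval z = 0}).Finite := fun g =>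
    hL.biUnion fun pq _ => ((g pq).roots.toFinset.finite_toSet).subset fun z hz => by
      simpa [hz.1] using hz.2
  set Z := ⋃ pq ∈ L, {z | pq.1 ≠ 0 ∧ pq.1.eval z = 0} with hZdef
  set W := ⋃ pq ∈ L, {z | pq.2 ≠ 0 ∧ pq.2.eval z = 0} with hWdef
  have hZ : Z.Finite := hfin Prod.fst
  have hW : W.Finite := hfin Prod.snd
  have hZW : ∀ φ : ℝ ≃o ℝ, (∀ pq ∈ L, SignAgree φ pq.1 pq.2) → ∀ t, t ∈ Z ↔ φ t ∈ W := by
    intro φ hφ t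
    simp only [hZdef, hWdef, mem_iUnion, mem_ofPred_eq, exists_prop]
    refine exists_congr fun pq => and_congr_right fun hpq => and_congr (not_congr ⟨?_, ?_⟩) ?_
    · exact (hφ pq hpq).eq_zero
    · exact (hφ pq hpq).symm.eq_zero
    · exact (hφ pq hpq).eval_eq_zero_iff t
  have hZP : ∀ φ : ℝ ≃o ℝ, (∀ pq ∈ L, SignAgree φ pq.1 pq.2) → ∀ z ∈ Z,
      SignType.sign (P.eval z) = SignType.sign (Q.eval (φ z)) := by
    intro φ hφ z hz
    simp only [hZdef, mem_iUnion, mem_ofPred_eq, exists_prop] at hz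
    obtain ⟨pq, hpq, h0, hz⟩ := hz
    exact hroot φ hφ pq hpq h0 z hz
  have hZd : ∀ t, P.derivative.eval t = 0 → t ∈ Z := fun t ht => by
    simp only [hZdef, mem_iUnion, mem_ofPred_eq, exists_prop]
    exact ⟨_, hder, hP, ht⟩
  have hmatch : ∀ S : Finset ℝ, (∀ r ∈ S, P.eval r = 0) → ∃ φ : ℝ ≃o ℝ,
      (∀ pq ∈ L, SignAgree φ pq.1 pq.2) ∧ ∀ r ∈ S, Q.eval (φ r) = 0 := by
    intro S
    induction S using Finset.induction_on with
    | empty => exact fun _ => hex.imp fun φ hφ => ⟨hφ, by simp⟩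
    | insert r S hrS ih =>
      intro hS
      obtain ⟨φ, hφ, hφS⟩ := ih fun s hs => hS s (Finset.mem_insert_of_mem hs)
      have hr := hS r (Finset.mem_insert_self r S)
      by_cases hQr : Q.eval (φ r) = 0
      · exact ⟨φ, hφ, by simpa [hQr] using hφS⟩
      have hne : SignType.sign (P.eval r) ≠ SignType.sign (Q.eval (φ r)) := by
        rw [hr, sign_zero]; exact fun h => hQr (sign_eq_zero_iff.1 h.symm)
      have hrZ : r ∉ Z := fun h => hne (hZP φ hφ r h)
      obtain ⟨r', hr', hgap⟩ := exists_root_of_sign_ne hZ (hZP φ hφ) (hφ _ hder) hZd hrZ hne hQr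
      obtain ⟨ψ, hψ, hψW⟩ := exists_orderIso_avoiding (W := W ∪ φ '' S) (c := φ r) (c' := r')
        (hW.union (S.finite_toSet.image φ)) (by
          rintro w (hw | ⟨s, hs, rfl⟩) hmem
          · refine hgap (φ.symm w) ?_ (by simpa using hmem)
            rw [hZW φ hφ]; simpa using hw
          · have hs0 : P.eval s = 0 := hS s (Finset.mem_insert_of_mem hs)
            have hsr : s ≠ r := fun e => hrS (e ▸ hs)
            obtain ⟨z, hz, hzZ⟩ : ∃ z ∈ uIcc r s, z ∈ Z := by
              by_contra! hno
              have := sign_eval_sub_eval (p := P) (t := r) (r := s)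
                fun z hz h0 => hno z hz (hZd z h0)
              rw [hr, hs0, sub_self, sign_zero, eq_comm, ← sign_mul, sign_eq_zero_iff,
                mul_eq_zero] at this
              rcases this with h | h
              · exact hno r left_mem_uIcc (hZd r h)
              · exact hsr (sub_eq_zero.1 h).symm
            refine hgap z hzZ (uIcc_subset_uIcc_left hmem ?_)
            rw [mem_uIcc] at hz ⊢
            simpa only [φ.le_iff_le] using hz)
      refine ⟨φ.trans ψ, fun pq hpq t => ?_, ?_⟩
      · rw [hφ pq hpq t]
        change _ = SignType.sign (pq.2.eval (ψ (φ t)))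
        rcases hψW (φ t) with h | h
        · rw [h]
        by_cases h0 : pq.2 = 0
        · simp [h0]
        refine sign_eval_eq_of_forall_ne_zero fun z hz hz0 => h z (Or.inl ?_) hz
        simp only [hWdef, mem_iUnion, mem_ofPred_eq, exists_prop]
        exact ⟨pq, hpq, h0, hz0⟩
      · intro s hs
        rw [OrderIso.trans_apply]
        rcases Finset.mem_insert.1 hs with rfl | hs
        · rw [hψ, hr']
        · rcases hψW (φ s) with h | h
          · rw [h]; exact hφS s hs
          · exact absurd left_mem_uIcc (h (φ s) (Or.inr ⟨s, hs, rfl⟩))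
  have hP0 : P ≠ 0 := by rintro rfl; simp at hP
  obtain ⟨φ, hφ, hφP⟩ := hmatch P.roots.toFinset fun r hr => by simpa [hP0] using hr
  refine ⟨φ, hφ, fun t => by_contra fun hne => ?_⟩
  have hφP' : ∀ r, P.eval r = 0 → Q.eval (φ r) = 0 := fun r hr => hφP r (by simpa [hP0] using hr)
  have hPt : P.eval t ≠ 0 := fun h => hne (by rw [h, hφP' t h])
  have htZ : t ∉ Z := fun h => hne (hZP φ hφ t h)
  have hsW : ∀ s, s ∈ W ↔ φ.symm s ∈ Z := fun s => by rw [hZW φ hφ, φ.apply_symm_apply]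
  have hWd : ∀ s, Q.derivative.eval s = 0 → s ∈ W := fun s hs => by
    rw [hsW]; exact hZd _ (((hφ _ hder).symm.eval_eq_zero_iff s).1 hs)
  obtain ⟨r, hr, hgap⟩ := exists_root_of_sign_ne (φ := φ.symm) (P := Q) (Q := P) (t := φ t) hW
    (fun w hw => by rw [hZP φ hφ _ ((hsW w).1 hw), φ.apply_symm_apply]) (hφ _ hder).symm hWd
    (by rwa [← hZW φ hφ]) (by simpa using Ne.symm hne) (by simpa using hPt)
  have e₁ := sign_eval_sub_eval (p := P) (t := t) (r := r) fun z hz h0 =>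
    hgap (φ z) ((hZW φ hφ z).1 (hZd z h0)) (by simpa using hz)
  have e₂ := sign_eval_sub_eval (p := Q) (t := φ t) (r := φ r) fun z hz h0 => by
    refine hgap z (hWd z h0) ?_
    rw [mem_uIcc] at hz ⊢
    simpa [φ.symm_apply_le, φ.le_symm_apply] using hz
  rw [hr, sub_zero] at e₁
  rw [hφP' r hr, sub_zero, ← hφ _ hder t] at e₂
  refine hne (e₁.trans (Eq.trans ?_ e₂.symm))
  congr 1
  rcases lt_trichotomy t r with h | rfl | h
  · rw [sign_neg (sub_neg.2 h), sign_neg (sub_neg.2 (φ.strictMono h))]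
  · simp
  · rw [sign_pos (sub_pos.2 h), sign_pos (sub_pos.2 (φ.strictMono h))]

/-- A finite set has a finite closure under finitely-valued operations that lower degrees. -/
lemma exists_finite_closure {α : Type*} (deg : α → ℕ) (o : α → α → Set α)
    (hfin : ∀ p q, (o p q).Finite) (hdeg : ∀ p q, ∀ e ∈ o p q, deg e < deg p ∧ deg e < deg q)
    {F : Set α} (hF : F.Finite) :
    ∃ F' : Set α, F'.Finite ∧ F ⊆ F' ∧ ∀ p ∈ F', ∀ q ∈ F', o p q ⊆ F' := by
  obtain ⟨D, hD⟩ : ∃ D, ∀ p ∈ F, deg p < D := by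
    obtain ⟨D, hD⟩ := (hF.image deg).bddAbove
    exact ⟨D + 1, fun p hp => Nat.lt_succ_of_le (hD ⟨p, hp, rfl⟩)⟩
  have key : ∀ j, ∃ F' : Set α, F'.Finite ∧ F ⊆ F' ∧ (∀ p ∈ F', deg p < D) ∧
      ∀ p ∈ F', ∀ q ∈ F', D ≤ deg p + j → D ≤ deg q + j → o p q ⊆ F' := by
    intro j
    induction j with
    | zero => exact ⟨F, hF, subset_rfl, hD, fun p hp q _ h _ => absurd (hD p hp) (by omega)⟩
    | succ j ih =>
      obtain ⟨E, hE, hFE, hED, hEo⟩ := ih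
      refine ⟨E ∪ ⋃ p ∈ E, ⋃ q ∈ E, o p q, hE.union (hE.biUnion fun p _ => hE.biUnion fun q _ =>
        hfin p q), hFE.trans subset_union_left, ?_, ?_⟩
      · rintro e (he | he)
        · exact hED e he
        · simp only [mem_iUnion, exists_prop] at he
          obtain ⟨p, hp, q, hq, he⟩ := he
          exact (hdeg p q e he).1.trans (hED p hp)
      · have old : ∀ e ∈ E ∪ ⋃ p ∈ E, ⋃ q ∈ E, o p q, D ≤ deg e + (j + 1) → e ∈ E := by
          rintro e (he | he) hj
          · exact he
          · simp only [mem_iUnion, exists_prop] at he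
            obtain ⟨p, hp, q, hq, he⟩ := he
            have := hdeg p q e he
            exact hEo p hp q hq (by omega) (by omega) he
        intro p hp q hq hpj hqj e he
        right
        simp only [mem_iUnion, exists_prop]
        exact ⟨p, old p hp hpj, q, old q hq hqj, he⟩
  obtain ⟨F', h₁, h₂, -, h₃⟩ := key D
  exact ⟨F', h₁, h₂, fun p hp q hq => h₃ p hp q hq (by omega) (by omega)⟩

lemma exists_pseudoRemainder {R : Type*} [CommRing R] {Q : R[X]} (hQ : 0 < Q.natDegree)
    (P : R[X]) : ∃ (m : ℕ) (A S : R[X]), S.natDegree < Q.natDegree ∧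
      C (Q.leadingCoeff ^ m) * P = A * Q + S := by
  induction h : P.natDegree using Nat.strong_induction_on generalizing P with
  | _ d ih =>
    subst h
    rcases lt_or_ge P.natDegree Q.natDegree with hlt | hle
    · exact ⟨0, 0, P, hlt, by simp⟩
    · obtain ⟨m, A, S, hS, e⟩ := ih _
        (natDegree_cancelLeads_lt_of_natDegree_le_natDegree hle (hQ.trans_le hle)) _ rfl
      refine ⟨m + 1, A + C (Q.leadingCoeff ^ m) * C P.leadingCoeff *
        X ^ (P.natDegree - Q.natDegree), S, hS, ?_⟩
      rw [cancelLeads, Nat.sub_eq_zero_of_le hle, pow_zero, mul_one] at e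
      rw [pow_succ, C_mul]
      linear_combination e

/-- Closure under the operations of the Cohen–Hörmander elimination. -/
structure EliminationClosed {R : Type*} [CommRing R] (F : Set R[X]) : Prop where
  eraseLead_mem : ∀ P ∈ F, 0 < P.natDegree → P.eraseLead ∈ F
  derivative_mem : ∀ P ∈ F, 0 < P.natDegree → derivative P ∈ F
  exists_rem_mem : ∀ P ∈ F, ∀ Q ∈ F, 0 < Q.natDegree → Q.natDegree ≤ P.natDegree →
    ∃ (m : ℕ) (A S : R[X]), S ∈ F ∧ S.natDegree < Q.natDegree ∧
      C (Q.leadingCoeff ^ m) * P = A * Q + S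

lemma natDegree_eraseLead_lt_self {R : Type*} [CommRing R] {P : R[X]} (hP : 0 < P.natDegree) :
    P.eraseLead.natDegree < P.natDegree :=
  (eraseLead_natDegree_le P).trans_lt (Nat.sub_lt hP one_pos)

lemma exists_eliminationClosed {R : Type*} [CommRing R] {F : Set R[X]} (hF : F.Finite) :
    ∃ F' : Set R[X], F'.Finite ∧ F ⊆ F' ∧ EliminationClosed F' := by
  choose m A S hS e using fun (Q : {Q : R[X] // 0 < Q.natDegree}) => exists_pseudoRemainder Q.2
  let o : R[X] → R[X] → Set R[X] := fun P Q =>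
    {T | ∃ h : 0 < Q.natDegree, Q.natDegree ≤ P.natDegree ∧
      (T = S ⟨Q, h⟩ P ∨ P = Q ∧ (T = P.eraseLead ∨ T = derivative P))}
  obtain ⟨F', hF', hFF', hcl⟩ := exists_finite_closure natDegree o (fun P Q => by
    by_cases h : 0 < Q.natDegree
    · exact (Set.toFinite {S ⟨Q, h⟩ P, P.eraseLead, derivative P}).subset (by
        rintro T ⟨_, _, h | ⟨_, h | h⟩⟩ <;> simp [h])
    · exact Set.finite_empty.subset fun T hT => absurd hT.1 h) (by
    rintro P Q T ⟨h, hle, rfl | ⟨rfl, rfl | rfl⟩⟩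
    · exact ⟨(hS ⟨Q, h⟩ P).trans_le hle, hS ⟨Q, h⟩ P⟩
    · exact ⟨natDegree_eraseLead_lt_self h, natDegree_eraseLead_lt_self h⟩
    · exact ⟨natDegree_derivative_lt h.ne', natDegree_derivative_lt h.ne'⟩) hF
  exact ⟨F', hF', hFF',
    fun P hP h => hcl P hP P hP ⟨h, le_rfl, Or.inr ⟨rfl, Or.inl rfl⟩⟩,
    fun P hP h => hcl P hP P hP ⟨h, le_rfl, Or.inr ⟨rfl, Or.inr rfl⟩⟩,
    fun P hP Q hQ h hle => ⟨m ⟨Q, h⟩ P, A ⟨Q, h⟩ P, S ⟨Q, h⟩ P,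
      hcl P hP Q hQ ⟨h, hle, Or.inl rfl⟩, hS ⟨Q, h⟩ P, e ⟨Q, h⟩ P⟩⟩

lemma map_eraseLead_of_leadingCoeff_eq_zero {R : Type*} [CommRing R] {x : R →+* ℝ} {P : R[X]}
    (h : x P.leadingCoeff = 0) : P.eraseLead.map x = P.map x := by
  have := congrArg (Polynomial.map x) (eraseLead_add_monomial_natDegree_leadingCoeff P)
  rwa [Polynomial.map_add, map_monomial, h, monomial_zero_right, add_zero] at this

lemma sign_eval_eq_of_pseudoRemainder {R : Type*} [CommRing R] {x : R →+* ℝ} {P Q A S : R[X]}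
    {m : ℕ} (e : C (Q.leadingCoeff ^ m) * P = A * Q + S) {t : ℝ} (ht : (Q.map x).eval t = 0) :
    SignType.sign (x Q.leadingCoeff) ^ m * SignType.sign ((P.map x).eval t) =
      SignType.sign ((S.map x).eval t) := by
  have := congrArg (fun T => (T.map x).eval t) e
  simp only [Polynomial.map_mul, Polynomial.map_add, Polynomial.map_pow, map_C, eval_mul,
    eval_pow, eval_C, eval_add, ht, mul_zero, zero_add, C_pow] at this
  rw [← this, sign_mul, sign_pow]

/-- Two specialisations at which the coefficients of a closed family have the same signs induce
sign-matched families of real polynomials. -/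
theorem EliminationClosed.exists_signAgree {R : Type*} [CommRing R] {F : Set R[X]}
    (hF : EliminationClosed F) (hfin : F.Finite) {x y : R →+* ℝ}
    (hxy : ∀ P ∈ F, ∀ i, SignType.sign (x (P.coeff i)) = SignType.sign (y (P.coeff i))) :
    ∃ φ : ℝ ≃o ℝ, ∀ P ∈ F, SignAgree φ (P.map x) (P.map y) := by
  classical
  have key : ∀ s : Finset R[X], (∀ P ∈ s, P ∈ F) →
      (∀ Q ∈ F, ∀ P ∈ s, Q.natDegree < P.natDegree → Q ∈ s) →
      ∃ φ : ℝ ≃o ℝ, ∀ P ∈ s, SignAgree φ (P.map x) (P.map y) := by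
    intro s
    refine Finset.induction_on_max_value (fun P : R[X] => P.natDegree) s
      (fun _ _ => ⟨OrderIso.refl ℝ, by simp⟩) ?_
    · intro P s hPs hmax ih hsF hdown
      have hPF := hsF P (Finset.mem_insert_self P s)
      have hlow : ∀ Q ∈ F, Q.natDegree < P.natDegree → Q ∈ s := fun Q hQ hlt =>
        (Finset.mem_insert.1 (hdown Q hQ P (Finset.mem_insert_self P s) hlt)).resolve_left
          (by rintro rfl; exact lt_irrefl _ hlt)
      obtain ⟨φ, hφ⟩ := ih (fun Q hQ => hsF Q (Finset.mem_insert_of_mem hQ))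
        fun Q hQ T hT hlt => hlow Q hQ (hlt.trans_le (hmax T hT))
      have hext : ∀ φ : ℝ ≃o ℝ, (∀ Q ∈ s, SignAgree φ (Q.map x) (Q.map y)) →
          SignAgree φ (P.map x) (P.map y) →
          ∃ φ : ℝ ≃o ℝ, ∀ Q ∈ insert P s, SignAgree φ (Q.map x) (Q.map y) :=
        fun φ h₁ h₂ => ⟨φ, fun Q hQ => (Finset.mem_insert.1 hQ).elim (fun e => e ▸ h₂) (h₁ Q)⟩
      rcases Nat.eq_zero_or_pos P.natDegree with h0 | hpos
      · refine hext φ hφ fun t => ?_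
        rw [eq_C_of_natDegree_eq_zero h0]
        simpa using hxy P hPF 0
      by_cases hlead : x P.leadingCoeff = 0
      · have hlead' : y P.leadingCoeff = 0 := by
          rw [← sign_eq_zero_iff, leadingCoeff, ← hxy P hPF, ← leadingCoeff, hlead, sign_zero]
        refine hext φ hφ ?_
        rw [← map_eraseLead_of_leadingCoeff_eq_zero hlead,
          ← map_eraseLead_of_leadingCoeff_eq_zero hlead']
        exact hφ _ (hlow _ (hF.eraseLead_mem P hPF hpos) (natDegree_eraseLead_lt_self hpos))
      have hroot : ∀ φ : ℝ ≃o ℝ, (∀ Q ∈ s, SignAgree φ (Q.map x) (Q.map y)) → ∀ d, ∀ Q ∈ s,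
          Q.natDegree = d → Q.map x ≠ 0 → ∀ t, (Q.map x).eval t = 0 →
          SignType.sign ((P.map x).eval t) = SignType.sign ((P.map y).eval (φ t)) := by
        intro φ hφ d
        induction d using Nat.strong_induction_on with
        | _ d ihd =>
          rintro Q hQ rfl hQ0 t ht
          have hQF := hsF Q (Finset.mem_insert_of_mem hQ)
          rcases Nat.eq_zero_or_pos Q.natDegree with hQd | hQd
          · rw [eq_C_of_natDegree_eq_zero hQd] at ht hQ0
            simp only [map_C, eval_C] at ht
            simp [ht] at hQ0
          by_cases hQl : x Q.leadingCoeff = 0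
          · have hlt := natDegree_eraseLead_lt_self hQd
            refine ihd _ hlt _ (hlow _ (hF.eraseLead_mem Q hQF hQd)
              (hlt.trans_le (hmax Q hQ))) rfl ?_ t ?_ <;>
            rwa [map_eraseLead_of_leadingCoeff_eq_zero hQl]
          · obtain ⟨m, A, S, hS, hSd, e⟩ := hF.exists_rem_mem P hPF Q hQF hQd (hmax Q hQ)
            have h₁ := sign_eval_eq_of_pseudoRemainder e ht
            have h₂ := sign_eval_eq_of_pseudoRemainder e (((hφ Q hQ).eval_eq_zero_iff t).1 ht)
            rw [← hφ S (hlow S hS (hSd.trans_le (hmax Q hQ))) t, ← h₁, leadingCoeff,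
              ← hxy Q hQF] at h₂
            exact (mul_left_cancel₀ (pow_ne_zero m (sign_ne_zero.2 hQl)) h₂).symm
      have hdeg : (P.map x).natDegree = P.natDegree :=
        natDegree_map_of_leadingCoeff_ne_zero x hlead
      obtain ⟨ψ, hψ, hψP⟩ := exists_signAgree_extend (P := P.map x) (Q := P.map y)
        (L := (fun Q => (Q.map x, Q.map y)) '' (s : Set R[X])) (s.finite_toSet.image _)
        ⟨derivative P, hlow _ (hF.derivative_mem P hPF hpos)
          (natDegree_derivative_lt hpos.ne'), by simp [derivative_map]⟩
        (fun h => by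
          have := derivative_eq_zero.1 h
          omega)
        (by
          rintro φ hφ _ ⟨Q, hQ, rfl⟩ hQ0 t ht
          exact hroot φ (fun T hT => hφ _ ⟨T, hT, rfl⟩) _ Q hQ rfl hQ0 t ht)
        ⟨φ, by rintro _ ⟨Q, hQ, rfl⟩; exact hφ Q hQ⟩
      exact hext ψ (fun Q hQ => hψ _ ⟨Q, hQ, rfl⟩) hψP
  obtain ⟨φ, hφ⟩ := key hfin.toFinset (by simp) (fun Q hQ _ _ _ => by simpa using hQ)
  exact ⟨φ, fun P hP => hφ P (by simpa using hP)⟩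

/-- Membership in `A` depends only on the signs of finitely many polynomials. -/
def SignDetermined {ι : Type*} (A : Set (ι → ℝ)) : Prop :=
  ∃ G : Set (MvPolynomial ι ℝ), G.Finite ∧ ∀ x y : ι → ℝ,
    (∀ g ∈ G, SignType.sign (MvPolynomial.eval x g) = SignType.sign (MvPolynomial.eval y g)) →
    (x ∈ A ↔ y ∈ A)

namespace SignDetermined

variable {ι κ : Type*} {A B : Set (ι → ℝ)}

lemma compl (hA : SignDetermined A) : SignDetermined Aᶜ := by
  obtain ⟨G, hG, h⟩ := hA
  exact ⟨G, hG, fun x y hxy => not_congr (h x y hxy)⟩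

lemma iInter {α : Type*} [Finite α] {A : α → Set (ι → ℝ)} (hA : ∀ i, SignDetermined (A i)) :
    SignDetermined (⋂ i, A i) := by
  choose G hG h using hA
  refine ⟨⋃ i, G i, Set.finite_iUnion hG, fun x y hxy => ?_⟩
  simp only [mem_iInter]
  exact forall_congr' fun i => h i x y fun g hg => hxy g (mem_iUnion.2 ⟨i, hg⟩)

lemma inter (hA : SignDetermined A) (hB : SignDetermined B) : SignDetermined (A ∩ B) := by
  rw [inter_eq_iInter]
  exact iInter fun b => by cases b <;> assumption

lemma setOf_pos (p : MvPolynomial ι ℝ) :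
    SignDetermined {x | 0 < MvPolynomial.eval x p} :=
  ⟨{p}, finite_singleton p, fun x y hxy => by
    have := hxy p rfl
    rw [mem_ofPred_eq, mem_ofPred_eq, ← sign_eq_one_iff, this, sign_eq_one_iff]⟩

lemma preimage_comp (hA : SignDetermined A) (e : ι → κ) :
    SignDetermined {x : κ → ℝ | x ∘ e ∈ A} := by
  obtain ⟨G, hG, h⟩ := hA
  refine ⟨MvPolynomial.rename e '' G, hG.image _, fun x y hxy => h _ _ fun g hg => ?_⟩
  simpa [MvPolynomial.eval_rename] using hxy _ ⟨g, hg, rfl⟩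

/-- The Tarski–Seidenberg projection theorem. -/
theorem exists_option {A : Set (Option ι → ℝ)} (hA : SignDetermined A) :
    SignDetermined {x : ι → ℝ | ∃ t : ℝ, (fun o : Option ι => o.elim t x) ∈ A} := by
  obtain ⟨G, hG, h⟩ := hA
  obtain ⟨F, hF, hGF, hcl⟩ :=
    exists_eliminationClosed (hG.image (MvPolynomial.optionEquivLeft ℝ ι))
  refine ⟨⋃ P ∈ F, P.coeff '' P.support, hF.biUnion fun P _ => P.support.finite_toSet.image _,
    fun x y hxy => ?_⟩
  have hcoeff : ∀ P ∈ F, ∀ i, SignType.sign (MvPolynomial.eval x (P.coeff i)) =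
      SignType.sign (MvPolynomial.eval y (P.coeff i)) := by
    intro P hP i
    by_cases hi : i ∈ P.support
    · exact hxy _ (mem_biUnion hP ⟨i, hi, rfl⟩)
    · simp [notMem_support_iff.1 hi]
  have one : ∀ x y : ι → ℝ, (∀ P ∈ F, ∀ i, SignType.sign (MvPolynomial.eval x (P.coeff i)) =
      SignType.sign (MvPolynomial.eval y (P.coeff i))) →
      (∃ t : ℝ, (fun o : Option ι => o.elim t x) ∈ A) →
      ∃ t : ℝ, (fun o : Option ι => o.elim t y) ∈ A := by
    rintro x y hxy ⟨t, ht⟩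
    obtain ⟨φ, hφ⟩ := hcl.exists_signAgree hF hxy
    refine ⟨φ t, (h _ _ fun g hg => ?_).1 ht⟩
    rw [MvPolynomial.optionEquivLeft_elim_eval, MvPolynomial.optionEquivLeft_elim_eval]
    exact hφ _ (hGF ⟨g, hg, rfl⟩) t
  exact ⟨one x y hcoeff, one y x fun P hP i => (hcoeff P hP i).symm⟩

theorem exists_sum_fin {m : ℕ} {A : Set (ι ⊕ Fin m → ℝ)} (hA : SignDetermined A) :
    SignDetermined {x : ι → ℝ | ∃ z : Fin m → ℝ, Sum.elim x z ∈ A} := by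
  induction m with
  | zero =>
    obtain ⟨G, hG, h⟩ := hA
    convert! preimage_comp ⟨G, hG, h⟩ (Sum.elim id Fin.elim0) using 1
    ext x
    have : ∀ z : Fin 0 → ℝ, Sum.elim x z = x ∘ Sum.elim id Fin.elim0 := fun z => by
      ext (i | i)
      · rfl
      · exact i.elim0
    simp only [mem_ofPred_eq, this]
    exact exists_const _
  | succ m ih =>
    let e : ι ⊕ Fin (m + 1) → Option (ι ⊕ Fin m) :=
      Sum.elim (some ∘ Sum.inl) (Fin.cons none (some ∘ Sum.inr))
    convert! ih (hA.preimage_comp e).exists_option using 1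
    ext x
    have : ∀ (t : ℝ) (z : Fin m → ℝ), (fun o : Option (ι ⊕ Fin m) => o.elim t (Sum.elim x z)) ∘ e =
        Sum.elim x (Fin.cons t z) := fun t z => by
      ext (i | i)
      · rfl
      · cases i using Fin.cases <;> rfl
    simp only [mem_ofPred_eq, this]
    constructor
    · rintro ⟨z, hz⟩
      exact ⟨Fin.tail z, z 0, by rwa [Fin.cons_self_tail]⟩
    · rintro ⟨z, t, hz⟩
      exact ⟨_, hz⟩

end SignDetermined

theorem IsSemialgebraic.signDetermined {k : ℕ} {A : Set (Fin k → ℝ)} (hA : IsSemialgebraic A) :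
    SignDetermined A := by
  obtain ⟨N, p, m, q, rfl⟩ := hA
  refine ⟨range p ∪ ⋃ i, range (q i), (finite_range p).union
    (finite_iUnion fun i => finite_range (q i)), fun x y hxy => ?_⟩
  simp only [mem_iUnion, mem_ofPred_eq]
  refine exists_congr fun i => and_congr ?_ (forall_congr' fun j => ?_)
  · rw [← sign_eq_zero_iff, hxy _ (Or.inl ⟨i, rfl⟩), sign_eq_zero_iff]
  · rw [← sign_eq_one_iff, hxy _ (Or.inr (mem_iUnion.2 ⟨i, j, rfl⟩)), sign_eq_one_iff]

theorem SignDetermined.isSemialgebraic {k : ℕ} {A : Set (Fin k → ℝ)} (hA : SignDetermined A) :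
    IsSemialgebraic A := by
  classical
  obtain ⟨G, hG, h⟩ := hA
  have := hG.fintype
  let T := {σ : G → SignType // ∃ x ∈ A, ∀ g : G, SignType.sign (MvPolynomial.eval x g.1) = σ g}
  let eT := Fintype.equivFin T
  let eG := Fintype.equivFin G
  refine ⟨Fintype.card T, fun i => ∑ g : G, if (eT.symm i).1 g = 0 then g.1 ^ 2 else 0,
    fun _ => Fintype.card G, fun i j =>
      if (eT.symm i).1 (eG.symm j) = 1 then (eG.symm j).1
      else if (eT.symm i).1 (eG.symm j) = -1 then -(eG.symm j).1 else 1, ?_⟩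
  have hpiece : ∀ (σ : G → SignType) (x : Fin k → ℝ),
      (∀ g : G, SignType.sign (MvPolynomial.eval x g.1) = σ g) ↔
      MvPolynomial.eval x (∑ g : G, if σ g = 0 then g.1 ^ 2 else 0) = 0 ∧
      ∀ g : G, 0 < MvPolynomial.eval x (if σ g = 1 then g.1 else if σ g = -1 then -g.1 else 1) := by
    intro σ x
    rw [map_sum, Finset.sum_eq_zero_iff_of_nonneg (by intro g _; split_ifs <;> simp [sq_nonneg])]
    simp only [Finset.mem_univ, true_implies]
    rw [← forall_and]
    refine forall_congr' fun g => ?_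
    cases σ g <;> simp [sign_eq_zero_iff, sign_eq_one_iff, sign_eq_neg_one_iff]
  ext x
  simp only [mem_iUnion, mem_ofPred_eq]
  constructor
  · intro hx
    refine ⟨eT ⟨fun g => SignType.sign (MvPolynomial.eval x g.1), x, hx, fun _ => rfl⟩, ?_⟩
    rw [Equiv.symm_apply_apply]
    have := (hpiece _ x).1 fun g => rfl
    exact ⟨this.1, fun j => this.2 (eG.symm j)⟩
  · rintro ⟨i, h₁, h₂⟩
    obtain ⟨y, hy, hσ⟩ := (eT.symm i).2
    refine (h x y fun g hg => ?_).2 hy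
    rw [hσ ⟨g, hg⟩, (hpiece _ x).2 ⟨h₁, fun g => by simpa using h₂ (eG g)⟩ ⟨g, hg⟩]

section LipschitzEnvelope

variable {E : Type*} [PseudoMetricSpace E] {M : Set E} {f : E → ℝ}

/-- The largest `1`-Lipschitz minorant of `f` on `M`. -/
noncomputable def lipschitzEnvelope (M : Set E) (f : E → ℝ) (x : E) : ℝ :=
  sInf ((fun y => f y + dist x y) '' M)

lemma bddBelow_add_dist (hf : ∀ y ∈ M, 0 ≤ f y) (x : E) :
    BddBelow ((fun y => f y + dist x y) '' M) :=
  ⟨0, by rintro _ ⟨y, hy, rfl⟩; exact add_nonneg (hf y hy) dist_nonneg⟩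

lemma lipschitzEnvelope_lt_iff (hf : ∀ y ∈ M, 0 ≤ f y) (hM : M.Nonempty) {x : E} {c : ℝ} :
    lipschitzEnvelope M f x < c ↔ ∃ y ∈ M, f y + dist x y < c := by
  rw [lipschitzEnvelope, csInf_lt_iff (bddBelow_add_dist hf x) (hM.image _)]
  simp

lemma lipschitzEnvelope_nonneg (hf : ∀ y ∈ M, 0 ≤ f y) (x : E) : 0 ≤ lipschitzEnvelope M f x :=
  Real.sInf_nonneg (by rintro _ ⟨y, hy, rfl⟩; exact add_nonneg (hf y hy) dist_nonneg)

lemma lipschitzEnvelope_le (hf : ∀ y ∈ M, 0 ≤ f y) {x : E} (hx : x ∈ M) :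
    lipschitzEnvelope M f x ≤ f x :=
  csInf_le (bddBelow_add_dist hf x) ⟨x, hx, by simp⟩

lemma continuous_lipschitzEnvelope (hf : ∀ y ∈ M, 0 ≤ f y) (hM : M.Nonempty) :
    Continuous (lipschitzEnvelope M f) := by
  refine (LipschitzWith.of_le_add fun x y => ?_).continuous
  rw [← sub_le_iff_le_add]
  refine le_csInf (hM.image _) ?_
  rintro _ ⟨z, hz, rfl⟩
  have := csInf_le (bddBelow_add_dist hf x) ⟨z, hz, rfl⟩
  have := dist_triangle x y z
  simp only [lipschitzEnvelope] at *
  linarith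

lemma eq_zero_of_lipschitzEnvelope_eq_zero (hf : ∀ y ∈ M, 0 ≤ f y) {x : E} (hx : x ∈ M)
    (hcont : ContinuousWithinAt f M x) (h : lipschitzEnvelope M f x = 0) : f x = 0 := by
  by_contra hne
  have hpos : 0 < f x := lt_of_le_of_ne (hf x hx) (Ne.symm hne)
  obtain ⟨δ, hδ, hball⟩ := Metric.continuousWithinAt_iff.1 hcont (f x / 2) (by positivity)
  obtain ⟨y, hy, hlt⟩ := (lipschitzEnvelope_lt_iff hf ⟨x, hx⟩ (x := x)
    (c := min δ (f x / 2))).1 (by rw [h]; positivity)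
  have h₁ := lt_min_iff.1 hlt
  have h₂ := hball hy (by rw [dist_comm]; linarith [hf y hy])
  rw [Real.dist_eq, abs_lt] at h₂
  linarith [dist_nonneg (x := x) (y := y)]

end LipschitzEnvelope

lemma signDetermined_graph_lipschitzEnvelope {n : ℕ} {M : Set (Fin n → ℝ)} (hM : SignDetermined M)
    {f : (Fin n → ℝ) → ℝ} (hf : ∀ x ∈ M, 0 ≤ f x)
    (hgraph : SignDetermined {z : Fin (n + 1) → ℝ | ∃ x ∈ M, z = Fin.snoc x (f x)}) :
    SignDetermined {z : Fin (n + 1) → ℝ | ∃ x ∈ M, z = Fin.snoc x (lipschitzEnvelope M f x)} := by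
  let last : Fin (n + 1) := Fin.last n
  let X : Fin (n + 1) ⊕ Fin (n + 1) → MvPolynomial (Fin (n + 1) ⊕ Fin (n + 1)) ℝ := MvPolynomial.X
  let gap := X (.inl last) - X (.inr last)
  let A : Set (Fin (n + 1) ⊕ Fin (n + 1) → ℝ) :=
    {w | w ∘ Sum.inr ∈ {z : Fin (n + 1) → ℝ | ∃ x ∈ M, z = Fin.snoc x (f x)}} ∩
    ({w | 0 < MvPolynomial.eval w gap} ∩
    ((⋂ i : Fin n, {w | 0 < MvPolynomial.eval w
      (gap - (X (.inl i.castSucc) - X (.inr i.castSucc)))}) ∩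
    ⋂ i : Fin n, {w | 0 < MvPolynomial.eval w
      (gap + (X (.inl i.castSucc) - X (.inr i.castSucc)))}))
  let S : Set (Fin (n + 1) → ℝ) := {u | ∃ z : Fin (n + 1) → ℝ, Sum.elim u z ∈ A}
  have hsub : SignDetermined S := SignDetermined.exists_sum_fin <|
    (hgraph.preimage_comp Sum.inr).inter <| (SignDetermined.setOf_pos _).inter <|
    (SignDetermined.iInter fun _ => SignDetermined.setOf_pos _).inter <|
    SignDetermined.iInter fun _ => SignDetermined.setOf_pos _
  have hmemS : ∀ u : Fin (n + 1) → ℝ, u ∈ S ↔ ∃ y ∈ M, f y + dist (Fin.init u) y < u last := by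
    intro u
    have hdist : ∀ y : Fin n → ℝ, f y + dist (Fin.init u) y < u last ↔
        0 < u last - f y ∧ (∀ i : Fin n, 0 < u last - f y - (u i.castSucc - y i)) ∧
        ∀ i : Fin n, 0 < u last - f y + (u i.castSucc - y i) := by
      intro y
      rw [← lt_sub_iff_add_lt', ← forall_and]
      constructor
      · intro h
        have h0 := dist_nonneg.trans_lt h
        refine ⟨h0, fun i => ?_⟩
        have := (dist_pi_lt_iff h0).1 h i
        rw [Real.dist_eq, abs_lt] at this
        simp only [Fin.init] at this
        constructor <;> linarith
      · rintro ⟨h0, h⟩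
        refine (dist_pi_lt_iff h0).2 fun i => ?_
        rw [Real.dist_eq, abs_lt]
        simp only [Fin.init]
        constructor <;> linarith [(h i).1, (h i).2]
    simp only [hdist]
    constructor
    · rintro ⟨z, ⟨y, hy, hz⟩, h⟩
      replace hz : z = Fin.snoc y (f y) := hz
      subst hz
      exact ⟨y, hy, by simpa [gap, X, last] using h⟩
    · rintro ⟨y, hy, h⟩
      exact ⟨Fin.snoc y (f y), ⟨y, hy, rfl⟩, by simpa [gap, X, last] using h⟩
  let e : Fin (n + 1) → Option (Fin (n + 1)) := Fin.snoc (fun i => some i.castSucc) none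
  have hcut := ((SignDetermined.setOf_pos
    (MvPolynomial.X none - MvPolynomial.X (some last) : MvPolynomial (Option (Fin (n + 1))) ℝ)).inter
    (hsub.compl.preimage_comp e)).exists_option
  convert! (hM.preimage_comp Fin.castSucc).inter (hsub.compl.inter hcut.compl) using 1
  ext u
  have hcomp : ∀ c : ℝ, (fun o : Option (Fin (n + 1)) => o.elim c u) ∘ e =
      Fin.snoc (Fin.init u) c := fun c => by
    ext i
    cases i using Fin.lastCases <;> simp [e, Fin.init]
  have hu : u ∈ {z : Fin (n + 1) → ℝ | ∃ x ∈ M, z = Fin.snoc x (lipschitzEnvelope M f x)} ↔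
      Fin.init u ∈ M ∧ u last = lipschitzEnvelope M f (Fin.init u) := by
    constructor
    · rintro ⟨x, hx, rfl⟩
      simpa [last] using hx
    · rintro ⟨h₁, h₂⟩
      exact ⟨_, h₁, by rw [← h₂]; exact (Fin.snoc_init_self u).symm⟩
  rw [hu]
  refine and_congr_right fun huM => ?_
  simp only [mem_inter_iff, mem_compl_iff, mem_ofPred_eq, hcomp, hmemS,
    ← lipschitzEnvelope_lt_iff hf ⟨_, huM⟩, Fin.init_snoc, not_exists, not_and, not_lt]
  simp only [map_sub, MvPolynomial.eval_X, Option.elim, sub_pos, last, Fin.snoc_last,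
    not_le]
  exact ⟨fun h => ⟨h.le, fun c hc => h ▸ hc⟩, fun h => le_antisymm h.1 (le_of_forall_gt h.2)⟩

end

/-- Let `M ⊆ ℝⁿ` be semialgebraic and `f : M → ℝ` a nonnegative function
with semialgebraic graph. Let `D ⊆ M` be the set of points of `M` where `f` is not
continuous (for the subspace topology on `M`). Then there is a continuous function
`g : M → ℝ` with semialgebraic graph such that `0 ≤ g ≤ f` on `M` and every zero
of `g` in `M` is either a zero of `f` or lies in the closure of `D`. -/
theorem exists_continuous_semialgebraic_minorant
    (n : ℕ) (M : Set (Fin n → ℝ)) (hM : IsSemialgebraic M)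
    (f : (Fin n → ℝ) → ℝ) (hf0 : ∀ x ∈ M, 0 ≤ f x)
    (hfgraph : IsSemialgebraic {z : Fin (n + 1) → ℝ | ∃ x ∈ M, z = Fin.snoc x (f x)})
    (D : Set (Fin n → ℝ)) (hD : D = {x ∈ M | ¬ ContinuousWithinAt f M x}) :
    ∃ g : (Fin n → ℝ) → ℝ,
      ContinuousOn g M ∧
      IsSemialgebraic {z : Fin (n + 1) → ℝ | ∃ x ∈ M, z = Fin.snoc x (g x)} ∧
      (∀ x ∈ M, 0 ≤ g x ∧ g x ≤ f x) ∧
      (∀ x ∈ M, g x = 0 → f x = 0 ∨ x ∈ closure D) := by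
  subst hD
  rcases M.eq_empty_or_nonempty with rfl | hne
  · exact ⟨f, by simp, hfgraph, by simp, by simp⟩
  refine ⟨lipschitzEnvelope M f, (continuous_lipschitzEnvelope hf0 hne).continuousOn,
    (signDetermined_graph_lipschitzEnvelope hM.signDetermined hf0
      hfgraph.signDetermined).isSemialgebraic,
    fun x hx => ⟨lipschitzEnvelope_nonneg hf0 x, lipschitzEnvelope_le hf0 hx⟩,
    fun x hx h => ?_⟩
  by_cases hc : ContinuousWithinAt f M x
  · exact Or.inl (eq_zero_of_lipschitzEnvelope_eq_zero hf0 hx hc h)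
  · exact Or.inr (subset_closure ⟨hx, hc⟩)
end

section
/- Let S ⊆ ℝⁿ be a semialgebraic set and let B(S) be the ring of polynomials bounded on S. For a polynomial f ∈ ℝ[x₁,…,xₙ], the following are equivalent: (i) there exists h ∈ B(S) with h ≠ 0 and f·h ∈ B(S) (i.e., f lies in the fraction field of B(S)); (ii) there exist m ≥ 1, polynomials φ₁, …, φ_m ∈ B(S), and a polynomial q ∈ ℝ[y₁,…,y_m] such that the polynomial q(φ₁,…,φ_m) ∈ ℝ[x₁,…,xₙ] is nonzero, and for every point y = (y₁,…,y_m) ∈ ℝ^m with q(y) ≠ 0 the polynomial f is bounded on the fibre S_y = {x ∈ S : φᵢ(x) = yᵢ for i = 1,…,m}. -/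
/-- `f` is bounded on `S` if the image of `S` under evaluation of `f` is bounded in `ℝ`. -/
def BddOn {n : ℕ} (S : Set (Fin n → ℝ)) (f : MvPolynomial (Fin n) ℝ) : Prop :=
  Bornology.IsBounded ((fun x => MvPolynomial.eval x f) '' S)


open Polynomial in
theorem Polynomial.monotoneOn_eval_of_derivative_nonneg {g : ℝ[X]} {D : Set ℝ} (hD : Convex ℝ D)
    (h : ∀ w ∈ D, 0 ≤ g.derivative.eval w) : MonotoneOn (fun w => g.eval w) D := by
  refine monotoneOn_of_deriv_nonneg hD g.continuous.continuousOn
    g.differentiable.differentiableOn fun w hw => ?_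
  rw [Polynomial.deriv]
  exact h w (interior_subset hw)

open Polynomial in
theorem Polynomial.antitoneOn_eval_of_derivative_nonpos {g : ℝ[X]} {D : Set ℝ} (hD : Convex ℝ D)
    (h : ∀ w ∈ D, g.derivative.eval w ≤ 0) : AntitoneOn (fun w => g.eval w) D := by
  refine antitoneOn_of_deriv_nonpos hD g.continuous.continuousOn
    g.differentiable.differentiableOn fun w hw => ?_
  rw [Polynomial.deriv]
  exact h w (interior_subset hw)

open Polynomial in
/-- A set on which all derivatives of `g` have prescribed signs is convex. -/
theorem Polynomial.sign_eval_eq_of_mem_Icc {u v : ℝ} {g : ℝ[X]}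
    (h : ∀ k, SignType.sign ((derivative^[k] g).eval u) =
      SignType.sign ((derivative^[k] g).eval v)) {w : ℝ} (hw : w ∈ Set.Icc u v) :
    SignType.sign (g.eval w) = SignType.sign (g.eval u) := by
  induction hn : g.natDegree using Nat.strong_induction_on generalizing g w with
  | _ n ih =>
    subst hn
    rcases Nat.eq_zero_or_pos g.natDegree with h0 | hpos
    · rw [Polynomial.eq_C_of_natDegree_eq_zero h0]
      simp
    have huv : u ≤ v := hw.1.trans hw.2
    have hd : ∀ w ∈ Set.Icc u v, SignType.sign (g.derivative.eval w) =
        SignType.sign (g.derivative.eval u) := fun w hw =>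
      ih _ (Polynomial.natDegree_derivative_lt hpos.ne') (fun k => h (k + 1)) hw rfl
    have hg := h 0
    simp only [Function.iterate_zero, id] at hg
    have hbetween : (g.eval u ≤ g.eval w ∧ g.eval w ≤ g.eval v) ∨
        (g.eval v ≤ g.eval w ∧ g.eval w ≤ g.eval u) := by
      rcases le_total 0 (g.derivative.eval u) with hs | hs
      · left
        have hm := Polynomial.monotoneOn_eval_of_derivative_nonneg (convex_Icc u v)
          fun w hw => by rwa [← sign_nonneg_iff, hd w hw, sign_nonneg_iff]
        exact ⟨hm (Set.left_mem_Icc.2 huv) hw hw.1, hm hw (Set.right_mem_Icc.2 huv) hw.2⟩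
      · right
        have hm := Polynomial.antitoneOn_eval_of_derivative_nonpos (convex_Icc u v)
          fun w hw => by rwa [← sign_nonpos_iff, hd w hw, sign_nonpos_iff]
        exact ⟨hm hw (Set.right_mem_Icc.2 huv) hw.2, hm (Set.left_mem_Icc.2 huv) hw hw.1⟩
    rcases hbetween with ⟨h1, h2⟩ | ⟨h1, h2⟩
    · exact le_antisymm ((SignType.sign.monotone h2).trans_eq hg.symm) (SignType.sign.monotone h1)
    · exact le_antisymm (SignType.sign.monotone h2) (hg.trans_le (SignType.sign.monotone h1))

open Polynomial in
theorem Polynomial.sign_eval_eq_of_no_root {g : ℝ[X]} {u v : ℝ}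
    (huv : u ≤ v) (h : ∀ w ∈ Set.Icc u v, g.eval w ≠ 0) :
    SignType.sign (g.eval u) = SignType.sign (g.eval v) := by
  have hc : ContinuousOn (fun w => g.eval w) (Set.Icc u v) := g.continuous.continuousOn
  rcases lt_trichotomy (g.eval u) 0 with hu | hu | hu
  · rcases lt_trichotomy (g.eval v) 0 with hv | hv | hv
    · rw [sign_neg hu, sign_neg hv]
    · exact absurd hv (h v (Set.right_mem_Icc.2 huv))
    · obtain ⟨w, hw, hw0⟩ := intermediate_value_Icc huv hc ⟨hu.le, hv.le⟩
      exact absurd hw0 (h w hw)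
  · exact absurd hu (h u (Set.left_mem_Icc.2 huv))
  · rcases lt_trichotomy (g.eval v) 0 with hv | hv | hv
    · obtain ⟨w, hw, hw0⟩ := intermediate_value_Icc' huv hc ⟨hv.le, hu.le⟩
      exact absurd hw0 (h w hw)
    · exact absurd hv (h v (Set.right_mem_Icc.2 huv))
    · rw [sign_pos hu, sign_pos hv]

/-- The first components of the pairs in `F` have at `u` the signs that the second components
have at `u'`. -/
def SameSigns (F : Set (Polynomial ℝ × Polynomial ℝ)) (u u' : ℝ) : Prop :=
  ∀ g ∈ F, SignType.sign (g.1.eval u) = SignType.sign (g.2.eval u')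

section SignMatching

open Polynomial

variable {F : Set (ℝ[X] × ℝ[X])}

theorem iterate_derivative_mem_of_derivative_mem
    (hD : ∀ g ∈ F, (derivative g.1, derivative g.2) ∈ F) {g : ℝ[X] × ℝ[X]} (hg : g ∈ F) (k : ℕ) :
    (derivative^[k] g.1, derivative^[k] g.2) ∈ F := by
  induction k with
  | zero => exact hg
  | succ k ih =>
    rw [Function.iterate_succ_apply', Function.iterate_succ_apply']
    exact hD (derivative^[k] g.1, derivative^[k] g.2) ih

/-- Thom's lemma: the signs of a family closed under derivation determine the order of points. -/
theorem SameSigns.lt_of_sign_ne (hD : ∀ g ∈ F, (derivative g.1, derivative g.2) ∈ F)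
    {u v u' v' : ℝ} (hu : SameSigns F u u') (hv : SameSigns F v v') (huv : u < v)
    {g : ℝ[X] × ℝ[X]} (hg : g ∈ F)
    (hne : SignType.sign (g.1.eval u) ≠ SignType.sign (g.1.eval v)) : u' < v' := by
  induction hn : g.1.natDegree using Nat.strong_induction_on generalizing g with
  | _ n ih =>
    subst hn
    have hpos : 0 < g.1.natDegree := by
      by_contra h0
      rw [Polynomial.eq_C_of_natDegree_eq_zero (by omega : g.1.natDegree = 0)] at hne
      simp at hne
    by_cases hk : ∃ k, SignType.sign ((derivative^[k] (derivative g.1)).eval u) ≠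
        SignType.sign ((derivative^[k] (derivative g.1)).eval v)
    · obtain ⟨k, hk⟩ := hk
      refine ih _ ?_ (iterate_derivative_mem_of_derivative_mem hD hg (k + 1)) hk rfl
      have := Polynomial.natDegree_iterate_derivative g.1 (k + 1)
      simp only
      omega
    · push Not at hk
      by_contra! hle
      have hmem := fun k => iterate_derivative_mem_of_derivative_mem hD hg (k + 1)
      have hk' : ∀ k, SignType.sign ((derivative^[k] (derivative g.2)).eval v') =
          SignType.sign ((derivative^[k] (derivative g.2)).eval u') := fun k =>
        ((hv _ (hmem k)).symm.trans (hk k).symm).trans (hu _ (hmem k))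
      have hd := fun w hw => Polynomial.sign_eval_eq_of_mem_Icc (w := w) hk hw
      have hd' := fun w hw => Polynomial.sign_eval_eq_of_mem_Icc (w := w) hk' hw
      have hdu : SignType.sign ((derivative g.2).eval v') =
          SignType.sign ((derivative g.1).eval u) := (hk' 0).trans (hu _ (hmem 0)).symm
      have hgu := hu _ hg
      have hgv := hv _ hg
      have mu := Set.left_mem_Icc.2 huv.le
      have mv := Set.right_mem_Icc.2 huv.le
      have mu' := Set.right_mem_Icc.2 hle
      have mv' := Set.left_mem_Icc.2 hle
      rcases le_total 0 (g.1.derivative.eval u) with hs | hs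
      · have hm := Polynomial.monotoneOn_eval_of_derivative_nonneg (convex_Icc u v)
          fun w hw => by rwa [← sign_nonneg_iff, hd w hw, sign_nonneg_iff]
        have hm' := Polynomial.monotoneOn_eval_of_derivative_nonneg (convex_Icc v' u')
          fun w hw => by rwa [← sign_nonneg_iff, hd' w hw, hdu, sign_nonneg_iff]
        have h1 := SignType.sign.monotone (hm mu mv huv.le)
        have h2 := SignType.sign.monotone (hm' mv' mu' hle)
        simp only at h1 h2
        rw [← hgu, ← hgv] at h2
        exact hne (le_antisymm h1 h2)
      · have hm := Polynomial.antitoneOn_eval_of_derivative_nonpos (convex_Icc u v)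
          fun w hw => by rwa [← sign_nonpos_iff, hd w hw, sign_nonpos_iff]
        have hm' := Polynomial.antitoneOn_eval_of_derivative_nonpos (convex_Icc v' u')
          fun w hw => by rwa [← sign_nonpos_iff, hd' w hw, hdu, sign_nonpos_iff]
        have h1 := SignType.sign.monotone (hm mu mv huv.le)
        have h2 := SignType.sign.monotone (hm' mv' mu' hle)
        simp only at h1 h2
        rw [← hgu, ← hgv] at h2
        exact hne (le_antisymm h2 h1)

/-- Two distinct points with equal signs for a family closed under derivation are not zeros of
nonzero members. -/
theorem eval_ne_zero_of_sign_eq (hD : ∀ g ∈ F, (derivative g.1, derivative g.2) ∈ F)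
    {u v : ℝ} (huv : u < v)
    (h : ∀ g ∈ F, SignType.sign (g.1.eval u) = SignType.sign (g.1.eval v))
    {g : ℝ[X] × ℝ[X]} (hg : g ∈ F) (hg0 : g.1 ≠ 0) : g.1.eval v ≠ 0 := by
  intro hv
  refine hg0 (Polynomial.eq_zero_of_infinite_isRoot _ ((Set.Icc_infinite huv).mono fun w hw => ?_))
  have := Polynomial.sign_eval_eq_of_mem_Icc
    (fun k => h _ (iterate_derivative_mem_of_derivative_mem hD hg k)) hw
  rwa [h g hg, hv, sign_zero, sign_eq_zero_iff] at this

/-- If `p` is increasing and nonnegative at `x`, and the zeros of `F` carry matching signs of `p`,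
then `p` takes positive values on the matching cell. -/
theorem SameSigns.exists_pos (hF : F.Finite)
    (hD : ∀ g ∈ F, (derivative g.1, derivative g.2) ∈ F)
    (hz : ∀ g ∈ F, g.1 = 0 ↔ g.2 = 0) {p : ℝ[X] × ℝ[X]}
    (hp : (derivative p.1, derivative p.2) ∈ F)
    (hforth : ∀ x, ∃ x', SameSigns F x x')
    (hback : ∀ x', ∃ x, SameSigns F x x' ∧ ((∃ g ∈ F, g.2 ≠ 0 ∧ g.2.eval x' = 0) →
      SignType.sign (p.1.eval x) = SignType.sign (p.2.eval x')))
    {x x' : ℝ} (hx : SameSigns F x x') (hx' : ∀ g ∈ F, g.2 ≠ 0 → g.2.eval x' ≠ 0)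
    (hdx : 0 < (derivative p.1).eval x) (hpx : 0 ≤ p.1.eval x) :
    ∃ z', SameSigns F x z' ∧ 0 < p.2.eval z' := by
  have hdp1 : derivative p.1 ≠ 0 := fun h => by simp [h] at hdx
  have hdp2 : derivative p.2 ≠ 0 := fun h => hdp1 ((hz _ hp).2 h)
  have hdx' : 0 < (derivative p.2).eval x' := by
    rw [← sign_eq_one_iff, ← hx _ hp, sign_eq_one_iff]
    exact hdx
  -- points reached from `x'` without crossing a zero of `F` have the same signs
  have hcell : ∀ z', x' ≤ z' → (∀ g ∈ F, g.2 ≠ 0 → ∀ w ∈ Set.Icc x' z', g.2.eval w ≠ 0) →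
      SameSigns F x z' := by
    intro z' hz' hw g hg
    rw [hx g hg]
    by_cases hg0 : g.2 = 0
    · simp [hg0]
    · exact Polynomial.sign_eval_eq_of_no_root hz' (hw g hg hg0)
  let Z : Set ℝ := {w | x' < w ∧ ∃ g ∈ F, g.2 ≠ 0 ∧ g.2.eval w = 0}
  have hZ : Z.Finite := by
    refine (hF.biUnion (t := fun g => {w | g.2 ≠ 0 ∧ g.2.eval w = 0}) fun g _ => ?_).subset ?_
    · by_cases hg0 : g.2 = 0
      · simp [hg0]
      · exact (g.2.rootSet_finite ℝ).subset fun w hw => by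
          simpa [Polynomial.mem_rootSet, hg0] using hw.2
    · rintro w ⟨-, g, hg, hgw⟩
      exact Set.mem_biUnion hg hgw
  by_cases hZe : Z.Nonempty
  · obtain ⟨b', ⟨hxb', g₀, hg₀, hg₀0, hg₀b⟩, hmin⟩ := hZ.exists_minimal hZe
    have hmin' : ∀ w, x' ≤ w → w < b' → ∀ g ∈ F, g.2 ≠ 0 → g.2.eval w ≠ 0 := by
      intro w hw hwb g hg hg0 hgw
      rcases hw.eq_or_lt with rfl | hw
      · exact hx' g hg hg0 hgw
      · exact absurd (hmin ⟨hw, g, hg, hg0, hgw⟩ hwb.le) (not_le.2 hwb)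
    obtain ⟨b, hb, hpb⟩ := hback b'
    specialize hpb ⟨g₀, hg₀, hg₀0, hg₀b⟩
    have hg₀1 : g₀.1 ≠ 0 := fun h => hg₀0 ((hz _ hg₀).1 h)
    have hg₀b1 : g₀.1.eval b = 0 := by
      rw [← sign_eq_zero_iff, hb _ hg₀, sign_eq_zero_iff, hg₀b]
    have hg₀x1 : g₀.1.eval x ≠ 0 := by
      rw [← sign_ne_zero, hx _ hg₀, sign_ne_zero]
      exact hx' _ hg₀ hg₀0
    have hxb : x < b := by
      rcases lt_trichotomy x b with h | h | h
      · exact h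
      · exact absurd (h ▸ hg₀b1) hg₀x1
      · refine absurd (hb.lt_of_sign_ne hD hx h hg₀ ?_) (not_lt.2 hxb'.le)
        rw [hg₀b1, sign_zero]
        exact (sign_ne_zero.2 hg₀x1).symm
    have hnz : ∀ c ∈ Set.Ico x b, (derivative p.1).eval c ≠ 0 := by
      rintro c ⟨hxc, hcb⟩ hc0
      rcases hxc.eq_or_lt with rfl | hxc
      · exact hdx.ne' hc0
      obtain ⟨c', hc⟩ := hforth c
      have hc0' : (derivative p.2).eval c' = 0 := by
        rw [← sign_eq_zero_iff, ← hc _ hp, sign_eq_zero_iff]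
        exact hc0
      have hxc' : x' < c' := by
        refine hx.lt_of_sign_ne hD hc hxc hp ?_
        simp only
        rw [hc0, sign_zero]
        exact sign_ne_zero.2 hdx.ne'
      by_cases hs : ∀ g ∈ F, SignType.sign (g.1.eval c) = SignType.sign (g.1.eval b)
      · exact eval_ne_zero_of_sign_eq hD hcb hs hg₀ hg₀1 hg₀b1
      · push Not at hs
        obtain ⟨g, hg, hgs⟩ := hs
        exact hmin' c' hxc'.le (hc.lt_of_sign_ne hD hb hcb hg hgs) _ hp hdp2 hc0'
    have hmono : StrictMonoOn (fun w => p.1.eval w) (Set.Icc x b) := by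
      refine strictMonoOn_of_deriv_pos (convex_Icc x b) p.1.continuous.continuousOn fun w hw => ?_
      rw [interior_Icc] at hw
      rw [Polynomial.deriv, ← sign_eq_one_iff, ← Polynomial.sign_eval_eq_of_no_root hw.1.le
        fun c hc => hnz c ⟨hc.1, hc.2.trans_lt hw.2⟩]
      exact sign_pos hdx
    have hpos : 0 < p.2.eval b' := by
      rw [← sign_eq_one_iff, ← hpb, sign_eq_one_iff]
      exact hpx.trans_lt (hmono (Set.left_mem_Icc.2 hxb.le) (Set.right_mem_Icc.2 hxb.le) hxb)
    have hev : ∀ᶠ w in nhdsWithin b' (Set.Iio b'), 0 < p.2.eval w :=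
      (p.2.continuous.tendsto b').mono_left nhdsWithin_le_nhds |>.eventually_const_lt hpos
    obtain ⟨z', hz'p, hxz', hz'b⟩ := (hev.and (Ioo_mem_nhdsLT hxb')).exists
    exact ⟨z', hcell z' hxz'.le fun g hg hg0 w hw =>
      hmin' w hw.1 (hw.2.trans_lt hz'b) g hg hg0, hz'p⟩
  · have hnr : ∀ g ∈ F, g.2 ≠ 0 → ∀ w, x' ≤ w → g.2.eval w ≠ 0 := by
      intro g hg hg0 w hw hgw
      rcases hw.eq_or_lt with rfl | hw
      · exact hx' g hg hg0 hgw
      · exact hZe ⟨w, hw, g, hg, hg0, hgw⟩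
    by_contra! hcon
    have hle : ∀ w, x' ≤ w → p.2.eval w ≤ 0 := fun w hw =>
      hcon w (hcell w hw fun g hg hg0 c hc => hnr g hg hg0 c hc.1)
    have hmono : MonotoneOn (fun w => p.2.eval w) (Set.Ici x') := by
      refine Polynomial.monotoneOn_eval_of_derivative_nonneg (convex_Ici x') fun w hw => ?_
      rw [← sign_nonneg_iff, ← Polynomial.sign_eval_eq_of_no_root hw
        fun c hc => hnr _ hp hdp2 c hc.1, sign_nonneg_iff]
      exact hdx'.le
    have hbdd : Filter.IsBoundedUnder (· ≤ ·) Filter.atTop fun w => |p.2.eval w| := by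
      refine ⟨|p.2.eval x'|, ?_⟩
      rw [Filter.eventually_map]
      filter_upwards [Filter.eventually_ge_atTop x'] with w hw
      have h1 := hmono Set.self_mem_Ici hw hw
      rw [abs_of_nonpos (hle w hw), abs_of_nonpos (hle x' le_rfl)]
      simpa using h1
    rw [Polynomial.isBoundedUnder_abs_atTop_iff] at hbdd
    exact hdp2 (by rw [Polynomial.eq_C_of_degree_le_zero hbdd, derivative_C])

theorem sameSigns_image_comp_neg_X {u u' : ℝ} :
    SameSigns ((fun g : ℝ[X] × ℝ[X] => (g.1.comp (-X), g.2.comp (-X))) '' F) u u' ↔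
      SameSigns F (-u) (-u') := by
  simp only [SameSigns, Set.forall_mem_image, eval_comp, eval_neg, eval_X]

/-- If `p` is increasing and nonpositive at `x`, and the zeros of `F` carry matching signs of `p`,
then `p` takes negative values on the matching cell. -/
theorem SameSigns.exists_neg (hF : F.Finite)
    (hD : ∀ g ∈ F, (derivative g.1, derivative g.2) ∈ F) (hN : ∀ g ∈ F, -g ∈ F)
    (hz : ∀ g ∈ F, g.1 = 0 ↔ g.2 = 0) {p : ℝ[X] × ℝ[X]}
    (hp : (derivative p.1, derivative p.2) ∈ F)
    (hforth : ∀ x, ∃ x', SameSigns F x x')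
    (hback : ∀ x', ∃ x, SameSigns F x x' ∧ ((∃ g ∈ F, g.2 ≠ 0 ∧ g.2.eval x' = 0) →
      SignType.sign (p.1.eval x) = SignType.sign (p.2.eval x')))
    {x x' : ℝ} (hx : SameSigns F x x') (hx' : ∀ g ∈ F, g.2 ≠ 0 → g.2.eval x' ≠ 0)
    (hdx : 0 < (derivative p.1).eval x) (hpx : p.1.eval x ≤ 0) :
    ∃ z', SameSigns F x z' ∧ p.2.eval z' < 0 := by
  obtain ⟨z', h1, h2⟩ := SameSigns.exists_pos
    (F := (fun g : ℝ[X] × ℝ[X] => (g.1.comp (-X), g.2.comp (-X))) '' F)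
    (p := (-(p.1.comp (-X)), -(p.2.comp (-X)))) (x := -x) (x' := -x') (hF.image _)
    (by
      rintro _ ⟨g, hg, rfl⟩
      exact ⟨_, hD _ (hN g hg), by simp [derivative_comp]⟩)
    (by
      rintro _ ⟨g, hg, rfl⟩
      simpa only [comp_neg_X_eq_zero_iff] using hz g hg)
    ⟨_, hp, by simp [derivative_comp]⟩
    (fun z => by
      obtain ⟨z', hz'⟩ := hforth (-z)
      exact ⟨-z', sameSigns_image_comp_neg_X.2 (by simpa using hz')⟩)
    (fun z' => by
      obtain ⟨z, hz1, hz2⟩ := hback (-z')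
      refine ⟨-z, sameSigns_image_comp_neg_X.2 (by simpa using hz1), ?_⟩
      rintro ⟨_, ⟨g, hg, rfl⟩, hg0, hgz⟩
      have := hz2 ⟨g, hg, fun h => hg0 (comp_neg_X_eq_zero_iff.2 h), by simpa [eval_comp] using hgz⟩
      simpa [eval_comp, Left.sign_neg] using this)
    (sameSigns_image_comp_neg_X.2 (by simpa using hx))
    (by
      rintro _ ⟨g, hg, rfl⟩ hg0
      simpa [eval_comp] using hx' g hg fun h => hg0 (comp_neg_X_eq_zero_iff.2 h))
    (by simpa [derivative_comp, eval_comp] using hdx)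
    (by simpa [eval_comp] using hpx)
  exact ⟨-z', by simpa using sameSigns_image_comp_neg_X.1 h1, by simpa [eval_comp] using h2⟩

theorem SameSigns.exists_sign_eq_of_increasing (hF : F.Finite)
    (hD : ∀ g ∈ F, (derivative g.1, derivative g.2) ∈ F) (hN : ∀ g ∈ F, -g ∈ F)
    (hz : ∀ g ∈ F, g.1 = 0 ↔ g.2 = 0) {p : ℝ[X] × ℝ[X]}
    (hp : (derivative p.1, derivative p.2) ∈ F)
    (hforth : ∀ x, ∃ x', SameSigns F x x')
    (hback : ∀ x', ∃ x, SameSigns F x x' ∧ ((∃ g ∈ F, g.2 ≠ 0 ∧ g.2.eval x' = 0) →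
      SignType.sign (p.1.eval x) = SignType.sign (p.2.eval x')))
    {x x' : ℝ} (hx : SameSigns F x x') (hx' : ∀ g ∈ F, g.2 ≠ 0 → g.2.eval x' ≠ 0)
    (hdx : 0 < (derivative p.1).eval x) :
    ∃ z', SameSigns F x z' ∧ SignType.sign (p.1.eval x) = SignType.sign (p.2.eval z') := by
  have hpos := hx.exists_pos hF hD hz hp hforth hback hx' hdx
  have hneg := hx.exists_neg hF hD hN hz hp hforth hback hx' hdx
  rcases lt_trichotomy (p.1.eval x) 0 with h | h | h
  · obtain ⟨z, hz1, hz2⟩ := hneg h.le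
    exact ⟨z, hz1, by rw [sign_neg h, sign_neg hz2]⟩
  · obtain ⟨u, hu1, hu2⟩ := hneg h.le
    obtain ⟨v, hv1, hv2⟩ := hpos h.ge
    obtain ⟨w, hw, hw0⟩ := intermediate_value_uIcc (a := u) (b := v) (f := fun w => p.2.eval w)
      p.2.continuous.continuousOn (Set.mem_uIcc.2 (Or.inl ⟨hu2.le, hv2.le⟩))
    simp only at hw0
    refine ⟨w, fun g hg => ?_, by rw [h, hw0]⟩
    have hk : ∀ k, SignType.sign ((derivative^[k] g.2).eval u) =
        SignType.sign ((derivative^[k] g.2).eval v) := fun k =>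
      have := iterate_derivative_mem_of_derivative_mem hD hg k
      (hu1 _ this).symm.trans (hv1 _ this)
    rcases Set.mem_uIcc.1 hw with hw | hw
    · rw [Polynomial.sign_eval_eq_of_mem_Icc hk hw, hu1 g hg]
    · rw [Polynomial.sign_eval_eq_of_mem_Icc (fun k => (hk k).symm) hw, hv1 g hg]
  · obtain ⟨z, hz1, hz2⟩ := hpos h.le
    exact ⟨z, hz1, by rw [sign_pos h, sign_pos hz2]⟩

/-- Matching points for `F` and `p`, given matching points for `F` under which the sign of `p`
matches at the zeros of nonzero members of `F`. -/
theorem exists_sameSigns_and_sign_eq (hF : F.Finite)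
    (hD : ∀ g ∈ F, (derivative g.1, derivative g.2) ∈ F) (hN : ∀ g ∈ F, -g ∈ F)
    (hz : ∀ g ∈ F, g.1 = 0 ↔ g.2 = 0) {p : ℝ[X] × ℝ[X]}
    (hp : (derivative p.1, derivative p.2) ∈ F)
    (hc : SignType.sign (p.1.coeff 0) = SignType.sign (p.2.coeff 0))
    (hforth : ∀ x, ∃ x', SameSigns F x x' ∧ ((∃ g ∈ F, g.1 ≠ 0 ∧ g.1.eval x = 0) →
      SignType.sign (p.1.eval x) = SignType.sign (p.2.eval x')))
    (hback : ∀ x', ∃ x, SameSigns F x x' ∧ ((∃ g ∈ F, g.2 ≠ 0 ∧ g.2.eval x' = 0) →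
      SignType.sign (p.1.eval x) = SignType.sign (p.2.eval x'))) (x : ℝ) :
    ∃ x', SameSigns F x x' ∧ SignType.sign (p.1.eval x) = SignType.sign (p.2.eval x') := by
  obtain ⟨x', hx, hroot⟩ := hforth x
  by_cases h : ∃ g ∈ F, g.1 ≠ 0 ∧ g.1.eval x = 0
  · exact ⟨x', hx, hroot h⟩
  push Not at h
  have hx' : ∀ g ∈ F, g.2 ≠ 0 → g.2.eval x' ≠ 0 := by
    intro g hg hg0
    rw [← sign_ne_zero, ← hx g hg, sign_ne_zero]
    exact h g hg fun h0 => hg0 ((hz g hg).1 h0)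
  by_cases hdp : derivative p.1 = 0
  · have hdp2 : derivative p.2 = 0 := (hz _ hp).1 hdp
    refine ⟨x', hx, ?_⟩
    rw [eq_C_of_derivative_eq_zero hdp, eq_C_of_derivative_eq_zero hdp2]
    simpa using hc
  rcases (h _ hp hdp).lt_or_gt with hdx | hdx
  · obtain ⟨z, hz1, hz2⟩ := hx.exists_sign_eq_of_increasing (p := -p) hF hD hN hz
      (by simpa using hN _ hp) (fun x => (hforth x).imp fun _ h => h.1)
      (fun x' => (hback x').imp fun _ h => ⟨h.1, fun hr => by
        simpa [Left.sign_neg] using h.2 hr⟩) hx' (by simpa using hdx)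
    exact ⟨z, hz1, by simpa [Left.sign_neg] using hz2⟩
  · exact hx.exists_sign_eq_of_increasing hF hD hN hz hp (fun x => (hforth x).imp fun _ h => h.1)
      hback hx' hdx

end SignMatching

section Elimination

open Polynomial

variable {A : Type*} [CommRing A]

/-- Pseudo-division: at the zeros of a specialization of `r` of degree `j`, the sign of `p` is
that of a polynomial of degree less than `j`. -/
theorem exists_degree_lt_sign_eq_at_roots (r : A[X]) (j : ℕ) (p : A[X]) :
    ∃ ρ : A[X], ρ.degree < j ∧ ∀ (y : A →+* ℝ) (x : ℝ), (r.map y).natDegree = j → r.map y ≠ 0 →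
      (r.map y).eval x = 0 →
      SignType.sign ((p.map y).eval x) = SignType.sign ((ρ.map y).eval x) := by
  suffices ∀ (n : ℕ) (p : A[X]), p.degree < n →
      ∃ ρ : A[X], ρ.degree < j ∧ ∀ (y : A →+* ℝ) (x : ℝ), (r.map y).natDegree = j →
        r.map y ≠ 0 → (r.map y).eval x = 0 →
        SignType.sign ((p.map y).eval x) = SignType.sign ((ρ.map y).eval x) from
    this (p.natDegree + 1) p (degree_le_natDegree.trans_lt (by exact_mod_cast Nat.lt_succ_self _))
  intro n
  induction n with
  | zero =>
    intro p hp
    exact ⟨p, hp.trans_le (by simp), fun _ _ _ _ _ => rfl⟩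
  | succ n ih =>
    intro p hp
    rcases lt_or_ge n j with hnj | hjn
    · exact ⟨p, hp.trans_le (by exact_mod_cast hnj), fun _ _ _ _ _ => rfl⟩
    let t : A[X] := ∑ i ∈ Finset.range (j + 1), monomial i (r.coeff i)
    have ht : ∀ i, t.coeff i = if i ≤ j then r.coeff i else 0 := by
      intro i
      simp [t, finsetSum_coeff, coeff_monomial]
    obtain ⟨ρ, hρ, hsign⟩ := ih (C (r.coeff j ^ 2) * p - C (r.coeff j * p.coeff n) * (X ^ (n - j) * t))
      (by
        rw [degree_lt_iff_coeff_zero] at hp ⊢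
        intro m hm
        simp only [coeff_sub, coeff_C_mul, coeff_X_pow_mul', ht]
        rcases hm.eq_or_lt with rfl | hm
        · rw [if_pos (Nat.sub_le _ _), if_pos (by omega), show n - (n - j) = j by omega]
          ring
        · rw [if_pos (by omega : n - j ≤ m), if_neg (by omega), hp m hm]
          ring)
    refine ⟨ρ, hρ, fun y x hdeg hr0 hrx => ?_⟩
    have htr : t.map y = r.map y := by
      ext i
      rw [coeff_map, coeff_map, ht]
      split_ifs with hi
      · rfl
      · rw [map_zero, ← coeff_map, coeff_eq_zero_of_natDegree_lt (by omega)]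
    have hc : y (r.coeff j) ≠ 0 := by
      rw [← coeff_map, ← hdeg]
      exact leadingCoeff_ne_zero.2 hr0
    rw [← hsign y x hdeg hr0 hrx]
    have heval : ((C (r.coeff j ^ 2) * p - C (r.coeff j * p.coeff n) * (X ^ (n - j) * t)).map y).eval x
        = y (r.coeff j) ^ 2 * (p.map y).eval x := by
      simp [htr, hrx]
    rw [heval, sign_mul, sign_pos (by positivity : 0 < y (r.coeff j) ^ 2), one_mul]

/-- The signs of the elements of `Q` at a real point of `A` determine which sign conditions on the
members of `P` are realized over that point. -/
def DeterminesSigns (Q : Set A) (P : Set A[X]) : Prop :=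
  ∀ y y' : A →+* ℝ, (∀ a ∈ Q, SignType.sign (y a) = SignType.sign (y' a)) →
    ∀ x, ∃ x', ∀ p ∈ P, SignType.sign ((p.map y).eval x) = SignType.sign ((p.map y').eval x')

theorem DeterminesSigns.insert {F R : Set A[X]} {Q : Set A} {p : A[X]} (hF : F.Finite)
    (hD : ∀ g ∈ F, derivative g ∈ F) (hp : derivative p ∈ F)
    (hR : ∀ r ∈ F, ∀ j ≤ r.natDegree, ∃ ρ ∈ R, ∀ (y : A →+* ℝ) (x : ℝ), (r.map y).natDegree = j →
      r.map y ≠ 0 → (r.map y).eval x = 0 →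
      SignType.sign ((p.map y).eval x) = SignType.sign ((ρ.map y).eval x))
    (hQ : DeterminesSigns Q (F ∪ R)) :
    DeterminesSigns (insert (p.coeff 0) (Q ∪ ⋃ g ∈ F, (g.coeffs : Set A))) (insert p F) := by
  have key : ∀ y y' : A →+* ℝ, (∀ a ∈ Q, SignType.sign (y a) = SignType.sign (y' a)) →
      ∀ x, ∃ x', (∀ g ∈ F, SignType.sign ((g.map y).eval x) = SignType.sign ((g.map y').eval x')) ∧
        ((∃ g ∈ F, g.map y ≠ 0 ∧ g.map y' ≠ 0 ∧ (g.map y).natDegree = (g.map y').natDegree ∧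
          (g.map y).eval x = 0) →
        SignType.sign ((p.map y).eval x) = SignType.sign ((p.map y').eval x')) := by
    intro y y' hy x
    obtain ⟨x', hx'⟩ := hQ y y' hy x
    refine ⟨x', fun g hg => hx' g (Or.inl hg), ?_⟩
    rintro ⟨g, hg, h0, h0', hdeg, hgx⟩
    obtain ⟨ρ, hρ, h⟩ := hR g hg _ (natDegree_map_le (f := y))
    rw [h y x rfl h0 hgx, hx' ρ (Or.inr hρ), h y' x' hdeg.symm h0']
    rw [← sign_eq_zero_iff, ← hx' g (Or.inl hg), sign_eq_zero_iff, hgx]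
  intro y y' hy
  have hyQ : ∀ a ∈ Q, SignType.sign (y a) = SignType.sign (y' a) := fun a ha =>
    hy a (Or.inr (Or.inl ha))
  have hcoeff : ∀ g ∈ F, ∀ i, y (g.coeff i) = 0 ↔ y' (g.coeff i) = 0 := by
    intro g hg i
    by_cases hi : g.coeff i = 0
    · simp [hi]
    · rw [← sign_eq_zero_iff, hy _ (Or.inr (Or.inr (Set.mem_biUnion hg
        (coeff_mem_coeffs hi)))), sign_eq_zero_iff]
  have hsupp : ∀ g ∈ F, (g.map y).support = (g.map y').support := by
    intro g hg
    ext i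
    simp only [mem_support_iff, coeff_map, ne_eq, hcoeff g hg i]
  have hzero : ∀ g ∈ F, g.map y = 0 ↔ g.map y' = 0 := fun g hg => by
    rw [← support_eq_empty, hsupp g hg, support_eq_empty]
  have hdeg : ∀ g ∈ F, (g.map y).natDegree = (g.map y').natDegree := fun g hg =>
    natDegree_eq_of_degree_eq (by simp only [degree, hsupp g hg])
  let φ : A[X] → ℝ[X] × ℝ[X] := fun g => (g.map y, g.map y')
  have hφ : ∀ x x', (∀ g ∈ F, SignType.sign ((g.map y).eval x) =
      SignType.sign ((g.map y').eval x')) → SameSigns (φ '' (F ∪ Neg.neg '' F)) x x' := by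
    rintro x x' h _ ⟨g, hg | ⟨g, hg, rfl⟩, rfl⟩
    · exact h g hg
    · simpa [φ, Left.sign_neg] using h g hg
  intro x
  obtain ⟨x', hx', hpx⟩ := exists_sameSigns_and_sign_eq (F := φ '' (F ∪ Neg.neg '' F)) (p := φ p)
    ((hF.union (hF.image _)).image _)
    (by
      rintro _ ⟨g, hg | ⟨g, hg, rfl⟩, rfl⟩
      · exact ⟨_, Or.inl (hD g hg), by simp [φ, derivative_map]⟩
      · exact ⟨_, Or.inr ⟨_, hD g hg, rfl⟩, by simp [φ, derivative_map]⟩)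
    (by
      rintro _ ⟨g, hg | ⟨g, hg, rfl⟩, rfl⟩
      · exact ⟨_, Or.inr ⟨_, hg, rfl⟩, by simp [φ]⟩
      · exact ⟨_, Or.inl hg, by simp [φ]⟩)
    (by
      rintro _ ⟨g, hg | ⟨g, hg, rfl⟩, rfl⟩
      · exact hzero g hg
      · simpa [φ] using hzero g hg)
    ⟨_, Or.inl hp, by simp [φ, derivative_map]⟩
    (by simpa [φ] using hy _ (Or.inl rfl))
    (fun x => by
      obtain ⟨x', h1, h2⟩ := key y y' hyQ x
      refine ⟨x', hφ x x' h1, ?_⟩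
      rintro ⟨_, ⟨g, hg | ⟨g, hg, rfl⟩, rfl⟩, h0, hgx⟩
      · exact h2 ⟨g, hg, h0, fun h => h0 ((hzero g hg).2 h), hdeg g hg, hgx⟩
      · have h0 : g.map y ≠ 0 := by simpa [φ] using h0
        exact h2 ⟨g, hg, h0, fun h => h0 ((hzero g hg).2 h), hdeg g hg, by simpa [φ] using hgx⟩)
    (fun x' => by
      obtain ⟨x, h1, h2⟩ := key y' y (fun a ha => (hyQ a ha).symm) x'
      refine ⟨x, hφ x x' fun g hg => (h1 g hg).symm, ?_⟩
      rintro ⟨_, ⟨g, hg | ⟨g, hg, rfl⟩, rfl⟩, h0, hgx⟩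
      · exact (h2 ⟨g, hg, h0, fun h => h0 ((hzero g hg).1 h), (hdeg g hg).symm, hgx⟩).symm
      · have h0 : g.map y' ≠ 0 := by simpa [φ] using h0
        exact (h2 ⟨g, hg, h0, fun h => h0 ((hzero g hg).1 h), (hdeg g hg).symm,
          by simpa [φ] using hgx⟩).symm) x
  refine ⟨x', ?_⟩
  rintro g (rfl | hg)
  · exact hpx
  · exact hx' _ ⟨g, Or.inl hg, rfl⟩

theorem exists_determinesSigns_of_degree_lt (d : ℕ) {P : Set A[X]} (hP : P.Finite)
    (hd : ∀ p ∈ P, p.degree < d) : ∃ Q : Set A, Q.Finite ∧ DeterminesSigns Q P := by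
  induction d generalizing P with
  | zero =>
    refine ⟨∅, Set.finite_empty, fun y y' _ x => ⟨x, fun p hp => ?_⟩⟩
    have : p = 0 := by simpa using hd p hp
    simp [this]
  | succ d ih =>
    suffices ∀ L : Set A[X], L.Finite → (∀ p ∈ L, p.degree < d) →
        ∃ Q : Set A, Q.Finite ∧ DeterminesSigns Q (L ∪ P) by
      simpa using this ∅ Set.finite_empty (by simp)
    induction P, hP using Set.Finite.induction_on with
    | empty =>
      intro L hL hLd
      simpa using ih hL hLd
    | @insert p P _ hP ihP =>
      intro L hL hLd
      have hder : ∀ g : A[X], g.degree < (d + 1 : ℕ) → ∀ k, (derivative^[k + 1] g).degree < d := by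
        intro g hg k
        rw [degree_lt_iff_coeff_zero] at hg ⊢
        intro m hm
        rw [coeff_iterate_derivative, hg _ (by omega), smul_zero]
      let E : Set A[X] := ⋃ g ∈ Insert.insert p (L ∪ P), Set.range fun k => derivative^[k + 1] g
      have hEd : ∀ e ∈ E, e.degree < d := by
        intro e he
        simp only [E, Set.mem_iUnion] at he
        obtain ⟨g, hg, k, rfl⟩ := he
        refine hder g ?_ k
        rcases hg with rfl | hg | hg
        · exact hd _ (Set.mem_insert _ _)
        · exact (hLd g hg).trans (by exact_mod_cast Nat.lt_succ_self d)
        · exact hd _ (Set.mem_insert_of_mem _ hg)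
      have hE : E.Finite := by
        refine ((hL.union hP).insert p).biUnion fun g _ => ?_
        refine (((Set.finite_Iic g.natDegree).image fun k => derivative^[k + 1] g).insert 0).subset ?_
        rintro _ ⟨k, rfl⟩
        rcases le_or_gt k g.natDegree with hk | hk
        · exact Or.inr ⟨k, hk, rfl⟩
        · exact Or.inl (iterate_derivative_eq_zero (by omega))
      have hderE : ∀ g ∈ Insert.insert p (L ∪ P), ∀ k, derivative^[k + 1] g ∈ E := fun g hg k =>
        Set.mem_biUnion hg ⟨k, rfl⟩
      choose ρ hρ hρs using fun (r : A[X]) (j : ℕ) => exists_degree_lt_sign_eq_at_roots r j p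
      let F : Set A[X] := L ∪ P ∪ E
      have hF : F.Finite := (hL.union hP).union hE
      have hFd : ∀ r ∈ F, r.natDegree ≤ d := by
        intro r hr
        refine natDegree_le_iff_coeff_eq_zero.2 fun m hm => ?_
        refine degree_lt_iff_coeff_zero _ _ |>.1 (?_ : r.degree < (d + 1 : ℕ)) m hm
        have hlt : (d : WithBot ℕ) < (d + 1 : ℕ) := by exact_mod_cast Nat.lt_succ_self d
        rcases hr with (hr | hr) | hr
        · exact (hLd r hr).trans hlt
        · exact hd _ (Set.mem_insert_of_mem _ hr)
        · exact (hEd r hr).trans hlt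
      let R : Set A[X] := ⋃ r ∈ F, ρ r '' Set.Iic r.natDegree
      have hR : R.Finite := hF.biUnion fun r _ => (Set.finite_Iic _).image _
      have hRd : ∀ q ∈ R, q.degree < d := by
        intro q hq
        simp only [R, Set.mem_iUnion] at hq
        obtain ⟨r, hr, j, hj, rfl⟩ := hq
        exact (hρ r j).trans_le (by exact_mod_cast le_trans hj (hFd r hr))
      obtain ⟨Q, hQ, hdet⟩ := ihP (fun g hg => hd g (Set.mem_insert_of_mem _ hg)) (L ∪ E ∪ R)
        ((hL.union hE).union hR) (by
          rintro g ((hg | hg) | hg)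
          exacts [hLd g hg, hEd g hg, hRd g hg])
      have hdet' : DeterminesSigns Q (F ∪ R) := by
        rwa [show F ∪ R = L ∪ E ∪ R ∪ P by ext; simp only [F, Set.mem_union]; tauto]
      refine ⟨Insert.insert (p.coeff 0) (Q ∪ ⋃ g ∈ F, (g.coeffs : Set A)),
        (hQ.union (hF.biUnion fun g _ => g.coeffs.finite_toSet)).insert _, fun y y' hy x => ?_⟩
      obtain ⟨x', hx'⟩ := DeterminesSigns.insert (p := p) hF
        (by
          rintro g (hg | hg)
          · exact Or.inr (hderE g (Or.inr hg) 0)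
          · right
            simp only [E, Set.mem_iUnion] at hg
            obtain ⟨g, hg, k, rfl⟩ := hg
            rw [← Function.iterate_succ_apply' derivative]
            exact hderE g hg (k + 1))
        (Or.inr (hderE p (Or.inl rfl) 0))
        (fun r hr j hj => ⟨ρ r j, Set.mem_biUnion hr (Set.mem_image_of_mem _ hj), hρs r j⟩)
        hdet' y y' hy x
      refine ⟨x', fun g hg => hx' g ?_⟩
      rcases hg with hg | rfl | hg
      exacts [Or.inr (Or.inl (Or.inl hg)), Or.inl rfl, Or.inr (Or.inl (Or.inr hg))]

theorem exists_determinesSigns {P : Set A[X]} (hP : P.Finite) :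
    ∃ Q : Set A, Q.Finite ∧ DeterminesSigns Q P := by
  obtain ⟨d, hd⟩ := (hP.image natDegree).bddAbove
  exact exists_determinesSigns_of_degree_lt (d + 1) hP fun p hp =>
    degree_le_natDegree.trans_lt (by
      exact_mod_cast Nat.lt_succ_of_le (hd (Set.mem_image_of_mem _ hp)))

theorem MvPolynomial.eval₂_cons_eq_eval_finSuccEquiv {N : ℕ} (y : A →+* ℝ) (t : ℝ) (x : Fin N → ℝ)
    (p : MvPolynomial (Fin (N + 1)) A) :
    MvPolynomial.eval₂ y (Fin.cons t x) p =
      ((MvPolynomial.finSuccEquiv A N p).map (MvPolynomial.eval₂Hom y x)).eval t := by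
  induction p using MvPolynomial.induction_on with
  | C a => simp [MvPolynomial.finSuccEquiv_apply]
  | add p q hp hq => simp [hp, hq]
  | mul_X p i hp =>
    rw [MvPolynomial.eval₂_mul, hp, map_mul, Polynomial.map_mul, Polynomial.eval_mul,
      MvPolynomial.eval₂_X]
    congr 1
    refine Fin.cases ?_ (fun i => ?_) i
    · simp [MvPolynomial.finSuccEquiv_X_zero]
    · simp [MvPolynomial.finSuccEquiv_X_succ]

/-- Tarski–Seidenberg: the sign conditions realized by finitely many polynomials with coefficients
in `A`, over a real point of `A`, are determined by the signs of finitely many elements of `A`. -/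
theorem MvPolynomial.exists_finite_determining_signs {N : ℕ} {P : Set (MvPolynomial (Fin N) A)}
    (hP : P.Finite) : ∃ Q : Set A, Q.Finite ∧ ∀ y y' : A →+* ℝ,
      (∀ a ∈ Q, SignType.sign (y a) = SignType.sign (y' a)) → ∀ x : Fin N → ℝ, ∃ x' : Fin N → ℝ,
        ∀ p ∈ P, SignType.sign (p.eval₂ y x) = SignType.sign (p.eval₂ y' x') := by
  induction N with
  | zero =>
    refine ⟨MvPolynomial.coeff 0 '' P, hP.image _,
      fun y y' hy x => ⟨x, fun p hp => ?_⟩⟩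
    obtain ⟨a, rfl⟩ := MvPolynomial.C_surjective (R := A) (Fin 0) p
    simpa [MvPolynomial.coeff_zero_C] using hy _ (Set.mem_image_of_mem _ hp)
  | succ N ih =>
    obtain ⟨Q₁, hQ₁, h₁⟩ := exists_determinesSigns (hP.image (MvPolynomial.finSuccEquiv A N))
    obtain ⟨Q, hQ, h⟩ := ih hQ₁
    refine ⟨Q, hQ, fun y y' hy x => ?_⟩
    obtain ⟨xs, hxs⟩ := h y y' hy (Fin.tail x)
    obtain ⟨t, ht⟩ := h₁ (MvPolynomial.eval₂Hom y (Fin.tail x)) (MvPolynomial.eval₂Hom y' xs)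
      hxs (x 0)
    refine ⟨Fin.cons t xs, fun p hp => ?_⟩
    rw [← Fin.cons_self_tail x, MvPolynomial.eval₂_cons_eq_eval_finSuccEquiv,
      MvPolynomial.eval₂_cons_eq_eval_finSuccEquiv]
    exact ht _ ⟨p, hp, rfl⟩

end Elimination

section BoundedPolynomials

theorem MvPolynomial.eval_aeval_eq {σ τ : Type*} (x : σ → ℝ) (φ : τ → MvPolynomial σ ℝ)
    (q : MvPolynomial τ ℝ) :
    MvPolynomial.eval x (MvPolynomial.aeval φ q) =
      MvPolynomial.eval (fun i => MvPolynomial.eval x (φ i)) q := by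
  induction q using MvPolynomial.induction_on with
  | C a => simp [MvPolynomial.algebraMap_eq]
  | add p q hp hq => simp only [map_add, hp, hq]
  | mul_X p i hp => simp only [map_mul, hp, MvPolynomial.aeval_X, MvPolynomial.eval_X]

variable {n : ℕ} {S : Set (Fin n → ℝ)}

theorem bddOn_iff {f : MvPolynomial (Fin n) ℝ} :
    BddOn S f ↔ ∃ C : NNReal, ∀ x ∈ S, |MvPolynomial.eval x f| ≤ C := by
  simp only [BddOn, isBounded_iff_forall_norm_le, Set.forall_mem_image, Real.norm_eq_abs]
  exact ⟨fun ⟨C, hC⟩ => ⟨C.toNNReal, fun x hx => (hC hx).trans (Real.le_coe_toNNReal C)⟩,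
    fun ⟨C, hC⟩ => ⟨C, fun x hx => hC x hx⟩⟩

theorem BddOn.add {f g : MvPolynomial (Fin n) ℝ} (hf : BddOn S f) (hg : BddOn S g) :
    BddOn S (f + g) := by
  rw [bddOn_iff] at *
  obtain ⟨C, hC⟩ := hf
  obtain ⟨D, hD⟩ := hg
  refine ⟨C + D, fun x hx => ?_⟩
  rw [map_add, NNReal.coe_add]
  exact (abs_add_le _ _).trans (add_le_add (hC x hx) (hD x hx))

theorem BddOn.mul {f g : MvPolynomial (Fin n) ℝ} (hf : BddOn S f) (hg : BddOn S g) :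
    BddOn S (f * g) := by
  rw [bddOn_iff] at *
  obtain ⟨C, hC⟩ := hf
  obtain ⟨D, hD⟩ := hg
  refine ⟨C * D, fun x hx => ?_⟩
  rw [map_mul, abs_mul, NNReal.coe_mul]
  exact mul_le_mul (hC x hx) (hD x hx) (abs_nonneg _) C.2

theorem bddOn_of_mem_adjoin {s : Set (MvPolynomial (Fin n) ℝ)} (hs : ∀ f ∈ s, BddOn S f)
    {f : MvPolynomial (Fin n) ℝ} (hf : f ∈ Algebra.adjoin ℝ s) : BddOn S f := by
  induction hf using Algebra.adjoin_induction with
  | mem f hf => exact hs f hf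
  | algebraMap r =>
    rw [bddOn_iff]
    exact ⟨|r|.toNNReal, fun x _ => by simp [MvPolynomial.algebraMap_eq]⟩
  | add f g _ _ hf hg => exact hf.add hg
  | mul f g _ _ hf hg => exact hf.mul hg

/-- Evaluation at a point, restricted to a subalgebra of the polynomial ring. -/
noncomputable def Subalgebra.evalHom (B : Subalgebra ℝ (MvPolynomial (Fin n) ℝ))
    (x : Fin n → ℝ) : B →+* ℝ :=
  (MvPolynomial.eval x).comp (B.val : B →+* MvPolynomial (Fin n) ℝ)

theorem Subalgebra.evalHom_apply (B : Subalgebra ℝ (MvPolynomial (Fin n) ℝ)) (x : Fin n → ℝ)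
    (b : B) : B.evalHom x b = MvPolynomial.eval x (b : MvPolynomial (Fin n) ℝ) := rfl

/-- The zeros of a polynomial over a ring of functions bounded on `S`, multiplied by the leading
coefficient, are bounded on `S`. -/
theorem exists_abs_leadingCoeff_mul_root_le {B : Subalgebra ℝ (MvPolynomial (Fin n) ℝ)}
    (hB : ∀ b ∈ B, BddOn S b) (c : Polynomial B) :
    ∃ K : NNReal, ∀ x ∈ S, B.evalHom x c.leadingCoeff ≠ 0 → ∀ t,
      (c.map (B.evalHom x)).eval t = 0 → |B.evalHom x c.leadingCoeff| * |t| ≤ K := by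
  choose C hC using fun i => bddOn_iff.1 (hB _ (c.coeff i).2)
  refine ⟨(∑ i ∈ Finset.range c.natDegree, C i) + C c.natDegree, fun x hx hlead t ht => ?_⟩
  have hdeg := Polynomial.natDegree_map_of_leadingCoeff_ne_zero (B.evalHom x) hlead
  have hlc := Polynomial.leadingCoeff_map_of_leadingCoeff_ne_zero (B.evalHom x) hlead
  have h0 : c.map (B.evalHom x) ≠ 0 := by
    rw [← Polynomial.leadingCoeff_ne_zero, hlc]
    exact hlead
  have hsup : (Finset.range c.natDegree).sup
      (fun i => ‖(c.map (B.evalHom x)).coeff i‖₊) ≤ ∑ i ∈ Finset.range c.natDegree, C i := by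
    refine Finset.sup_le fun i hi => le_trans ?_ (Finset.single_le_sum (fun _ _ => zero_le) hi)
    rw [← NNReal.coe_le_coe, coe_nnnorm, Real.norm_eq_abs, Polynomial.coeff_map]
    exact hC i x hx
  have hb := (Polynomial.IsRoot.norm_lt_cauchyBound h0 ht).le
  rw [Polynomial.cauchyBound, hdeg, hlc] at hb
  have hl : ‖B.evalHom x c.leadingCoeff‖₊ ≤ C c.natDegree := by
    rw [← NNReal.coe_le_coe, coe_nnnorm, Real.norm_eq_abs]
    exact hC _ x hx
  have hl0 : ‖B.evalHom x c.leadingCoeff‖₊ ≠ 0 := nnnorm_ne_zero_iff.2 hlead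
  have : ‖B.evalHom x c.leadingCoeff‖₊ * ‖t‖₊ ≤
      (∑ i ∈ Finset.range c.natDegree, C i) + C c.natDegree := by
    refine (mul_le_mul_right (b := ‖t‖₊) hb _).trans ?_
    rw [mul_add, mul_one, mul_div_cancel₀ _ hl0]
    exact add_le_add hsup hl
  exact_mod_cast this

/-- If `f` is bounded on the fibre through `x`, then `f(x) ^ 2` is bounded by a zero of one of
finitely many polynomials whose coefficients are constant on fibres. -/
theorem IsSemialgebraic.exists_finite_sq_le_root (hS : IsSemialgebraic S)
    (f : MvPolynomial (Fin n) ℝ) {m : ℕ} (φ : Fin m → MvPolynomial (Fin n) ℝ)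
    {A : Type*} [CommRing A] [Algebra ℝ A] (b : Fin m → A) (e : (Fin n → ℝ) → A →+* ℝ)
    (hb : ∀ i x, e x (b i) = MvPolynomial.eval x (φ i)) :
    ∃ Q : Set (Polynomial A), Q.Finite ∧ ∀ x ∈ S,
      BddOn {z ∈ S | ∀ i, MvPolynomial.eval z (φ i) = MvPolynomial.eval x (φ i)} f →
      ∃ c ∈ Q, c ≠ 0 ∧ ∃ t, MvPolynomial.eval x f ^ 2 ≤ t ∧
        (c.map (e x)).eval t = 0 := by
  obtain ⟨N, p, k, q, rfl⟩ := hS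
  let ι : MvPolynomial (Fin n) ℝ →+* MvPolynomial (Fin n) (Polynomial A) :=
    MvPolynomial.map (algebraMap ℝ (Polynomial A))
  have hι : ∀ (y : Polynomial A →+* ℝ) (x : Fin n → ℝ) (g : MvPolynomial (Fin n) ℝ),
      (ι g).eval₂ y x = MvPolynomial.eval x g := by
    intro y x g
    rw [MvPolynomial.eval₂_map, Subsingleton.elim (y.comp _) (RingHom.id ℝ)]
    rfl
  let C : Polynomial A →+* MvPolynomial (Fin n) (Polynomial A) := MvPolynomial.C
  let P : Set (MvPolynomial (Fin n) (Polynomial A)) :=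
    Set.range (fun i : Fin m => ι (φ i) - C (Polynomial.C (b i))) ∪
      {ι f ^ 2 - C Polynomial.X} ∪ Set.range (fun i : Fin N => ι (p i)) ∪
      Set.range (fun i : Σ i, Fin (k i) => ι (q i.1 i.2))
  have hP : P.Finite := (((Set.finite_range _).union (Set.finite_singleton _)).union
    (Set.finite_range _)).union (Set.finite_range _)
  obtain ⟨Q, hQ, hdet⟩ := MvPolynomial.exists_finite_determining_signs hP
  refine ⟨Q, hQ, fun x hx hbdd => ?_⟩
  by_contra! hcon
  obtain ⟨M, hM⟩ := bddOn_iff.1 hbdd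
  have hlt : MvPolynomial.eval x f ^ 2 ≤ MvPolynomial.eval x f ^ 2 + (M ^ 2 + 1) := by
    have : (0 : ℝ) ≤ M ^ 2 + 1 := by positivity
    linarith
  obtain ⟨x', hx'⟩ := hdet
    (Polynomial.eval₂RingHom (e x) (MvPolynomial.eval x f ^ 2))
    (Polynomial.eval₂RingHom (e x) (MvPolynomial.eval x f ^ 2 + (M ^ 2 + 1)))
    (by
      intro c hc
      by_cases hc0 : c = 0
      · simp [hc0]
      rw [Polynomial.coe_eval₂RingHom, Polynomial.coe_eval₂RingHom, Polynomial.eval₂_eq_eval_map,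
        Polynomial.eval₂_eq_eval_map]
      exact Polynomial.sign_eval_eq_of_no_root hlt fun w hw => hcon c hc hc0 w hw.1) x
  have hφ : ∀ i, MvPolynomial.eval x' (φ i) = MvPolynomial.eval x (φ i) := by
    intro i
    have := hx' _ (Or.inl (Or.inl (Or.inl ⟨i, rfl⟩)))
    simp only [MvPolynomial.eval₂_sub, hι, MvPolynomial.eval₂_C, Polynomial.coe_eval₂RingHom,
      Polynomial.eval₂_C, C, hb, sub_self, sign_zero] at this
    exact sub_eq_zero.1 (sign_eq_zero_iff.1 this.symm)
  have hf : MvPolynomial.eval x' f ^ 2 = MvPolynomial.eval x f ^ 2 + (M ^ 2 + 1) := by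
    have := hx' _ (Or.inl (Or.inl (Or.inr rfl)))
    simp only [MvPolynomial.eval₂_sub, MvPolynomial.eval₂_pow, hι, MvPolynomial.eval₂_C,
      Polynomial.coe_eval₂RingHom, Polynomial.eval₂_X, C, sub_self, sign_zero] at this
    exact sub_eq_zero.1 (sign_eq_zero_iff.1 this.symm)
  have hxS : x' ∈ ⋃ i, {x | MvPolynomial.eval x (p i) = 0 ∧
      ∀ j, 0 < MvPolynomial.eval x (q i j)} := by
    obtain ⟨i, hpi, hqi⟩ := Set.mem_iUnion.1 hx
    refine Set.mem_iUnion.2 ⟨i, ?_, fun j => ?_⟩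
    · have := hx' _ (Or.inl (Or.inr ⟨i, rfl⟩))
      simp only [hι, hpi, sign_zero] at this
      exact sign_eq_zero_iff.1 this.symm
    · have := hx' _ (Or.inr ⟨⟨i, j⟩, rfl⟩)
      simp only [hι, sign_pos (hqi j)] at this
      exact sign_eq_one_iff.1 this.symm
  have hle := pow_le_pow_left₀ (abs_nonneg _) (hM x' ⟨hxS, hφ⟩) 2
  rw [sq_abs, hf] at hle
  nlinarith [sq_nonneg (MvPolynomial.eval x f)]

theorem exists_bddOn_mul_of_bddOn_fibres (hS : IsSemialgebraic S) (f : MvPolynomial (Fin n) ℝ)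
    {m : ℕ} {φ : Fin m → MvPolynomial (Fin n) ℝ} {q : MvPolynomial (Fin m) ℝ}
    (hφ : ∀ i, BddOn S (φ i)) (hq : MvPolynomial.aeval φ q ≠ 0)
    (hfib : ∀ y : Fin m → ℝ, MvPolynomial.eval y q ≠ 0 →
      BddOn {x ∈ S | ∀ i, MvPolynomial.eval x (φ i) = y i} f) :
    ∃ h : MvPolynomial (Fin n) ℝ, h ≠ 0 ∧ BddOn S h ∧ BddOn S (f * h) := by
  obtain ⟨B, hBdef⟩ : ∃ B, B = Algebra.adjoin ℝ (Set.range φ) := ⟨_, rfl⟩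
  have hφB : ∀ i, φ i ∈ B := fun i => hBdef ▸ Algebra.subset_adjoin (Set.mem_range_self i)
  obtain ⟨Q, hQ, hroot⟩ := hS.exists_finite_sq_le_root f φ (fun i => (⟨φ i, hφB i⟩ : B))
    B.evalHom fun _ _ => rfl
  have hB : ∀ b ∈ B, BddOn S b := fun b hb =>
    bddOn_of_mem_adjoin (by rintro _ ⟨i, rfl⟩; exact hφ i) (hBdef ▸ hb)
  have hqB : MvPolynomial.aeval φ q ∈ B := by
    rw [hBdef, Algebra.adjoin_range_eq_range_aeval]
    exact ⟨q, rfl⟩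
  have hqe : ∀ x, MvPolynomial.eval x (MvPolynomial.aeval φ q) =
      MvPolynomial.eval (fun i => MvPolynomial.eval x (φ i)) q := by
    intro x
    exact MvPolynomial.eval_aeval_eq x φ q
  classical
  let Q' := hQ.toFinset.filter (· ≠ 0)
  let q' : B := ⟨_, hqB⟩
  let h : B := q' * ∏ c ∈ Q', c.leadingCoeff
  have hh0 : h ≠ 0 := by
    refine mul_ne_zero (fun h0 => hq (congrArg Subtype.val h0)) (Finset.prod_ne_zero_iff.2 ?_)
    intro c hc
    exact Polynomial.leadingCoeff_ne_zero.2 (Finset.mem_filter.1 hc).2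
  have hdvd : ∀ c ∈ Q', c.leadingCoeff ∣ h := fun c hc =>
    (Finset.dvd_prod_of_mem (fun c : Polynomial B => c.leadingCoeff) hc).mul_left _
  choose! r hr using hdvd
  choose K hK using exists_abs_leadingCoeff_mul_root_le hB
  choose D hD using fun b : B => bddOn_iff.1 (hB b b.2)
  have hbound : BddOn S (f ^ 2 * h) := by
    refine bddOn_iff.2 ⟨∑ c ∈ Q', K c * D (r c), fun x hx => ?_⟩
    by_cases hx0 : B.evalHom x h = 0
    · rw [map_mul, ← Subalgebra.evalHom_apply, hx0, mul_zero, abs_zero]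
      exact NNReal.coe_nonneg _
    have hq0 : MvPolynomial.eval (fun i => MvPolynomial.eval x (φ i)) q ≠ 0 := by
      rw [← hqe]
      intro h0
      refine hx0 ?_
      rw [map_mul, B.evalHom_apply x q', h0, zero_mul]
    obtain ⟨c, hcQ, hc0, t, hft, ht⟩ := hroot x hx (hfib _ hq0)
    have hc : c ∈ Q' := Finset.mem_filter.2 ⟨hQ.mem_toFinset.2 hcQ, hc0⟩
    have hxh : B.evalHom x h = B.evalHom x c.leadingCoeff * B.evalHom x (r c) := by
      rw [← map_mul, ← hr c hc]
    have hlead : B.evalHom x c.leadingCoeff ≠ 0 := by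
      intro h0
      exact hx0 (by rw [hxh, h0, zero_mul])
    calc |MvPolynomial.eval x (f ^ 2 * h)|
        = |B.evalHom x c.leadingCoeff| * MvPolynomial.eval x f ^ 2 * |B.evalHom x (r c)| := by
          rw [map_mul, map_pow, ← Subalgebra.evalHom_apply, hxh, abs_mul, abs_mul, abs_pow, sq_abs]
          ring
      _ ≤ |B.evalHom x c.leadingCoeff| * |t| * |B.evalHom x (r c)| := by
          gcongr
          exact hft.trans (le_abs_self t)
      _ ≤ K c * D (r c) :=
          mul_le_mul (hK c x hx hlead t ht) (hD (r c) x hx) (abs_nonneg _) (K c).2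
      _ ≤ (∑ c ∈ Q', K c * D (r c) : NNReal) := by
          exact_mod_cast Finset.single_le_sum (f := fun c => K c * D (r c))
            (fun _ _ => zero_le) hc
  refine ⟨h, fun h0 => hh0 (Subtype.ext h0), hB _ h.2, ?_⟩
  obtain ⟨C₁, hC₁⟩ := bddOn_iff.1 (hB _ h.2)
  obtain ⟨C₂, hC₂⟩ := bddOn_iff.1 hbound
  refine bddOn_iff.2 ⟨C₁ + C₂, fun x hx => ?_⟩
  have h₁ := hC₁ x hx
  have h₂ := hC₂ x hx
  rw [map_mul, abs_mul, map_pow, abs_pow] at h₂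
  rw [map_mul, abs_mul, NNReal.coe_add]
  have : |MvPolynomial.eval x f| ≤ 1 + |MvPolynomial.eval x f| ^ 2 := by
    nlinarith [sq_nonneg (|MvPolynomial.eval x f| - 1)]
  nlinarith [mul_le_mul_of_nonneg_right this
    (abs_nonneg (MvPolynomial.eval x (h : MvPolynomial (Fin n) ℝ)))]

end BoundedPolynomials


/-- For a semialgebraic `S ⊆ ℝⁿ` and `f ∈ ℝ[x₁,…,xₙ]`, the following are
equivalent: (i) there is `0 ≠ h ∈ B(S)` with `f·h ∈ B(S)`; (ii) there are `m ≥ 1`,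
`φ₁,…,φₘ ∈ B(S)` and `q ∈ ℝ[y₁,…,yₘ]` with `q(φ₁,…,φₘ) ≠ 0` such that `f` is bounded
on every fibre `S_y = {x ∈ S : φᵢ(x) = yᵢ}` with `q(y) ≠ 0`. -/
theorem mem_fractionField_iff_bounded_on_generic_fibres
    (n : ℕ) (S : Set (Fin n → ℝ)) (hS : IsSemialgebraic S)
    (f : MvPolynomial (Fin n) ℝ) :
    (∃ h : MvPolynomial (Fin n) ℝ, h ≠ 0 ∧ BddOn S h ∧ BddOn S (f * h)) ↔
    (∃ m : ℕ, 1 ≤ m ∧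
      ∃ (φ : Fin m → MvPolynomial (Fin n) ℝ) (q : MvPolynomial (Fin m) ℝ),
        (∀ i, BddOn S (φ i)) ∧
        (MvPolynomial.aeval φ) q ≠ 0 ∧
        ∀ y : Fin m → ℝ, MvPolynomial.eval y q ≠ 0 →
          BddOn {x ∈ S | ∀ i, MvPolynomial.eval x (φ i) = y i} f) := by
  constructor
  · rintro ⟨h, h0, hh, hfh⟩
    refine ⟨2, by norm_num, ![h, f * h], MvPolynomial.X 0, ?_, by simpa using h0, fun y hy => ?_⟩
    · intro i
      fin_cases i
      exacts [hh, hfh]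
    · rw [MvPolynomial.eval_X] at hy
      refine bddOn_iff.2 ⟨|y 1 / y 0|.toNNReal, fun x hx => ?_⟩
      have hx0 : MvPolynomial.eval x h = y 0 := hx.2 0
      have hx1 : MvPolynomial.eval x (f * h) = y 1 := hx.2 1
      rw [map_mul, hx0] at hx1
      rw [Real.coe_toNNReal _ (abs_nonneg _), ← hx1, mul_div_cancel_right₀ _ hy]
  · rintro ⟨m, -, φ, q, hφ, hq, hfib⟩
    exact exists_bddOn_mul_of_bddOn_fibres hS f hφ hq hfib
end

section
/- Let S = {(x,y) ∈ ℝ² : 0 ≤ x·(x² + y²) ≤ 1}. Then the ring B(S) of polynomials in ℝ[x,y] bounded on S equals the ℝ-subalgebra of ℝ[x,y] generated by x, x·y and x·y². -/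
open MvPolynomial

/-- A monomial `xⁱyʲ` with `j ≤ 2i` is a product of powers of `x`, `xy` and `xy²`. -/
lemma X_pow_mul_X_pow_mem_adjoin {i j : ℕ} (h : j ≤ 2 * i) :
    (X 0 ^ i * X 1 ^ j : MvPolynomial (Fin 2) ℝ) ∈
      Algebra.adjoin ℝ
        ({X 0, X 0 * X 1, X 0 * X 1 ^ 2} : Set (MvPolynomial (Fin 2) ℝ)) := by
  set A := Algebra.adjoin ℝ
    ({X 0, X 0 * X 1, X 0 * X 1 ^ 2} : Set (MvPolynomial (Fin 2) ℝ))
  have h₀ : (X 0 : MvPolynomial (Fin 2) ℝ) ∈ A := Algebra.subset_adjoin (by simp)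
  have h₁ : (X 0 * X 1 : MvPolynomial (Fin 2) ℝ) ∈ A := Algebra.subset_adjoin (by simp)
  have h₂ : (X 0 * X 1 ^ 2 : MvPolynomial (Fin 2) ℝ) ∈ A := Algebra.subset_adjoin (by simp)
  rcases le_total j i with hji | hij
  · obtain ⟨k, rfl⟩ := Nat.exists_eq_add_of_le hji
    convert mul_mem (pow_mem h₀ k) (pow_mem h₁ j) using 1
    ring
  · obtain ⟨k, rfl⟩ := Nat.exists_eq_add_of_le hij
    obtain ⟨l, rfl⟩ : ∃ l, i = k + l := Nat.exists_eq_add_of_le (by omega)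
    convert mul_mem (pow_mem h₁ l) (pow_mem h₂ k) using 1
    ring

/-- A real polynomial that is `O(tᴺ)` on `[1, ∞)` has degree at most `N`. -/
lemma Polynomial.coeff_eq_zero_of_abs_eval_le {P : Polynomial ℝ} {N n : ℕ} {C : ℝ}
    (h : ∀ t : ℝ, 1 ≤ t → |P.eval t| ≤ C * t ^ N) (hn : N < n) : P.coeff n = 0 := by
  refine Polynomial.coeff_eq_zero_of_degree_lt ?_
  by_contra! hP
  have hdeg : (Polynomial.X ^ N : Polynomial ℝ).degree < P.degree := by
    rw [Polynomial.degree_X_pow]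
    exact lt_of_lt_of_le (by exact_mod_cast hn) hP
  have htend := Polynomial.abs_div_tendsto_atTop_atTop_of_degree_gt P (Polynomial.X ^ N) hdeg
    (pow_ne_zero _ Polynomial.X_ne_zero)
  obtain ⟨t, hCt, ht⟩ :=
    ((htend.eventually_gt_atTop C).and (Filter.eventually_ge_atTop 1)).exists
  have htN : 0 < t ^ N := by positivity
  rw [Polynomial.eval_pow, Polynomial.eval_X, abs_div, abs_of_pos htN, lt_div_iff₀ htN] at hCt
  exact absurd (h t ht) hCt.not_ge

/-- If `f(c/t², t)` is bounded in `t ≥ 1` for each `c ∈ (0, 1/2)`, then every monomial `xⁱyʲ`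
of `f` satisfies `j ≤ 2i`. -/
lemma apply_one_le_of_mem_support {f : MvPolynomial (Fin 2) ℝ} {C : ℝ}
    (hf : ∀ c ∈ Set.Ioo (0 : ℝ) (1 / 2), ∀ t : ℝ, 1 ≤ t → |eval ![c / t ^ 2, t] f| ≤ C)
    {m : Fin 2 →₀ ℕ} (hm : m ∈ f.support) : m 1 ≤ 2 * m 0 := by
  by_contra! hlt
  set N := 2 * f.degreeOf 0
  have hN : ∀ k ∈ f.support, 2 * k 0 ≤ N := fun k hk =>
    Nat.mul_le_mul_left 2 (monomial_le_degreeOf 0 hk)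
  let G : Polynomial (Polynomial ℝ) := ∑ k ∈ f.support,
    Polynomial.monomial (k 1 + (N - 2 * k 0)) (Polynomial.monomial (k 0) (f.coeff k))
  set n := m 1 + (N - 2 * m 0)
  have heval : ∀ c t : ℝ, 1 ≤ t → (G.map (Polynomial.evalRingHom c)).eval t =
      eval ![c / t ^ 2, t] f * t ^ N := by
    intro c t ht
    have ht0 : t ≠ 0 := by positivity
    rw [eval_eq', Finset.sum_mul, Polynomial.map_sum, Polynomial.eval_finsetSum]
    refine Finset.sum_congr rfl fun k hk => ?_
    obtain ⟨d, hd⟩ := Nat.exists_eq_add_of_le (hN k hk)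
    simp only [Polynomial.map_monomial, Polynomial.eval_monomial, Polynomial.coe_evalRingHom,
      Fin.prod_univ_two, Matrix.cons_val_zero, Matrix.cons_val_one, hd, Nat.add_sub_cancel_left,
      div_pow, pow_add, ← pow_mul]
    field_simp
  have hcoeff : G.coeff n = 0 := by
    refine Polynomial.eq_zero_of_infinite_isRoot _
      ((Set.Ioo_infinite (by norm_num : (0 : ℝ) < 1 / 2)).mono fun c hc => ?_)
    have h := Polynomial.coeff_eq_zero_of_abs_eval_le
      (P := G.map (Polynomial.evalRingHom c)) (N := N) (n := n) (C := C) (fun t ht => ?_)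
      (by have := hN m hm; omega)
    · simpa [Polynomial.coeff_map] using h
    · have htN : 0 ≤ t ^ N := by positivity
      rw [heval c t ht, abs_mul, abs_of_nonneg htN]
      exact mul_le_mul_of_nonneg_right (hf c hc t ht) htN
  have hm0 : (G.coeff n).coeff (m 0) = f.coeff m := by
    simp only [G, Polynomial.finsetSum_coeff, Polynomial.coeff_monomial]
    rw [Finset.sum_eq_single m]
    · simp [n]
    · intro k hk hkm
      split_ifs with h
      · rw [Polynomial.coeff_monomial, if_neg]
        intro h0
        refine hkm (Finsupp.ext fun i => ?_)
        fin_cases i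
        · exact h0
        · change k 1 = m 1
          omega
      · simp
    · exact fun h => absurd hm h
  rw [hcoeff, Polynomial.coeff_zero] at hm0
  exact mem_support_iff.mp hm hm0.symm

/-- For `S = {(x,y) ∈ ℝ² : 0 ≤ x(x²+y²) ≤ 1}`, the ring of polynomials
bounded on `S` is the `ℝ`-subalgebra of `ℝ[x,y]` generated by `x`, `xy` and `xy²`. -/
theorem bounded_ring_example_one :
    {f : MvPolynomial (Fin 2) ℝ |
        Bornology.IsBounded ((fun p => eval p f) ''
          {p : Fin 2 → ℝ | 0 ≤ p 0 * ((p 0) ^ 2 + (p 1) ^ 2) ∧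
                           p 0 * ((p 0) ^ 2 + (p 1) ^ 2) ≤ 1})} =
      ↑(Algebra.adjoin ℝ
          ({X 0, X 0 * X 1, X 0 * X 1 ^ 2} : Set (MvPolynomial (Fin 2) ℝ))) := by
  ext f
  simp only [Set.mem_ofPred_eq, SetLike.mem_coe, isBounded_iff_forall_norm_le,
    Set.forall_mem_image, Real.norm_eq_abs]
  constructor
  · rintro ⟨C, hC⟩
    rw [f.as_sum]
    refine sum_mem fun m hm => ?_
    rw [monomial_eq, Finsupp.prod_fintype _ _ (fun _ => pow_zero _), Fin.prod_univ_two,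
      ← smul_eq_C_mul]
    refine Subalgebra.smul_mem _ (X_pow_mul_X_pow_mem_adjoin
      (apply_one_le_of_mem_support (C := C) (fun c hc t ht => hC ?_) hm)) _
    obtain ⟨hc0, hc1⟩ := hc
    have ht0 : 0 < t := by positivity
    simp only [Matrix.cons_val_zero, Matrix.cons_val_one]
    refine ⟨by positivity, ?_⟩
    have hx0 : 0 < c / t ^ 2 := by positivity
    have hx1 : c / t ^ 2 ≤ 1 / 2 :=
      (div_le_self hc0.le (one_le_pow₀ ht)).trans hc1.le
    have hxt : c / t ^ 2 * t ^ 2 = c := by field_simp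
    nlinarith [mul_nonneg hx0.le (sub_nonneg.mpr hx1), pow_le_pow_left₀ hx0.le hx1 3]
  · intro hf
    induction hf using Algebra.adjoin_induction with
    | mem g hg =>
      refine ⟨1, fun p hp => ?_⟩
      obtain ⟨hp0, hp1⟩ := hp
      have hx0 : 0 ≤ p 0 := by
        by_contra! hneg
        nlinarith [mul_pos_of_neg_of_neg hneg hneg, sq_nonneg (p 1),
          mul_neg_of_neg_of_pos hneg (add_pos_of_pos_of_nonneg (pow_pos (neg_pos.mpr hneg) 2)
            (sq_nonneg (p 1)))]
      have hxy : p 0 * p 1 ^ 2 ≤ 1 := by nlinarith [pow_nonneg hx0 3]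
      have hxy0 : 0 ≤ p 0 * p 1 ^ 2 := by positivity
      have hx1 : p 0 ≤ 1 := by
        refine (pow_le_one_iff_of_nonneg hx0 three_ne_zero).mp ?_
        nlinarith
      rcases hg with rfl | rfl | rfl
      · simpa [abs_of_nonneg hx0] using hx1
      · rw [← sq_le_one_iff_abs_le_one]
        simp only [map_mul, eval_X]
        calc (p 0 * p 1) ^ 2 = p 0 * (p 0 * p 1 ^ 2) := by ring
          _ ≤ 1 := mul_le_one₀ hx1 hxy0 hxy
      · simpa only [map_mul, map_pow, eval_X, abs_of_nonneg hxy0] using hxy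
    | algebraMap r => exact ⟨|r|, fun p _ => by simp [algebraMap_eq]⟩
    | add g h _ _ hg hh =>
      obtain ⟨C, hC⟩ := hg
      obtain ⟨D, hD⟩ := hh
      refine ⟨C + D, fun p hp => ?_⟩
      rw [map_add]
      exact (abs_add_le _ _).trans (add_le_add (hC hp) (hD hp))
    | mul g h _ _ hg hh =>
      obtain ⟨C, hC⟩ := hg
      obtain ⟨D, hD⟩ := hh
      refine ⟨C * D, fun p hp => ?_⟩
      rw [map_mul, abs_mul]
      exact mul_le_mul (hC hp) (hD hp) (abs_nonneg _) ((abs_nonneg _).trans (hC hp))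
end

section
/- Let S = {(x,y) ∈ ℝ² : |x²·y| ≤ 1 and |x²·y³| ≤ 1}. Then the ring B(S) of polynomials in ℝ[x,y] bounded on S equals the ℝ-subalgebra of ℝ[x,y] generated by x·y, x²·y and x²·y³. -/
open MvPolynomial

/-- If a finite sum `∑ aᵢ c ^ eᵢ t ^ dᵢ` with distinct exponent pairs is `O(t ^ N)` for `t ≥ 1`,
for every fixed `c ∈ (0, 1]`, then every term with `N < dᵢ` vanishes. -/
lemma coeff_eq_zero_of_abs_sum_le {ι : Type*} (s : Finset ι) (a : ι → ℝ) (e d : ι → ℕ)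
    (N : ℕ) (M : ℝ)
    (h : ∀ c t : ℝ, 0 < c → c ≤ 1 → 1 ≤ t → |∑ i ∈ s, a i * c ^ e i * t ^ d i| ≤ M * t ^ N)
    (hinj : ∀ i ∈ s, ∀ j ∈ s, e i = e j → d i = d j → i = j) {i : ι} (hi : i ∈ s)
    (hN : N < d i) : a i = 0 := by
  have hcoeff : ∀ c : ℝ, 0 < c → c ≤ 1 → ∑ j ∈ s with d j = d i, a j * c ^ e j = 0 := by
    intro c hc hc1
    set P : Polynomial ℝ := ∑ j ∈ s, Polynomial.monomial (d j) (a j * c ^ e j) with hP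
    have hdeg : P.degree ≤ N := by
      rw [← Polynomial.degree_X_pow (R := ℝ) N]
      by_contra! hlt
      have hT := Polynomial.abs_div_tendsto_atTop_atTop_of_degree_gt P (Polynomial.X ^ N) hlt
        (pow_ne_zero _ Polynomial.X_ne_zero)
      obtain ⟨t, ht, ht1⟩ :=
        ((hT.eventually_gt_atTop M).and (Filter.eventually_ge_atTop 1)).exists
      have ht0 : 0 < t ^ N := by positivity
      rw [Polynomial.eval_pow, Polynomial.eval_X, abs_div, abs_of_pos ht0, lt_div_iff₀ ht0] at ht
      refine ht.not_ge ?_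
      simpa [hP, Polynomial.eval_finsetSum] using h c t hc hc1 ht1
    have hz : P.coeff (d i) = 0 :=
      Polynomial.coeff_eq_zero_of_degree_lt (hdeg.trans_lt (by exact_mod_cast hN))
    rw [Finset.sum_filter]
    simpa [hP, Polynomial.finsetSum_coeff, Polynomial.coeff_monomial] using hz
  set Q : Polynomial ℝ := ∑ j ∈ s with d j = d i, Polynomial.monomial (e j) (a j) with hQ
  have hQ0 : Q = 0 := by
    refine Polynomial.eq_zero_of_infinite_isRoot Q
      ((Set.Ioc_infinite (zero_lt_one' ℝ)).mono ?_)
    intro c hc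
    simpa [hQ, Polynomial.IsRoot, Polynomial.eval_finsetSum] using hcoeff c hc.1 hc.2
  have hQi : Q.coeff (e i) = a i := by
    rw [hQ, Polynomial.finsetSum_coeff, Finset.sum_eq_single i]
    · simp
    · intro j hj hji
      rw [Finset.mem_filter] at hj
      exact Polynomial.coeff_monomial_of_ne _ fun he => hji (hinj j hj.1 i hi he.symm hj.2)
    · intro hni
      simp [hi] at hni
  rw [← hQi, hQ0, Polynomial.coeff_zero]

lemma fin_two_finsupp_ext {m n : Fin 2 →₀ ℕ} (h0 : m 0 = n 0) (h1 : m 1 = n 1) : m = n := by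
  ext k
  fin_cases k
  exacts [h0, h1]

lemma eval_fin_two (p : Fin 2 → ℝ) (f : MvPolynomial (Fin 2) ℝ) :
    eval p f = ∑ m ∈ f.support, f.coeff m * (p 0 ^ m 0 * p 1 ^ m 1) := by
  rw [eval_eq']
  simp [Fin.prod_univ_two]

lemma monomial_mem_adjoin {m : Fin 2 →₀ ℕ} (r : ℝ) (h₁ : m 0 ≤ 2 * m 1)
    (h₂ : 2 * m 1 ≤ 3 * m 0) :
    monomial m r ∈ Algebra.adjoin ℝ
      ({X 0 * X 1, X 0 ^ 2 * X 1, X 0 ^ 2 * X 1 ^ 3} : Set (MvPolynomial (Fin 2) ℝ)) := by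
  set A := Algebra.adjoin ℝ
    ({X 0 * X 1, X 0 ^ 2 * X 1, X 0 ^ 2 * X 1 ^ 3} : Set (MvPolynomial (Fin 2) ℝ))
  have hu : (X 0 * X 1 : MvPolynomial (Fin 2) ℝ) ∈ A := Algebra.subset_adjoin (by simp)
  have hv : (X 0 ^ 2 * X 1 : MvPolynomial (Fin 2) ℝ) ∈ A := Algebra.subset_adjoin (by simp)
  have hw : (X 0 ^ 2 * X 1 ^ 3 : MvPolynomial (Fin 2) ℝ) ∈ A := Algebra.subset_adjoin (by simp)
  have hm : monomial m r = r • (X 0 ^ m 0 * X 1 ^ m 1 : MvPolynomial (Fin 2) ℝ) := by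
    rw [monomial_eq, Finsupp.prod_fintype _ _ (by simp), Fin.prod_univ_two, smul_eq_C_mul]
  rw [hm]
  refine A.smul_mem ?_ r
  rcases le_total (m 1) (m 0) with h | h
  · obtain ⟨k, hk⟩ := Nat.exists_eq_add_of_le h
    obtain ⟨l, hl⟩ := Nat.exists_eq_add_of_le (show k ≤ m 1 by omega)
    have : (X 0 ^ m 0 * X 1 ^ m 1 : MvPolynomial (Fin 2) ℝ) =
        (X 0 ^ 2 * X 1) ^ k * (X 0 * X 1) ^ l := by
      rw [hk, hl]; ring
    rw [this]
    exact A.mul_mem (A.pow_mem hv k) (A.pow_mem hu l)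
  · obtain ⟨k, hk⟩ := Nat.exists_eq_add_of_le h
    obtain ⟨l, hl⟩ := Nat.exists_eq_add_of_le (show 2 * k ≤ m 0 by omega)
    have : (X 0 ^ m 0 * X 1 ^ m 1 : MvPolynomial (Fin 2) ℝ) =
        (X 0 ^ 2 * X 1 ^ 3) ^ k * (X 0 * X 1) ^ l := by
      rw [hk, hl]; ring
    rw [this]
    exact A.mul_mem (A.pow_mem hw k) (A.pow_mem hu l)

/-- A polynomial bounded on `S` only involves monomials `xᵃyᵇ` with `a ≤ 2b`, as seen on the
curves `(t, c / t²)`. -/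
lemma le_two_mul_of_bounded {f : MvPolynomial (Fin 2) ℝ} {M : ℝ}
    (hM : ∀ p : Fin 2 → ℝ, |p 0 ^ 2 * p 1| ≤ 1 → |p 0 ^ 2 * p 1 ^ 3| ≤ 1 → |eval p f| ≤ M)
    {m : Fin 2 →₀ ℕ} (hm : m ∈ f.support) : m 0 ≤ 2 * m 1 := by
  by_contra! hlt
  set N := f.support.sup fun n => 2 * n 1
  have hN : ∀ n ∈ f.support, 2 * n 1 ≤ N := fun n hn =>
    Finset.le_sup (f := fun n : Fin 2 →₀ ℕ => 2 * n 1) hn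
  refine mem_support_iff.1 hm (coeff_eq_zero_of_abs_sum_le f.support (fun n => f.coeff n)
    (fun n => n 1) (fun n => N + n 0 - 2 * n 1) N M ?_ ?_ hm ?_)
  · intro c t hc hc1 ht
    have ht0 : 0 < t := by linarith
    have hb := hM ![t, c / t ^ 2] ?_ ?_
    · have hsum : ∑ n ∈ f.support, f.coeff n * c ^ n 1 * t ^ (N + n 0 - 2 * n 1) =
          eval ![t, c / t ^ 2] f * t ^ N := by
        rw [eval_fin_two, Finset.sum_mul]
        refine Finset.sum_congr rfl fun n hn => ?_
        have := hN n hn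
        rw [pow_sub₀ _ ht0.ne' (by omega), pow_add, pow_mul]
        simp only [Matrix.cons_val_zero, Matrix.cons_val_one, div_pow]
        field_simp
      rw [hsum, abs_mul, abs_of_pos (pow_pos ht0 N)]
      gcongr
    · have : t ^ 2 * (c / t ^ 2) = c := by field_simp
      simpa [this, abs_of_pos hc] using hc1
    · have : t ^ 2 * (c / t ^ 2) ^ 3 = c ^ 3 / t ^ 4 := by field_simp
      simp only [Matrix.cons_val_zero, Matrix.cons_val_one, this]
      rw [abs_of_pos (by positivity)]
      exact div_le_one_of_le₀ ((pow_le_one₀ hc.le hc1).trans (one_le_pow₀ ht)) (by positivity)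
  · intro i hi j hj h1 hd
    have := hN i hi
    have := hN j hj
    exact fin_two_finsupp_ext (by omega) h1
  · have := hN m hm
    omega

/-- A polynomial bounded on `S` only involves monomials `xᵃyᵇ` with `2b ≤ 3a`, as seen on the
curves `(c / t³, t²)`. -/
lemma two_mul_le_of_bounded {f : MvPolynomial (Fin 2) ℝ} {M : ℝ}
    (hM : ∀ p : Fin 2 → ℝ, |p 0 ^ 2 * p 1| ≤ 1 → |p 0 ^ 2 * p 1 ^ 3| ≤ 1 → |eval p f| ≤ M)
    {m : Fin 2 →₀ ℕ} (hm : m ∈ f.support) : 2 * m 1 ≤ 3 * m 0 := by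
  by_contra! hlt
  set N := f.support.sup fun n => 3 * n 0
  have hN : ∀ n ∈ f.support, 3 * n 0 ≤ N := fun n hn =>
    Finset.le_sup (f := fun n : Fin 2 →₀ ℕ => 3 * n 0) hn
  refine mem_support_iff.1 hm (coeff_eq_zero_of_abs_sum_le f.support (fun n => f.coeff n)
    (fun n => n 0) (fun n => N + 2 * n 1 - 3 * n 0) N M ?_ ?_ hm ?_)
  · intro c t hc hc1 ht
    have ht0 : 0 < t := by linarith
    have hb := hM ![c / t ^ 3, t ^ 2] ?_ ?_
    · have hsum : ∑ n ∈ f.support, f.coeff n * c ^ n 0 * t ^ (N + 2 * n 1 - 3 * n 0) =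
          eval ![c / t ^ 3, t ^ 2] f * t ^ N := by
        rw [eval_fin_two, Finset.sum_mul]
        refine Finset.sum_congr rfl fun n hn => ?_
        have := hN n hn
        rw [pow_sub₀ _ ht0.ne' (by omega), pow_add, pow_mul, pow_mul]
        simp only [Matrix.cons_val_zero, Matrix.cons_val_one, div_pow]
        field_simp
      rw [hsum, abs_mul, abs_of_pos (pow_pos ht0 N)]
      gcongr
    · have : (c / t ^ 3) ^ 2 * t ^ 2 = c ^ 2 / t ^ 4 := by field_simp
      simp only [Matrix.cons_val_zero, Matrix.cons_val_one, this]
      rw [abs_of_pos (by positivity)]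
      exact div_le_one_of_le₀ ((pow_le_one₀ hc.le hc1).trans (one_le_pow₀ ht)) (by positivity)
    · have : (c / t ^ 3) ^ 2 * (t ^ 2) ^ 3 = c ^ 2 := by field_simp
      simp only [Matrix.cons_val_zero, Matrix.cons_val_one, this]
      rw [abs_of_pos (by positivity)]
      exact pow_le_one₀ hc.le hc1
  · intro i hi j hj h0 hd
    have := hN i hi
    have := hN j hj
    exact fin_two_finsupp_ext h0 (by omega)
  · have := hN m hm
    omega

lemma exists_bound_of_mem_adjoin {σ : Type*} {s : Set (MvPolynomial σ ℝ)} {S : Set (σ → ℝ)}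
    (hs : ∀ g ∈ s, ∃ M : ℝ, ∀ p ∈ S, |eval p g| ≤ M) {f : MvPolynomial σ ℝ}
    (hf : f ∈ Algebra.adjoin ℝ s) : ∃ M : ℝ, ∀ p ∈ S, |eval p f| ≤ M := by
  induction hf using Algebra.adjoin_induction with
  | mem g hg => exact hs g hg
  | algebraMap r => exact ⟨|r|, fun p _ => by simp [algebraMap_eq]⟩
  | add g h _ _ ihg ihh =>
    obtain ⟨M, hM⟩ := ihg
    obtain ⟨L, hL⟩ := ihh
    refine ⟨M + L, fun p hp => ?_⟩
    rw [map_add]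
    exact (abs_add_le _ _).trans (add_le_add (hM p hp) (hL p hp))
  | mul g h _ _ ihg ihh =>
    obtain ⟨M, hM⟩ := ihg
    obtain ⟨L, hL⟩ := ihh
    refine ⟨M * L, fun p hp => ?_⟩
    rw [map_mul, abs_mul]
    exact mul_le_mul (hM p hp) (hL p hp) (abs_nonneg _) ((abs_nonneg _).trans (hM p hp))

/-- For `S = {(x,y) ∈ ℝ² : |x²y| ≤ 1 and |x²y³| ≤ 1}`, the ring of
polynomials bounded on `S` is the `ℝ`-subalgebra of `ℝ[x,y]` generated by
`xy`, `x²y` and `x²y³`. -/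
theorem bounded_ring_example_two :
    {f : MvPolynomial (Fin 2) ℝ |
        Bornology.IsBounded ((fun p => eval p f) ''
          {p : Fin 2 → ℝ | |p 0 ^ 2 * p 1| ≤ 1 ∧ |p 0 ^ 2 * p 1 ^ 3| ≤ 1})} =
      ↑(Algebra.adjoin ℝ
          ({X 0 * X 1, X 0 ^ 2 * X 1, X 0 ^ 2 * X 1 ^ 3} :
            Set (MvPolynomial (Fin 2) ℝ))) := by
  ext f
  simp only [Set.mem_ofPred_eq, SetLike.mem_coe, isBounded_iff_forall_norm_le,
    Set.forall_mem_image, Real.norm_eq_abs]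
  constructor
  · rintro ⟨M, hM⟩
    have hM' : ∀ p : Fin 2 → ℝ, |p 0 ^ 2 * p 1| ≤ 1 → |p 0 ^ 2 * p 1 ^ 3| ≤ 1 →
        |eval p f| ≤ M := fun p h₁ h₂ => hM ⟨h₁, h₂⟩
    rw [← support_sum_monomial_coeff f]
    exact Subalgebra.sum_mem _ fun m hm => monomial_mem_adjoin _
      (le_two_mul_of_bounded hM' hm) (two_mul_le_of_bounded hM' hm)
  · intro hf
    refine (exists_bound_of_mem_adjoin
      (S := {p : Fin 2 → ℝ | |p 0 ^ 2 * p 1| ≤ 1 ∧ |p 0 ^ 2 * p 1 ^ 3| ≤ 1}) ?_ hf).imp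
      fun M hM p hp => hM p hp
    rintro g (rfl | rfl | rfl)
    · refine ⟨1, fun p hp => ?_⟩
      have h : |p 0 * p 1| ^ 4 ≤ 1 := by
        rw [← abs_pow, show (p 0 * p 1) ^ 4 = (p 0 ^ 2 * p 1) * (p 0 ^ 2 * p 1 ^ 3) by ring,
          abs_mul]
        exact mul_le_one₀ hp.1 (abs_nonneg _) hp.2
      simpa using (pow_le_one_iff_of_nonneg (abs_nonneg _) four_ne_zero).1 h
    · exact ⟨1, fun p hp => by simpa using hp.1⟩
    · exact ⟨1, fun p hp => by simpa using hp.2⟩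
end

section
/- Let S = {(x,y) ∈ ℝ² : |x²·y| ≤ 1 and |x²·y³| ≤ 1}. Then for every real number c ≠ 0, the set {(x,y) ∈ S : x·y = c} is a compact subset of ℝ². -/
/-- For `S = {(x,y) ∈ ℝ² : |x²y| ≤ 1 and |x²y³| ≤ 1}` and any real
`c ≠ 0`, the fibre `{(x,y) ∈ S : xy = c}` is a compact subset of `ℝ²`. -/
theorem fibre_compact_example (c : ℝ) (hc : c ≠ 0) :
    IsCompact {p : Fin 2 → ℝ |
      (|p 0 ^ 2 * p 1| ≤ 1 ∧ |p 0 ^ 2 * p 1 ^ 3| ≤ 1) ∧ p 0 * p 1 = c} := by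
  have hclosed : IsClosed {p : Fin 2 → ℝ |
      (|p 0 ^ 2 * p 1| ≤ 1 ∧ |p 0 ^ 2 * p 1 ^ 3| ≤ 1) ∧ p 0 * p 1 = c} := by
    refine IsClosed.and (IsClosed.and ?_ ?_) ?_
    · exact isClosed_le (by fun_prop) (by fun_prop)
    · exact isClosed_le (by fun_prop) (by fun_prop)
    · exact isClosed_eq (by fun_prop) (by fun_prop)
  refine (isCompact_Icc (a := ![-(1 / |c|), -(1 / |c ^ 2|)])
    (b := ![1 / |c|, 1 / |c ^ 2|])).of_isClosed_subset hclosed ?_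
  rintro p ⟨⟨h₁, h₂⟩, h⟩
  have e₁ : p 0 * c = p 0 ^ 2 * p 1 := by rw [← h]; ring
  have e₂ : p 1 * c ^ 2 = p 0 ^ 2 * p 1 ^ 3 := by rw [← h]; ring
  have hx : |p 0| ≤ 1 / |c| := by
    rw [le_div_iff₀ (abs_pos.2 hc), ← abs_mul, e₁]
    exact h₁
  have hy : |p 1| ≤ 1 / |c ^ 2| := by
    rw [le_div_iff₀ (abs_pos.2 (pow_ne_zero 2 hc)), ← abs_mul, e₂]
    exact h₂
  rw [abs_le] at hx hy
  constructor <;> intro i <;> fin_cases i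
  · exact hx.1
  · exact hy.1
  · exact hx.2
  · exact hy.2
end

section
/- Let S = {(x,y) ∈ ℝ² : |x| ≤ 1}. Then the ring B(S) of polynomials in ℝ[x,y] bounded on S equals the ℝ-subalgebra of ℝ[x,y] generated by x, i.e. B(S) = ℝ[x]. -/
open MvPolynomial

/-- A real polynomial whose values are bounded is constant. -/
lemma Polynomial.eval_eq_eval_of_abs_eval_le {q : Polynomial ℝ} {M : ℝ}
    (h : ∀ t, |q.eval t| ≤ M) (s t : ℝ) : q.eval s = q.eval t := by
  have hdeg : q.degree ≤ 0 :=
    q.isBoundedUnder_abs_atTop_iff.1 (Filter.isBoundedUnder_of ⟨M, h⟩)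
  rw [Polynomial.eq_C_of_degree_le_zero hdeg, Polynomial.eval_C, Polynomial.eval_C]

/-- A polynomial in `x, y` that is bounded on the vertical line `x = a` is constant there. -/
lemma MvPolynomial.eval_eq_eval_of_abs_eval_le_on_line {f : MvPolynomial (Fin 2) ℝ} {a M : ℝ}
    (h : ∀ t, |eval ![a, t] f| ≤ M) (s t : ℝ) : eval ![a, s] f = eval ![a, t] f := by
  have key (t : ℝ) :
      (aeval ![Polynomial.C a, Polynomial.X] f : Polynomial ℝ).eval t = eval ![a, t] f := by
    rw [← Polynomial.coe_aeval_eq_eval,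
      ← AlgHom.comp_apply, comp_aeval, aeval_eq_eval]
    congr 2
    ext i
    fin_cases i <;> simp
  rw [← key, ← key]
  exact Polynomial.eval_eq_eval_of_abs_eval_le (M := M) (fun t => by rw [key]; exact h t) s t

/-- For the strip `S = {(x,y) ∈ ℝ² : |x| ≤ 1}`, the ring of polynomials
bounded on `S` is `ℝ[x]`, the `ℝ`-subalgebra of `ℝ[x,y]` generated by `x`. -/
theorem bounded_ring_strip :
    {f : MvPolynomial (Fin 2) ℝ |
        Bornology.IsBounded ((fun p => eval p f) ''
          {p : Fin 2 → ℝ | |p 0| ≤ 1})} =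
      ↑(Algebra.adjoin ℝ ({X 0} : Set (MvPolynomial (Fin 2) ℝ))) := by
  ext f
  simp only [Set.mem_ofPred_eq, SetLike.mem_coe]
  constructor
  · intro hf
    obtain ⟨M, hM⟩ := hf.exists_norm_le
    have hbound (p : Fin 2 → ℝ) (hp : |p 0| ≤ 1) : |eval p f| ≤ M :=
      hM _ ⟨p, hp, rfl⟩
    have hfg : f = aeval ![X 0, 0] f := by
      refine funext_set (fun _ => Set.Icc (-1 : ℝ) 1)
        (fun _ => Set.Icc_infinite (by norm_num)) fun p hp => ?_
      have hp0 : |p 0| ≤ 1 := abs_le.2 (hp 0 trivial)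
      have hline := eval_eq_eval_of_abs_eval_le_on_line (f := f) (a := p 0)
        (fun t => hbound ![p 0, t] hp0) (p 1) 0
      have hp_eq : ![p 0, p 1] = p := by ext i; fin_cases i <;> rfl
      rw [hp_eq] at hline
      rw [hline, ← aeval_eq_eval, ← aeval_eq_eval,
        ← AlgHom.comp_apply, comp_aeval]
      congr 2
      ext i
      fin_cases i <;> simp
    rw [hfg, aeval_def]
    refine eval₂_mem (s := Algebra.adjoin ℝ {X 0})
      (fun i _ => Subalgebra.algebraMap_mem _ _) fun i => ?_
    fin_cases i
    · exact Algebra.self_mem_adjoin_singleton ℝ _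
    · exact Subalgebra.zero_mem _
  · rw [Algebra.adjoin_singleton_eq_range_aeval]
    rintro ⟨q, rfl⟩
    refine ((isCompact_Icc (a := (-1 : ℝ)) (b := 1)).image q.continuous).isBounded.subset ?_
    rintro _ ⟨p, hp, rfl⟩
    refine ⟨p 0, abs_le.1 hp, ?_⟩
    simp [← aeval_eq_eval, ← Polynomial.aeval_algHom_apply]
end

section
/- Let T = {(x,y) ∈ ℝ² : |x| ≤ 1 and |x·y| ≤ 1}. Then the ring B(T) of polynomials in ℝ[x,y] bounded on T equals the ℝ-subalgebra of ℝ[x,y] generated by x and x·y. -/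
open MvPolynomial

/-- A real polynomial that is `O(t ^ N)` on `(0, 1]` is divisible by `X ^ N`. -/
theorem Polynomial.X_pow_dvd_of_abs_eval_le {P : Polynomial ℝ} {N : ℕ} {C : ℝ}
    (h : ∀ t : ℝ, 0 < t → t ≤ 1 → |P.eval t| ≤ C * t ^ N) : Polynomial.X ^ N ∣ P := by
  induction N with
  | zero => simp
  | succ N ih =>
    have hC : 0 ≤ C := by simpa using (abs_nonneg _).trans (h 1 one_pos le_rfl)
    obtain ⟨Q, rfl⟩ := ih fun t ht ht1 =>
      (h t ht ht1).trans (mul_le_mul_of_nonneg_left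
        (pow_le_pow_of_le_one ht.le ht1 N.le_succ) hC)
    have hQ : ∀ t : ℝ, 0 < t → t ≤ 1 → |Q.eval t| ≤ C * t := fun t ht ht1 => by
      have := h t ht ht1
      rw [Polynomial.eval_mul, Polynomial.eval_pow, Polynomial.eval_X, abs_mul,
        abs_of_pos (pow_pos ht N)] at this
      refine le_of_mul_le_mul_left (this.trans_eq ?_) (pow_pos ht N)
      ring
    have h0 : |Q.eval 0| ≤ C * 0 := by
      refine le_of_tendsto_of_tendsto (b := nhdsWithin (0 : ℝ) (Set.Ioi 0))
        (f := fun t => |Q.eval t|) (g := fun t => C * t) ?_ ?_ ?_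
      · exact (Q.continuous.abs.tendsto 0).mono_left nhdsWithin_le_nhds
      · exact ((continuous_const.mul continuous_id).tendsto 0).mono_left nhdsWithin_le_nhds
      · filter_upwards [Ioc_mem_nhdsGT (one_pos : (0 : ℝ) < 1)] with t ht
        exact hQ t ht.1 ht.2
    have hX : Polynomial.X ∣ Q := by
      rw [Polynomial.X_dvd_iff, Polynomial.coeff_zero_eq_eval_zero]
      simpa using h0
    rw [pow_succ]
    exact mul_dvd_mul_left _ hX

/-- If `f(x, y)` is bounded on `|x| ≤ 1`, `|xy| ≤ 1`, then every monomial `x ^ i * y ^ j` of `f`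
satisfies `j ≤ i`: restrict `f` to the curve `(t ^ M, t / t ^ M)` for large `M`. -/
theorem MvPolynomial.apply_one_le_apply_zero_of_bounded {f : MvPolynomial (Fin 2) ℝ} {C : ℝ}
    (h : ∀ p : Fin 2 → ℝ, |p 0| ≤ 1 → |p 0 * p 1| ≤ 1 → |eval p f| ≤ C)
    {s : Fin 2 →₀ ℕ} (hs : s ∈ f.support) : s 1 ≤ s 0 := by
  obtain ⟨M, hM⟩ : ∃ M : ℕ, ∀ r ∈ f.support, r 1 < M := by
    refine ⟨f.degreeOf 1 + 1, fun r hr => Nat.lt_succ_of_le ?_⟩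
    exact monomial_le_degreeOf 1 hr
  let e : (Fin 2 →₀ ℕ) → ℕ := fun r => M * (r 0 + (M - r 1)) + r 1
  have he : ∀ r ∈ f.support, e r = e s → r = s := by
    intro r hr hrs
    have hr1 := hM r hr
    have hs1 := hM s hs
    have h1 : r 1 = s 1 := by
      have := congrArg (· % M) hrs
      simpa [e, Nat.mul_add_mod, Nat.mod_eq_of_lt hr1, Nat.mod_eq_of_lt hs1] using this
    have h0 : r 0 = s 0 := by
      simp only [e, h1, add_left_inj] at hrs
      have := Nat.eq_of_mul_eq_mul_left (by omega) hrs
      omega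
    ext i
    fin_cases i
    · exact h0
    · exact h1
  let P : Polynomial ℝ := ∑ r ∈ f.support, Polynomial.monomial (e r) (coeff r f)
  have hP : ∀ t : ℝ, 0 < t → t ≤ 1 → |P.eval t| ≤ C * t ^ (M * M) := by
    intro t ht ht1
    have htM : t ^ M ≠ 0 := (pow_pos ht M).ne'
    have hev : P.eval t = eval ![t ^ M, t / t ^ M] f * t ^ (M * M) := by
      rw [eval_eq', Finset.sum_mul, Polynomial.eval_finsetSum]
      refine Finset.sum_congr rfl fun r hr => ?_
      obtain ⟨d, hd⟩ := Nat.exists_eq_add_of_le (hM r hr).le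
      have hd' : M - r 1 = d := by omega
      have hMM : t ^ (M * M) = (t ^ M) ^ r 1 * (t ^ M) ^ d := by
        rw [← pow_add, ← hd, pow_mul]
      simp only [Polynomial.eval_monomial, Fin.prod_univ_two, Matrix.cons_val_zero,
        Matrix.cons_val_one, e, hd', hMM, pow_add, mul_add, pow_mul, div_pow]
      field_simp
    rw [hev, abs_mul, abs_of_pos (pow_pos ht (M * M))]
    refine mul_le_mul_of_nonneg_right (h _ ?_ ?_) (pow_pos ht _).le
    · simpa [abs_of_pos ht] using pow_le_one₀ ht.le ht1
    · simpa [mul_div_cancel₀ _ htM, abs_of_pos ht] using ht1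
  by_contra! hlt
  have hes : e s < M * M := by
    have hs1 := hM s hs
    calc e s < M * (s 0 + (M - s 1)) + M := by simpa [e] using hs1
      _ = M * (s 0 + (M - s 1) + 1) := by ring
      _ ≤ M * M := Nat.mul_le_mul_left _ (by omega)
  have h0 := Polynomial.X_pow_dvd_iff.1 (Polynomial.X_pow_dvd_of_abs_eval_le hP) _ hes
  rw [Polynomial.finsetSum_coeff, Finset.sum_eq_single s] at h0
  · exact mem_support_iff.1 hs (by simpa using h0)
  · intro r hr hrs
    exact Polynomial.coeff_monomial_of_ne _ fun h' => hrs (he r hr h'.symm)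
  · exact fun h' => (h' hs).elim

/-- For `T = {(x,y) ∈ ℝ² : |x| ≤ 1 and |xy| ≤ 1}`, the ring of
polynomials bounded on `T` is the `ℝ`-subalgebra of `ℝ[x,y]` generated by `x` and `xy`. -/
theorem bounded_ring_example_xy :
    {f : MvPolynomial (Fin 2) ℝ |
        Bornology.IsBounded ((fun p => eval p f) ''
          {p : Fin 2 → ℝ | |p 0| ≤ 1 ∧ |p 0 * p 1| ≤ 1})} =
      ↑(Algebra.adjoin ℝ ({X 0, X 0 * X 1} : Set (MvPolynomial (Fin 2) ℝ))) := by
  ext f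
  simp only [Set.mem_ofPred_eq, SetLike.mem_coe, isBounded_iff_forall_norm_le,
    Set.forall_mem_image, Real.norm_eq_abs]
  constructor
  · rintro ⟨C, hC⟩
    rw [f.as_sum]
    refine Subalgebra.sum_mem _ fun s hs => ?_
    have hle := apply_one_le_apply_zero_of_bounded (fun p h0 h1 => hC ⟨h0, h1⟩) hs
    have hmon : monomial s (coeff s f) =
        coeff s f • (X 0 ^ (s 0 - s 1) * (X 0 * X 1 : MvPolynomial (Fin 2) ℝ) ^ s 1) := by
      rw [monomial_eq, Finsupp.prod_fintype _ _ fun _ => pow_zero _, Fin.prod_univ_two,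
        smul_eq_C_mul, mul_pow, ← mul_assoc (X 0 ^ _), ← pow_add, Nat.sub_add_cancel hle]
    rw [hmon]
    exact Subalgebra.smul_mem _ (mul_mem
      (pow_mem (Algebra.subset_adjoin (by simp)) _)
      (pow_mem (Algebra.subset_adjoin (by simp)) _)) _
  · intro hf
    induction hf using Algebra.adjoin_induction with
    | mem g hg =>
      refine ⟨1, fun p hp => ?_⟩
      rcases hg with rfl | rfl
      · simpa using hp.1
      · simpa using hp.2
    | algebraMap r => exact ⟨|r|, fun p _ => by simp [algebraMap_eq]⟩
    | add g k _ _ hg hk =>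
      obtain ⟨A, hA⟩ := hg
      obtain ⟨B, hB⟩ := hk
      refine ⟨A + B, fun p hp => ?_⟩
      rw [map_add]
      exact (abs_add_le _ _).trans (add_le_add (hA hp) (hB hp))
    | mul g k _ _ hg hk =>
      obtain ⟨A, hA⟩ := hg
      obtain ⟨B, hB⟩ := hk
      refine ⟨A * B, fun p hp => ?_⟩
      rw [map_mul, abs_mul]
      exact mul_le_mul (hA hp) (hB hp) (abs_nonneg _) ((abs_nonneg _).trans (hA hp))
end

section
/- Let S ⊆ ℝⁿ be a semialgebraic set and let b ∈ ℝ[x₁,…,xₙ]. Then the following are equivalent: (i) for every polynomial f ∈ ℝ[x₁,…,xₙ], the product b·f is bounded on S; (ii) the set {x ∈ S : b(x) ≠ 0} is a bounded subset of ℝⁿ. -/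
open Filter Topology

/-- If every generator satisfies a relation `X i ^ D = g i` with `g i` of total degree less than
`D`, the quotient of the polynomial ring by these relations is a finite module. -/
theorem MvPolynomial.finite_quotient_X_pow_sub {σ A : Type*} [Finite σ] [CommRing A] (D : ℕ)
    (g : σ → MvPolynomial σ A) (hg : ∀ i, (g i).totalDegree < D) :
    Module.Finite A (MvPolynomial σ A ⧸ Ideal.span (Set.range fun i => X i ^ D - g i)) := by
  classical
  have := Fintype.ofFinite σ
  set I := Ideal.span (Set.range fun i => (X i : MvPolynomial σ A) ^ D - g i)
  set π := Ideal.Quotient.mkₐ A I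
  set N := Fintype.card σ * D
  have key : ∀ k : ℕ, ∀ p : MvPolynomial σ A, p.totalDegree ≤ k →
      π p ∈ (restrictTotalDegree σ A N).map π.toLinearMap := by
    intro k
    induction k using Nat.strong_induction_on with
    | _ k ih =>
      intro p hp
      rw [p.as_sum, map_sum]
      refine Submodule.sum_mem _ fun m hm => ?_
      have hmk : (m.sum fun _ e => e) ≤ k := (le_totalDegree hm).trans hp
      by_cases hmN : (m.sum fun _ e => e) ≤ N
      · refine Submodule.mem_map_of_mem ?_
        rw [mem_restrictTotalDegree]
        exact (totalDegree_monomial_le m _).trans hmN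
      · obtain ⟨i, hi⟩ : ∃ i, D ≤ m i := by
          by_contra! h
          refine hmN ?_
          rw [Finsupp.sum_fintype _ _ (fun _ => rfl)]
          calc ∑ i, m i ≤ ∑ _i : σ, D := Finset.sum_le_sum fun i _ => (h i).le
            _ = N := by simp [N]
        set m' := m - Finsupp.single i D
        have hm' : m' + Finsupp.single i D = m :=
          tsub_add_cancel_of_le (Finsupp.single_le_iff.2 hi)
        have hdeg : (m.sum fun _ e => e) = (m'.sum fun _ e => e) + D := by
          rw [← hm', Finsupp.sum_add_index' (fun _ => rfl) (fun _ _ _ => rfl),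
            Finsupp.sum_single_index rfl]
        have hmon : monomial m (coeff m p) = monomial m' (coeff m p) * X i ^ D := by
          rw [X_pow_eq_monomial, monomial_mul, hm', mul_one]
        have hπ : π (X i ^ D) = π (g i) :=
          Ideal.Quotient.eq.2 (Ideal.subset_span ⟨i, rfl⟩)
        rw [hmon, map_mul, hπ, ← map_mul]
        have hlt : (monomial m' (coeff m p) * g i).totalDegree < k := by
          have h1 := totalDegree_mul (monomial m' (coeff m p)) (g i)
          have h2 : (monomial m' (coeff m p)).totalDegree ≤ m'.sum fun _ e => e :=
            totalDegree_monomial_le m' _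
          have h3 := hg i
          omega
        exact ih _ hlt _ le_rfl
  have htop : (restrictTotalDegree σ A N).map π.toLinearMap = ⊤ := by
    refine eq_top_iff.2 fun x _ => ?_
    obtain ⟨p, rfl⟩ := Ideal.Quotient.mkₐ_surjective A I x
    exact key _ p le_rfl
  refine Module.Finite.of_fg_top ?_
  rw [← htop]
  exact (Module.Finite.iff_fg.1 inferInstance).map _

theorem MvPolynomial.exists_monic_aeval_X_mem_span {σ A : Type*} [Finite σ] [CommRing A] (D : ℕ)
    (g : σ → MvPolynomial σ A) (hg : ∀ i, (g i).totalDegree < D) (i : σ) :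
    ∃ f : Polynomial A, f.Monic ∧ Polynomial.aeval (X i : MvPolynomial σ A) f ∈
      Ideal.span (Set.range fun i => X i ^ D - g i) := by
  have := finite_quotient_X_pow_sub D g hg
  obtain ⟨f, hf, hf0⟩ := Algebra.IsIntegral.isIntegral (R := A)
    (Ideal.Quotient.mk (Ideal.span (Set.range fun i => X i ^ D - g i)) (X i))
  refine ⟨f, hf, ?_⟩
  rw [← Ideal.Quotient.eq_zero_iff_mem, ← Ideal.Quotient.mkₐ_eq_mk A,
    ← Polynomial.aeval_algHom_apply]
  exact hf0

theorem MvPolynomial.hasDerivAt_eval_update {σ : Type*} [DecidableEq σ] (p : MvPolynomial σ ℝ)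
    (x : σ → ℝ) (i : σ) (t : ℝ) :
    HasDerivAt (fun t => eval (Function.update x i t) p)
      (eval (Function.update x i t) (pderiv i p)) t := by
  induction p using MvPolynomial.induction_on with
  | C a => simpa using hasDerivAt_const t a
  | add p q hp hq =>
    simp only [map_add]
    exact hp.add hq
  | mul_X p j hp =>
    have hX : HasDerivAt (fun t => Function.update x i t j)
        (eval (Function.update x i t) (pderiv i (X j))) t := by
      by_cases h : j = i
      · subst h
        simpa using hasDerivAt_id' t
      · simpa [h, pderiv_X_of_ne h] using hasDerivAt_const t (x j)
    have := hp.mul hX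
    simp only [pderiv_mul, map_add, map_mul, eval_X]
    exact this

theorem Polynomial.eval₂_eval₂RingHom_swap {R S : Type*} [CommSemiring R] [CommSemiring S]
    (φ : R →+* S) (x y : S) (f : Polynomial (Polynomial R)) :
    (Bivariate.swap f).eval₂ (eval₂RingHom φ x) y = f.eval₂ (eval₂RingHom φ y) x := by
  have : (eval₂RingHom (eval₂RingHom φ x) y).comp
      (Bivariate.swap (R := R) : _ ≃ₐ[R] _).toAlgHom.toRingHom =
      eval₂RingHom (eval₂RingHom φ y) x := by
    ext <;> simp [Bivariate.swap_apply]
  exact RingHom.congr_fun this f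

/-- If the values of a polynomial family at `yₖ → ∞` vanish while the parameters converge, then the
leading coefficient of the family vanishes at the limit parameter. -/
theorem Polynomial.eval₂_leadingCoeff_eq_zero_of_tendsto {R : Type*} [CommRing R] (φ : R →+* ℝ)
    (F : Polynomial (Polynomial R)) {x y : ℕ → ℝ} {x₀ : ℝ} (hx : Tendsto x atTop (𝓝 x₀))
    (hy : Tendsto y atTop atTop) (h : ∀ k, F.eval₂ (eval₂RingHom φ (x k)) (y k) = 0) :
    F.leadingCoeff.eval₂ φ x₀ = 0 := by
  have hcont : Continuous fun z : ℝ × ℝ => F.reverse.eval₂ (eval₂RingHom φ z.1) z.2 := by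
    simp only [eval₂_eq_sum_range, coe_eval₂RingHom]
    fun_prop
  have hlim : Tendsto (fun k => F.reverse.eval₂ (eval₂RingHom φ (x k)) (y k)⁻¹) atTop
      (𝓝 (F.reverse.eval₂ (eval₂RingHom φ x₀) 0)) :=
    (hcont.tendsto (x₀, 0)).comp (hx.prodMk_nhds (tendsto_inv_atTop_zero.comp hy))
  have hzero : ∀ᶠ k in atTop, F.reverse.eval₂ (eval₂RingHom φ (x k)) (y k)⁻¹ = 0 := by
    filter_upwards [hy.eventually_gt_atTop 0] with k hk
    have := invertibleOfNonzero hk.ne'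
    rw [← invOf_eq_inv, eval₂_reverse_eq_zero_iff]
    exact h k
  have := tendsto_nhds_unique hlim (tendsto_const_nhds.congr' (hzero.mono fun k hk => hk.symm))
  rw [eval₂_at_zero, coeff_zero_reverse] at this
  simpa using this

/-- The minimum of `s * P + ∑ i, X i ^ (2 * d + 2)` is attained, and it is a critical point. -/
theorem MvPolynomial.exists_critical_point {σ : Type*} [Fintype σ] (P : MvPolynomial σ ℝ)
    (hP : ∀ x, 0 ≤ eval x P) (d : ℕ) {s : ℝ} (hs : 0 < s) :
    ∃ x : σ → ℝ,
      (∀ z, s * eval x P + ∑ i, x i ^ (2 * d + 2) ≤ s * eval z P + ∑ i, z i ^ (2 * d + 2)) ∧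
      ∀ i, x i ^ (2 * d + 1) = -(1 / (2 * d + 2)) * s * eval x (pderiv i P) := by
  classical
  set G : MvPolynomial σ ℝ := C s * P + ∑ i, X i ^ (2 * d + 2) with hG
  have hGe : ∀ z, eval z G = s * eval z P + ∑ i, z i ^ (2 * d + 2) := fun z => by simp [hG]
  have hbdd : Bornology.IsBounded {z : σ → ℝ | eval z G ≤ eval 0 G} := by
    refine (Metric.isBounded_closedBall (x := (0 : σ → ℝ)) (r := 1 + eval 0 G)).subset ?_
    intro z hz
    have h0 : 0 ≤ eval (0 : σ → ℝ) G := by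
      rw [hGe]
      have := hP 0
      simp only [Pi.zero_apply]
      positivity
    rw [mem_closedBall_zero_iff, pi_norm_le_iff_of_nonneg (by positivity)]
    intro i
    have h1 : z i ^ (2 * d + 2) ≤ eval (0 : σ → ℝ) G := by
      refine le_trans ?_ (hz : eval z G ≤ _)
      rw [hGe]
      have h2 : z i ^ (2 * d + 2) ≤ ∑ i, z i ^ (2 * d + 2) :=
        Finset.single_le_sum (f := fun i => z i ^ (2 * d + 2))
          (fun j _ => Even.pow_nonneg ⟨d + 1, by ring⟩ _) (Finset.mem_univ i)
      have := mul_nonneg hs.le (hP z)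
      linarith
    rw [Real.norm_eq_abs]
    by_contra! hlt
    have h3 : |z i| ≤ |z i| ^ (2 * d + 2) := le_self_pow₀ (by linarith) (by omega)
    rw [Even.pow_abs ⟨d + 1, by ring⟩] at h3
    linarith
  obtain ⟨x, hx⟩ := (continuous_eval G).exists_forall_le_of_isBounded 0 hbdd
  refine ⟨x, fun z => by simpa only [hGe] using hx z, fun i => ?_⟩
  have hd := hasDerivAt_eval_update G x i (x i)
  have hmin : IsLocalMin (fun t => eval (Function.update x i t) G) (x i) :=
    Eventually.of_forall fun t => by
      simpa only [Function.update_eq_self] using hx (Function.update x i t)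
  have h0 := hmin.hasDerivAt_eq_zero hd
  have hsum : pderiv i (∑ j, (X j : MvPolynomial σ ℝ) ^ (2 * d + 2)) =
      C (2 * d + 2 : ℝ) * X i ^ (2 * d + 1) := by
    rw [map_sum, Finset.sum_eq_single i]
    · have hC : (C (2 * d + 2 : ℝ) : MvPolynomial σ ℝ) = ((2 * d + 2 : ℕ) : MvPolynomial σ ℝ) := by
        rw [← map_natCast (C (σ := σ) (R := ℝ))]
        push_cast
        rfl
      rw [pderiv_pow, pderiv_X_self, hC, mul_one]
      rfl
    · intro j _ hj
      simp [pderiv_X_of_ne hj]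
    · simp
  rw [Function.update_eq_self, hG, map_add, hsum, pderiv_C_mul] at h0
  simp only [map_add, map_mul, eval_C, map_pow, eval_X] at h0
  have : (2 * d + 2 : ℝ) ≠ 0 := by positivity
  field_simp
  linarith

/-- Given a polynomial family of nonnegative polynomials `P r` on affine space and a coordinate `i`,
there is one nontrivial algebraic relation `F r w = 0` such that whenever `P r` has a real zero, it
has one whose `i`-th coordinate `w` satisfies the relation. -/
theorem MvPolynomial.exists_algebraic_zero {σ : Type*} [Finite σ]
    (P : MvPolynomial σ (Polynomial ℝ))
    (hP : ∀ (r : ℝ) (x : σ → ℝ), 0 ≤ eval₂ (Polynomial.evalRingHom r) x P) (i : σ) :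
    ∃ F : Polynomial (Polynomial ℝ), F ≠ 0 ∧ ∀ r : ℝ,
      (∃ x : σ → ℝ, eval₂ (Polynomial.evalRingHom r) x P = 0) →
      ∃ x : σ → ℝ, eval₂ (Polynomial.evalRingHom r) x P = 0 ∧
        F.eval₂ (Polynomial.evalRingHom r) (x i) = 0 := by
  classical
  have := Fintype.ofFinite σ
  set d := ∑ j, (pderiv j P).totalDegree
  set g : σ → MvPolynomial σ (Polynomial (Polynomial ℝ)) := fun j =>
    C (Polynomial.C (Polynomial.C (-(1 / (2 * d + 2) : ℝ))) * Polynomial.X) *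
      map Polynomial.C (pderiv j P)
  have hg : ∀ j, (g j).totalDegree < 2 * d + 1 := fun j => by
    have h1 := totalDegree_mul
      (C (Polynomial.C (Polynomial.C (-(1 / (2 * d + 2) : ℝ))) * Polynomial.X))
      (map (Polynomial.C (R := Polynomial ℝ)) (pderiv j P))
    have h2 : (map (Polynomial.C (R := Polynomial ℝ)) (pderiv j P)).totalDegree ≤
        (pderiv j P).totalDegree := Finset.sup_mono (support_map_subset _ _)
    have h3 : (pderiv j P).totalDegree ≤ d :=
      Finset.single_le_sum (f := fun j => (pderiv j P).totalDegree) (fun _ _ => Nat.zero_le _)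
        (Finset.mem_univ j)
    rw [totalDegree_C] at h1
    change totalDegree (_ * _) < _
    omega
  obtain ⟨f, hf, hmem⟩ := exists_monic_aeval_X_mem_span (2 * d + 1) g hg i
  have hcrit : ∀ (r s : ℝ) (x : σ → ℝ),
      (∀ j, x j ^ (2 * d + 1) = -(1 / (2 * d + 2)) * s *
        eval x (pderiv j (map (Polynomial.evalRingHom r) P))) →
      f.eval₂ (Polynomial.eval₂RingHom (Polynomial.evalRingHom r) s) (x i) = 0 := by
    intro r s x hx
    set ψ := eval₂Hom (Polynomial.eval₂RingHom (Polynomial.evalRingHom r) s) x with hψ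
    have hker : Ideal.span (Set.range fun j => X j ^ (2 * d + 1) - g j) ≤ RingHom.ker ψ := by
      rw [Ideal.span_le]
      rintro _ ⟨j, rfl⟩
      have hC : (Polynomial.eval₂RingHom (Polynomial.evalRingHom r) s).comp Polynomial.C =
          Polynomial.evalRingHom r := by
        ext <;> simp
      have := hx j
      rw [pderiv_map, eval_map] at this
      simp only [SetLike.mem_coe, RingHom.mem_ker, map_sub, map_pow, map_mul, g, hψ, eval₂Hom_X',
        coe_eval₂Hom, eval₂_C, eval₂_map, hC, this]
      simp
    have h0 := hker hmem
    rw [RingHom.mem_ker, Polynomial.aeval_def, Polynomial.hom_eval₂] at h0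
    have hcomp : ψ.comp (algebraMap (Polynomial (Polynomial ℝ)) (MvPolynomial σ _)) =
        Polynomial.eval₂RingHom (Polynomial.evalRingHom r) s :=
      eval₂Hom_comp_C _ _
    rwa [hcomp, hψ, eval₂Hom_X'] at h0
  set F := Polynomial.Bivariate.swap f with hF
  have hF0 : F ≠ 0 := by
    rw [hF, Ne, EmbeddingLike.map_eq_zero_iff]
    exact hf.ne_zero
  refine ⟨F.leadingCoeff, Polynomial.leadingCoeff_ne_zero.2 hF0, ?_⟩
  rintro r ⟨z, hz⟩
  simp only [← eval_map] at hz hP ⊢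
  choose x hxmin hxcrit using fun k : ℕ => exists_critical_point
    (map (Polynomial.evalRingHom r) P) (hP r) d (s := k + 1) (by positivity)
  set Cz := ∑ j, z j ^ (2 * d + 2)
  have hev : ∀ t : ℝ, 0 ≤ t ^ (2 * d + 2) := fun t => Even.pow_nonneg ⟨d + 1, by ring⟩ t
  have hle : ∀ k : ℕ, (k + 1 : ℝ) * eval (x k) (map (Polynomial.evalRingHom r) P) +
      ∑ j, x k j ^ (2 * d + 2) ≤ Cz := fun k => by
    simpa [hz] using hxmin k z
  have hbd : ∀ k, x k ∈ Metric.closedBall (0 : σ → ℝ) (1 + Cz) := by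
    intro k
    have hCz : 0 ≤ Cz := Finset.sum_nonneg fun j _ => hev _
    rw [mem_closedBall_zero_iff, pi_norm_le_iff_of_nonneg (by positivity)]
    intro j
    have h1 : x k j ^ (2 * d + 2) ≤ ∑ j, x k j ^ (2 * d + 2) :=
      Finset.single_le_sum (f := fun j => x k j ^ (2 * d + 2)) (fun j _ => hev _)
        (Finset.mem_univ j)
    have h2 : 0 ≤ (k + 1 : ℝ) * eval (x k) (map (Polynomial.evalRingHom r) P) :=
      mul_nonneg (by positivity) (hP r _)
    have h4 := hle k
    rw [Real.norm_eq_abs]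
    by_contra! hlt
    have h3 : |x k j| ≤ |x k j| ^ (2 * d + 2) := le_self_pow₀ (by linarith) (by omega)
    rw [Even.pow_abs ⟨d + 1, by ring⟩] at h3
    linarith
  obtain ⟨x₀, -, ν, hν, hlim⟩ := (isCompact_closedBall (0 : σ → ℝ) (1 + Cz)).tendsto_subseq hbd
  have htop : Tendsto (fun k => ((ν k : ℕ) : ℝ) + 1) atTop atTop :=
    tendsto_atTop_add_const_right _ _ (tendsto_natCast_atTop_atTop.comp hν.tendsto_atTop)
  refine ⟨x₀, ?_, ?_⟩
  · have h1 := ((continuous_eval (map (Polynomial.evalRingHom r) P)).tendsto x₀).comp hlim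
    have h2 : Tendsto (fun k => Cz / ((ν k : ℕ) + 1 : ℝ)) atTop (𝓝 0) :=
      tendsto_const_nhds.div_atTop htop
    refine le_antisymm (le_of_tendsto_of_tendsto' h1 h2 fun k => ?_) (hP r x₀)
    have h3 := hle (ν k)
    have h4 : 0 ≤ ∑ j, x (ν k) j ^ (2 * d + 2) := Finset.sum_nonneg fun j _ => hev _
    rw [le_div_iff₀ (by positivity)]
    simp only [Function.comp_apply]
    linarith
  · refine Polynomial.eval₂_leadingCoeff_eq_zero_of_tendsto _ F
      (((continuous_apply i).tendsto x₀).comp hlim) htop fun k => ?_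
    rw [hF, Polynomial.eval₂_eval₂RingHom_swap]
    exact hcrit r _ _ (hxcrit (ν k))

/-- On a basic semialgebraic set on which `b` has no zeros, `b` satisfies an algebraic relation over
the squared distance `r` to the origin, at one point for each value of `r`. -/
theorem exists_algebraic_relation_basic {n m : ℕ} (p b : MvPolynomial (Fin n) ℝ)
    (q : Fin m → MvPolynomial (Fin n) ℝ) :
    ∃ F : Polynomial (Polynomial ℝ), F ≠ 0 ∧ ∀ x : Fin n → ℝ,
      MvPolynomial.eval x p = 0 → (∀ j, 0 < MvPolynomial.eval x (q j)) →
      MvPolynomial.eval x b ≠ 0 →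
      ∃ y : Fin n → ℝ, MvPolynomial.eval y p = 0 ∧ (∀ j, 0 < MvPolynomial.eval y (q j)) ∧
        MvPolynomial.eval y b ≠ 0 ∧ ∑ i, y i ^ 2 = ∑ i, x i ^ 2 ∧
        F.eval₂ (Polynomial.evalRingHom (∑ i, x i ^ 2)) (MvPolynomial.eval y b)⁻¹ = 0 := by
  classical
  let L : MvPolynomial (Fin n) ℝ →+* MvPolynomial (Fin n ⊕ Option (Fin m)) (Polynomial ℝ) :=
    MvPolynomial.eval₂Hom (MvPolynomial.C.comp Polynomial.C) fun i => MvPolynomial.X (Sum.inl i)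
  let P : MvPolynomial (Fin n ⊕ Option (Fin m)) (Polynomial ℝ) :=
    L p ^ 2 + ∑ j, (MvPolynomial.X (Sum.inr (some j)) ^ 2 * L (q j) - 1) ^ 2 +
      (MvPolynomial.X (Sum.inr none) * L b - 1) ^ 2 +
      (∑ i, MvPolynomial.X (Sum.inl i) ^ 2 - MvPolynomial.C Polynomial.X) ^ 2
  have hL : ∀ (r : ℝ) (x : Fin n ⊕ Option (Fin m) → ℝ) (a : MvPolynomial (Fin n) ℝ),
      MvPolynomial.eval₂ (Polynomial.evalRingHom r) x (L a) =
        MvPolynomial.eval (x ∘ Sum.inl) a := by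
    intro r x a
    have : (MvPolynomial.eval₂Hom (Polynomial.evalRingHom r) x).comp L =
        MvPolynomial.eval (x ∘ Sum.inl) := by
      ext <;> simp [L]
    exact RingHom.congr_fun this a
  have hPe : ∀ (r : ℝ) (x : Fin n ⊕ Option (Fin m) → ℝ),
      MvPolynomial.eval₂ (Polynomial.evalRingHom r) x P =
        MvPolynomial.eval (x ∘ Sum.inl) p ^ 2 +
        ∑ j, (x (Sum.inr (some j)) ^ 2 * MvPolynomial.eval (x ∘ Sum.inl) (q j) - 1) ^ 2 +
        (x (Sum.inr none) * MvPolynomial.eval (x ∘ Sum.inl) b - 1) ^ 2 +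
        (∑ i, x (Sum.inl i) ^ 2 - r) ^ 2 := by
    intro r x
    simp only [← MvPolynomial.coe_eval₂Hom] at hL ⊢
    simp only [P, map_add, map_pow, map_sub, map_mul, map_sum, map_one, hL]
    simp
  obtain ⟨F, hF, h⟩ := MvPolynomial.exists_algebraic_zero P
    (fun r x => by rw [hPe]; positivity) (Sum.inr none)
  refine ⟨F, hF, fun x hp hq hb => ?_⟩
  obtain ⟨y, hy, hFy⟩ := h (∑ i, x i ^ 2) ⟨Sum.elim x fun o => o.elim (MvPolynomial.eval x b)⁻¹
    fun j => (√(MvPolynomial.eval x (q j)))⁻¹, by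
      rw [hPe]
      have hs : ∀ j, (√(MvPolynomial.eval x (q j)) ^ 2)⁻¹ * MvPolynomial.eval x (q j) = 1 :=
        fun j => by
          rw [Real.sq_sqrt (hq j).le, inv_mul_cancel₀ (hq j).ne']
      simp [hp, hb, hs]⟩
  rw [hPe] at hy
  have hsum : 0 ≤ ∑ j, (y (Sum.inr (some j)) ^ 2 *
      MvPolynomial.eval (y ∘ Sum.inl) (q j) - 1) ^ 2 := by positivity
  have h1 := sq_nonneg (MvPolynomial.eval (y ∘ Sum.inl) p)
  have h2 := sq_nonneg (y (Sum.inr none) * MvPolynomial.eval (y ∘ Sum.inl) b - 1)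
  have h3 := sq_nonneg (∑ i, y (Sum.inl i) ^ 2 - ∑ i, x i ^ 2)
  have e1 : MvPolynomial.eval (y ∘ Sum.inl) p = 0 := pow_eq_zero_iff two_ne_zero |>.1 (by linarith)
  have e2 : y (Sum.inr none) * MvPolynomial.eval (y ∘ Sum.inl) b - 1 = 0 :=
    pow_eq_zero_iff two_ne_zero |>.1 (by linarith)
  have e3 : ∑ i, y (Sum.inl i) ^ 2 - ∑ i, x i ^ 2 = 0 :=
    pow_eq_zero_iff two_ne_zero |>.1 (by linarith)
  have e4 : ∑ j, (y (Sum.inr (some j)) ^ 2 *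
      MvPolynomial.eval (y ∘ Sum.inl) (q j) - 1) ^ 2 = 0 := by linarith
  rw [Finset.sum_eq_zero_iff_of_nonneg fun _ _ => sq_nonneg _] at e4
  refine ⟨y ∘ Sum.inl, e1, fun j => ?_, fun hb0 => ?_, sub_eq_zero.1 e3, ?_⟩
  · have := pow_eq_zero_iff two_ne_zero |>.1 (e4 j (Finset.mem_univ j))
    exact pos_of_mul_pos_right (by linarith) (sq_nonneg (y (Sum.inr (some j))))
  · rw [hb0] at e2
    norm_num at e2
  · rwa [← eq_inv_of_mul_eq_one_left (sub_eq_zero.1 e2)]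

theorem isBounded_of_forall_isBounded_mul_basic {n m : ℕ} (p b : MvPolynomial (Fin n) ℝ)
    (q : Fin m → MvPolynomial (Fin n) ℝ)
    (h : ∀ f : MvPolynomial (Fin n) ℝ, Bornology.IsBounded ((fun x => MvPolynomial.eval x (b * f)) ''
      {x | MvPolynomial.eval x p = 0 ∧ ∀ j, 0 < MvPolynomial.eval x (q j)})) :
    Bornology.IsBounded {x : Fin n → ℝ | (MvPolynomial.eval x p = 0 ∧
      ∀ j, 0 < MvPolynomial.eval x (q j)) ∧ MvPolynomial.eval x b ≠ 0} := by
  obtain ⟨F, hF, hrel⟩ := exists_algebraic_relation_basic p b q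
  let ρ : MvPolynomial (Fin n) ℝ := ∑ i, MvPolynomial.X i ^ 2
  let f : MvPolynomial (Fin n) ℝ := ρ *
    F.reverse.divX.eval₂ (Polynomial.eval₂RingHom MvPolynomial.C ρ) b
  have hlead : Polynomial.X * F.leadingCoeff ≠ 0 :=
    mul_ne_zero Polynomial.X_ne_zero (Polynomial.leadingCoeff_ne_zero.2 hF)
  have hdeg : 0 < (Polynomial.X * F.leadingCoeff).degree := by
    rw [Polynomial.degree_mul, Polynomial.degree_X,
      Polynomial.degree_eq_natDegree (Polynomial.leadingCoeff_ne_zero.2 hF)]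
    exact_mod_cast Nat.lt_add_right _ Nat.one_pos
  obtain ⟨K, hK⟩ := (h f).exists_norm_le
  have htend := Polynomial.abs_tendsto_atTop _ hdeg
  obtain ⟨R, hR⟩ := (htend.eventually_gt_atTop K).exists_forall_of_atTop
  have hbound : ∀ x ∈ {x : Fin n → ℝ | (MvPolynomial.eval x p = 0 ∧
      ∀ j, 0 < MvPolynomial.eval x (q j)) ∧ MvPolynomial.eval x b ≠ 0}, ∑ i, x i ^ 2 ≤ R := by
    rintro x ⟨⟨hp, hq⟩, hb⟩
    by_contra! hlt
    obtain ⟨y, hpy, hqy, hby, hρ, hFy⟩ := hrel x hp hq hb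
    have hKy := hK _ ⟨y, ⟨hpy, hqy⟩, rfl⟩
    have hlarge := hR _ hlt.le
    set r := ∑ i, x i ^ 2
    have hρy : MvPolynomial.eval y ρ = r := by simp [ρ, hρ]
    have hrev : F.reverse.eval₂ (Polynomial.evalRingHom r) (MvPolynomial.eval y b) = 0 := by
      have := invertibleOfNonzero (inv_ne_zero hby)
      rw [← Polynomial.eval₂_reverse_eq_zero_iff, invOf_eq_inv, inv_inv] at hFy
      exact hFy
    have hcomp : (MvPolynomial.eval y).comp (Polynomial.eval₂RingHom MvPolynomial.C ρ) =
        Polynomial.evalRingHom r := by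
      ext <;> simp [hρy]
    rw [← F.reverse.divX_mul_X_add, Polynomial.eval₂_add, Polynomial.eval₂_mul,
      Polynomial.eval₂_X, Polynomial.eval₂_C, Polynomial.coeff_zero_reverse] at hrev
    have hval : MvPolynomial.eval y (b * f) =
        -Polynomial.eval r (Polynomial.X * F.leadingCoeff) := by
      simp only [f, map_mul, Polynomial.hom_eval₂, hcomp, hρy, Polynomial.eval_mul,
        Polynomial.eval_X]
      rw [Polynomial.coe_evalRingHom] at hrev
      linear_combination r * hrev
    simp only [hval, norm_neg, Real.norm_eq_abs] at hKy
    linarith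
  refine (Metric.isBounded_closedBall (x := (0 : Fin n → ℝ)) (r := 1 + |R|)).subset fun x hx => ?_
  rw [mem_closedBall_zero_iff, pi_norm_le_iff_of_nonneg (by positivity)]
  intro i
  have h1 : x i ^ 2 ≤ ∑ i, x i ^ 2 :=
    Finset.single_le_sum (f := fun i => x i ^ 2) (fun _ _ => sq_nonneg _) (Finset.mem_univ i)
  have h2 := hbound x hx
  have h3 := le_abs_self R
  rw [Real.norm_eq_abs]
  nlinarith [sq_abs (x i), abs_nonneg R, abs_nonneg (x i), sq_nonneg (|x i| - 1)]

/-- For a semialgebraic `S ⊆ ℝⁿ` and `b ∈ ℝ[x₁,…,xₙ]`, the product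
`b·f` is bounded on `S` for every polynomial `f` if and only if the set
`{x ∈ S : b(x) ≠ 0}` is bounded. -/
theorem conductor_membership_iff
    (n : ℕ) (S : Set (Fin n → ℝ)) (hS : IsSemialgebraic S)
    (b : MvPolynomial (Fin n) ℝ) :
    (∀ f : MvPolynomial (Fin n) ℝ,
        Bornology.IsBounded ((fun x => MvPolynomial.eval x (b * f)) '' S)) ↔
      Bornology.IsBounded {x ∈ S | MvPolynomial.eval x b ≠ 0} := by
  constructor
  · intro h
    obtain ⟨N, p, m, q, rfl⟩ := hS
    have hset : {x | x ∈ (⋃ i, {x | MvPolynomial.eval x (p i) = 0 ∧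
        ∀ j, 0 < MvPolynomial.eval x (q i j)}) ∧ MvPolynomial.eval x b ≠ 0} =
        ⋃ i, {x | (MvPolynomial.eval x (p i) = 0 ∧ ∀ j, 0 < MvPolynomial.eval x (q i j)) ∧
          MvPolynomial.eval x b ≠ 0} := by
      ext x
      simp only [Set.mem_ofPred_eq, Set.mem_iUnion, exists_and_right]
    rw [hset, Bornology.isBounded_iUnion]
    intro i
    refine isBounded_of_forall_isBounded_mul_basic (p i) b (q i) fun f => (h f).subset ?_
    exact Set.image_mono (Set.subset_iUnion (fun i => {x | MvPolynomial.eval x (p i) = 0 ∧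
      ∀ j, 0 < MvPolynomial.eval x (q i j)}) i)
  · intro h f
    have hK := (h.isCompact_closure.image (MvPolynomial.continuous_eval (b * f))).isBounded
    refine (hK.union (Bornology.isBounded_singleton (x := (0 : ℝ)))).subset ?_
    rintro _ ⟨x, hx, rfl⟩
    by_cases hb : MvPolynomial.eval x b = 0
    · right
      simp [hb]
    · exact Or.inl ⟨x, subset_closure ⟨hx, hb⟩, rfl⟩
end

section
/- Let f, g : [0,∞) → ℝ be continuous functions whose graphs are semialgebraic subsets of ℝ², such that f is unbounded and g(t) > 0 for all t ≥ 0. Then there exists N such that for all n ≥ N, the function t ↦ f(t)ⁿ · g(t) is unbounded on [0,∞). -/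
open Polynomial Filter Bornology Topology in
/-- A real polynomial is bounded by a power of `|t|` for large `|t|`. -/
lemma Polynomial.exists_eventually_norm_eval_le_pow (p : ℝ[X]) :
    ∃ K : ℕ, ∀ᶠ t in cobounded ℝ, ‖p.eval t‖ ≤ ‖t‖ ^ K := by
  induction p using Polynomial.induction_on' with
  | add p q hp hq =>
    obtain ⟨a, ha⟩ := hp
    obtain ⟨b, hb⟩ := hq
    refine ⟨a + b + 1, ?_⟩
    filter_upwards [ha, hb, tendsto_norm_cobounded_atTop.eventually_ge_atTop (2 : ℝ)]
      with t hta htb ht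
    have h1 : (1 : ℝ) ≤ ‖t‖ := by linarith
    have h2 : ‖t‖ ^ a ≤ ‖t‖ ^ (a + b) := pow_le_pow_right₀ h1 (by omega)
    have h3 : ‖t‖ ^ b ≤ ‖t‖ ^ (a + b) := pow_le_pow_right₀ h1 (by omega)
    have h4 : 0 ≤ ‖t‖ ^ (a + b) := by positivity
    rw [eval_add, pow_succ]
    calc ‖p.eval t + q.eval t‖ ≤ ‖p.eval t‖ + ‖q.eval t‖ := norm_add_le _ _
      _ ≤ ‖t‖ ^ (a + b) * 2 := by linarith
      _ ≤ ‖t‖ ^ (a + b) * ‖t‖ := by gcongr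
  | monomial n a =>
    refine ⟨n + 1, ?_⟩
    filter_upwards [tendsto_norm_cobounded_atTop.eventually_ge_atTop ‖a‖] with t ht
    rw [eval_monomial, norm_mul, norm_pow, pow_succ, mul_comm]
    gcongr

open Polynomial Filter Bornology Topology in
/-- A nonzero real polynomial is bounded away from zero near infinity. -/
lemma Polynomial.exists_pos_eventually_le_norm_eval {p : ℝ[X]} (hp : p ≠ 0) :
    ∃ c : ℝ, 0 < c ∧ ∀ᶠ t in cobounded ℝ, c ≤ ‖p.eval t‖ := by
  by_cases hd : 0 < p.degree
  · exact ⟨1, one_pos,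
      (p.tendsto_norm_atTop hd tendsto_norm_cobounded_atTop).eventually_ge_atTop 1⟩
  · rw [eq_C_of_degree_le_zero (not_lt.mp hd)] at hp ⊢
    refine ⟨‖p.coeff 0‖, by simpa using hp, ?_⟩
    simp

open Polynomial Filter Bornology Topology in
/-- The roots of `P(t, ·)` grow at most polynomially in `t`. -/
lemma Polynomial.exists_eventually_norm_le_pow_of_evalEval_eq_zero {P : ℝ[X][X]} (hP : P ≠ 0) :
    ∃ K : ℕ, ∀ᶠ t in cobounded ℝ, ∀ s, P.evalEval t s = 0 → ‖s‖ ≤ ‖t‖ ^ K := by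
  obtain ⟨c, hc, hlead⟩ :=
    exists_pos_eventually_le_norm_eval (leadingCoeff_ne_zero.mpr hP)
  choose k hk using fun i => exists_eventually_norm_eval_le_pow (P.coeff i)
  set S := Finset.range P.natDegree
  have hcoeff : ∀ᶠ t in cobounded ℝ, ∀ i ∈ S, ‖(P.coeff i).eval t‖ ≤ ‖t‖ ^ k i :=
    (eventually_all_finset S).mpr fun i _ => hk i
  refine ⟨∑ i ∈ S, k i + 1, ?_⟩
  filter_upwards [hlead, hcoeff,
    tendsto_norm_cobounded_atTop.eventually_ge_atTop (1 / c + 1)] with t htl htc ht s hs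
  set M := ∑ i ∈ S, k i
  have hc' : 0 < 1 / c := by positivity
  have h1 : 1 ≤ ‖t‖ := by linarith
  have hne : evalRingHom t P.leadingCoeff ≠ 0 := by
    intro h
    rw [coe_evalRingHom] at h
    rw [h, norm_zero] at htl
    linarith
  have hmap : P.map (evalRingHom t) ≠ 0 := by
    intro h
    apply hne
    rw [leadingCoeff, ← coeff_map, h, coeff_zero]
  have hroot : (P.map (evalRingHom t)).IsRoot s := by
    rw [IsRoot.def, map_evalRingHom_eval, hs]
  have hb := hroot.norm_lt_cauchyBound hmap
  rw [cauchyBound, natDegree_map_of_leadingCoeff_ne_zero _ hne,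
    leadingCoeff_map_of_leadingCoeff_ne_zero _ hne] at hb
  have hsup : S.sup (fun i => ‖(P.map (evalRingHom t)).coeff i‖₊) ≤ ‖t‖₊ ^ M := by
    refine Finset.sup_le fun i hi => ?_
    rw [coeff_map, ← NNReal.coe_le_coe]
    push_cast
    exact (htc i hi).trans (pow_le_pow_right₀ h1 (Finset.single_le_sum (by simp) hi))
  have hb' := NNReal.coe_lt_coe.mpr hb
  have hsup' := NNReal.coe_le_coe.mpr hsup
  push_cast at hb' hsup'
  rw [coe_evalRingHom] at hb'
  have hM : 1 ≤ ‖t‖ ^ M := one_le_pow₀ h1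
  calc ‖s‖ ≤ _ := hb'.le
    _ ≤ ‖t‖ ^ M / c + 1 := by gcongr
    _ ≤ ‖t‖ ^ M / c + ‖t‖ ^ M := by gcongr
    _ = ‖t‖ ^ M * (1 / c + 1) := by ring
    _ ≤ ‖t‖ ^ M * ‖t‖ := by gcongr
    _ = ‖t‖ ^ (M + 1) := (pow_succ _ _).symm

open Polynomial Filter Bornology Topology in
/-- The nonzero roots of `P(t, ·)` decay at most polynomially in `t`. -/
lemma Polynomial.exists_eventually_norm_inv_le_pow_of_evalEval_eq_zero {P : ℝ[X][X]}
    (hP : P ≠ 0) :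
    ∃ K : ℕ, ∀ᶠ t in cobounded ℝ, ∀ s, s ≠ 0 → P.evalEval t s = 0 → ‖s⁻¹‖ ≤ ‖t‖ ^ K := by
  obtain ⟨K, hK⟩ := exists_eventually_norm_le_pow_of_evalEval_eq_zero
    (P := P.reverse) (by rwa [Ne, reverse_eq_zero])
  refine ⟨K, hK.mono fun t ht s hs h => ht _ ?_⟩
  let _ := invertibleOfNonzero hs
  rw [← eval₂_evalRingHom] at h ⊢
  rw [← invOf_eq_inv]
  exact (eval₂_reverse_eq_zero_iff _ _ _).mpr h

open Polynomial Filter Topology in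
/-- A semialgebraic function satisfies a nontrivial polynomial equation. -/
lemma IsSemialgebraic.exists_evalEval_eq_zero {f : ℝ → ℝ}
    (hf : IsSemialgebraic {z : Fin 2 → ℝ | 0 ≤ z 0 ∧ z 1 = f (z 0)}) :
    ∃ P : ℝ[X][X], P ≠ 0 ∧ ∀ t, 0 ≤ t → P.evalEval t (f t) = 0 := by
  classical
  obtain ⟨N, p, m, q, h⟩ := hf
  have hQ : ∏ i with p i ≠ 0, p i ≠ 0 :=
    Finset.prod_ne_zero_iff.mpr fun i hi => (Finset.mem_filter.mp hi).2
  set Q := ∏ i with p i ≠ 0, p i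
  refine ⟨(Bivariate.equivMvPolynomial ℝ).symm Q, by simpa using hQ, fun t ht => ?_⟩
  have heval : ∀ R : MvPolynomial (Fin 2) ℝ, ∀ s,
      ((Bivariate.equivMvPolynomial ℝ).symm R).evalEval t s = MvPolynomial.eval ![t, s] R := by
    intro R s
    induction R using MvPolynomial.induction_on with
    | C a => simp
    | add a b ha hb => simp [ha, hb, evalEval_add]
    | mul_X a i ha => fin_cases i <;> simp [ha, evalEval_mul, evalEval_C]
  rw [heval]
  have hmem : ![t, f t] ∈ {z : Fin 2 → ℝ | 0 ≤ z 0 ∧ z 1 = f (z 0)} := by simpa using ht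
  rw [h] at hmem
  obtain ⟨i, hi0, hiq⟩ := Set.mem_iUnion.mp hmem
  have hpi : p i ≠ 0 := by
    intro hp
    have hev : ∀ᶠ s in 𝓝 (f t), ∀ j, 0 < MvPolynomial.eval ![t, s] (q i j) := by
      refine eventually_all.mpr fun j => ?_
      have hc : Continuous fun s : ℝ => MvPolynomial.eval ![t, s] (q i j) :=
        (MvPolynomial.continuous_eval _).comp
          (continuous_pi fun k => by fin_cases k <;> simp <;> fun_prop)
      exact hc.continuousAt.eventually (lt_mem_nhds (hiq j))
    obtain ⟨s, hs, hne⟩ :=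
      ((hev.filter_mono nhdsWithin_le_nhds).and
        (self_mem_nhdsWithin : {f t}ᶜ ∈ 𝓝[≠] (f t))).exists
    have hmem' : ![t, s] ∈ {z : Fin 2 → ℝ | 0 ≤ z 0 ∧ z 1 = f (z 0)} := by
      rw [h]
      exact Set.mem_iUnion.mpr ⟨i, by simp [hp], hs⟩
    exact hne (by simpa using hmem'.2)
  rw [map_prod]
  exact Finset.prod_eq_zero (Finset.mem_filter.mpr ⟨Finset.mem_univ i, hpi⟩) hi0

open Polynomial Filter Bornology in
/-- Let `f, g : [0,∞) → ℝ` be continuous semialgebraic functions with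
`f` unbounded and `g > 0` everywhere. Then `fⁿ·g` is unbounded on `[0,∞)` for all
sufficiently large `n`. -/
theorem pow_mul_unbounded_of_unbounded
    (f g : ℝ → ℝ)
    (hfc : ContinuousOn f (Set.Ici (0 : ℝ)))
    (hgc : ContinuousOn g (Set.Ici (0 : ℝ)))
    (hfsa : IsSemialgebraic {z : Fin 2 → ℝ | 0 ≤ z 0 ∧ z 1 = f (z 0)})
    (hgsa : IsSemialgebraic {z : Fin 2 → ℝ | 0 ≤ z 0 ∧ z 1 = g (z 0)})
    (hfu : ¬ Bornology.IsBounded (f '' Set.Ici (0 : ℝ)))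
    (hgpos : ∀ t : ℝ, 0 ≤ t → 0 < g t) :
    ∃ N : ℕ, ∀ n ≥ N,
      ¬ Bornology.IsBounded ((fun t => f t ^ n * g t) '' Set.Ici (0 : ℝ)) := by
  obtain ⟨P, hP, hPf⟩ := hfsa.exists_evalEval_eq_zero
  obtain ⟨Q, hQ, hQg⟩ := hgsa.exists_evalEval_eq_zero
  obtain ⟨K, hK⟩ := exists_eventually_norm_le_pow_of_evalEval_eq_zero
    (P := Bivariate.swap P) (by simpa using hP)
  obtain ⟨M, hM⟩ := exists_eventually_norm_inv_le_pow_of_evalEval_eq_zero hQ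
  rw [← comap_norm_atTop, eventually_comap, eventually_atTop] at hK hM
  obtain ⟨R, hR⟩ := hK
  obtain ⟨T, hT⟩ := hM
  have hswap : ∀ t, 0 ≤ t → (Bivariate.swap P).evalEval (f t) t = 0 := by
    intro t ht
    rw [← coe_aevalAeval_eq_evalEval, Bivariate.aevalAeval_swap, coe_aevalAeval_eq_evalEval]
    exact hPf t ht
  refine ⟨K * M + 1, fun n hn hb => hfu ?_⟩
  obtain ⟨B, hB⟩ := isBounded_iff_forall_norm_le.mp hb
  obtain ⟨C, hC⟩ := isBounded_iff_forall_norm_le.mp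
    ((isCompact_Icc (a := (0 : ℝ)) (b := T)).image_of_continuousOn
      (hfc.mono Set.Icc_subset_Ici_self)).isBounded
  refine isBounded_iff_forall_norm_le.mpr ⟨max (max R 1) (max B C), ?_⟩
  rintro _ ⟨t, ht, rfl⟩
  have ht0 : (0 : ℝ) ≤ t := ht
  by_contra! hlt
  simp only [max_lt_iff] at hlt
  obtain ⟨⟨hfR, hf1⟩, hfB, hfC⟩ := hlt
  have htT : T < t := by
    by_contra! hle
    exact hfC.not_ge (hC _ ⟨t, ⟨ht0, hle⟩, rfl⟩)
  have h1 : ‖t‖ ≤ ‖f t‖ ^ K := hR _ hfR.le _ rfl _ (hswap t ht0)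
  have hg := hgpos t ht0
  have h2 : ‖(g t)⁻¹‖ ≤ ‖t‖ ^ M :=
    hT _ (htT.le.trans (le_abs_self t)) _ rfl _ hg.ne' (hQg t ht0)
  have h3 : (g t)⁻¹ ≤ ‖f t‖ ^ (K * M) := by
    calc (g t)⁻¹ ≤ ‖(g t)⁻¹‖ := le_abs_self _
      _ ≤ ‖t‖ ^ M := h2
      _ ≤ (‖f t‖ ^ K) ^ M := by gcongr
      _ = ‖f t‖ ^ (K * M) := (pow_mul _ _ _).symm
  have h4 : 1 ≤ ‖f t‖ ^ (K * M) * g t := (inv_le_iff_one_le_mul₀ hg).mp h3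
  have h5 : ‖f t ^ n * g t‖ ≤ B := hB _ ⟨t, ht, rfl⟩
  rw [norm_mul, norm_pow, Real.norm_of_nonneg hg.le] at h5
  have h6 : ‖f t‖ ≤ B := by
    calc ‖f t‖ ≤ ‖f t‖ * (‖f t‖ ^ (K * M) * g t) := le_mul_of_one_le_right (norm_nonneg _) h4
      _ = ‖f t‖ ^ (K * M + 1) * g t := by ring
      _ ≤ ‖f t‖ ^ n * g t := by gcongr; exact hf1.le
      _ ≤ B := h5
  linarith
end

section
/- Let B ⊆ A be an extension of commutative rings, and let J be an ideal of the ring A with J ⊆ B. Assume that J contains an element that is not a zero divisor in A, and that J is finitely generated as an ideal of B (equivalently, as a B-module). Then the extension B ⊆ A is integral, i.e., every element of A is integral over B. -/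
open Polynomial in
/-- An element that stabilizes a finitely generated submodule containing a non-zero-divisor is
integral. -/
theorem isIntegral_of_mul_mem_of_mem_nonZeroDivisors {R A : Type*} [CommRing R] [CommRing A]
    [Algebra R A] {N : Submodule R A} (hN : N.FG) {x : A} (hxN : x ∈ N)
    (hx : x ∈ nonZeroDivisors A) {a : A} (ha : ∀ n ∈ N, a * n ∈ N) : IsIntegral R a := by
  have : Module.Finite R N := Module.Finite.iff_fg.mpr hN
  let f : Module.End R N := (LinearMap.mulLeft R a).restrict ha
  obtain ⟨p, hp, hpf⟩ := LinearMap.exists_monic_and_aeval_eq_zero R f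
  have hpow (k : ℕ) (n : N) : ((f ^ k) n : A) = a ^ k * n := by
    induction k with
    | zero => simp
    | succ k ih => rw [pow_succ', pow_succ', mul_assoc, ← ih]; rfl
  have key (q : R[X]) (n : N) : (aeval f q n : A) = aeval a q * n := by
    induction q using Polynomial.induction_on' with
    | add q r hq hr => simp [hq, hr, add_mul]
    | monomial k c => simp [aeval_monomial, hpow, Algebra.smul_def, mul_assoc]
  refine ⟨p, hp, (mul_right_mem_nonZeroDivisors_eq_zero_iff hx).mp ?_⟩
  simpa [hpf, aeval_def] using (key p ⟨x, hxN⟩).symm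

/-- Let `B ⊆ A` be an extension of commutative rings and `J` an ideal
of `A` with `J ⊆ B`. If `J` contains a non-zero-divisor of `A` and `J` is finitely
generated as an ideal of `B` (i.e., by finitely many elements with coefficients
from `B`), then the extension `B ⊆ A` is integral. -/
theorem integral_of_conductor_fg
    (A : Type*) [CommRing A] (B : Subring A) (J : Ideal A)
    (hJB : (J : Set A) ⊆ (B : Set A))
    (hnzd : ∃ x ∈ J, x ∈ nonZeroDivisors A)
    (hfg : ∃ G : Finset A, (↑G : Set A) ⊆ (J : Set A) ∧
      ∀ a ∈ J, ∃ c : A → A, (∀ g ∈ G, c g ∈ B) ∧ a = ∑ g ∈ G, c g * g) :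
    ∀ a : A, IsIntegral B a := by
  intro a
  obtain ⟨x, hxJ, hx⟩ := hnzd
  obtain ⟨G, hGJ, hG⟩ := hfg
  have hspan : Submodule.span B (G : Set A) = J.restrictScalars B := by
    refine le_antisymm (Submodule.span_le.mpr hGJ) fun y hy => ?_
    obtain ⟨c, hc, rfl⟩ := hG y hy
    exact Submodule.sum_mem _ fun g hg =>
      Submodule.smul_mem _ (⟨c g, hc g hg⟩ : B) (Submodule.subset_span hg)
  exact isIntegral_of_mul_mem_of_mem_nonZeroDivisors (N := J.restrictScalars B)
    ⟨G, hspan⟩ hxJ hx fun n hn => J.mul_mem_left a hn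
end

section
/- Let K be a field, let A be a subring of K, and let (v_i)_{i ∈ I} be a family of valuations v_i : K → ℤₘ₀ with value group ℤ (i.e., valuations K → WithZero (Multiplicative ℤ)). Let B = {a ∈ A : v_i(a) ≤ 1 for all i ∈ I}. If B ≠ A, then B contains no nonzero ideal of A; that is, if b ∈ A satisfies a·b ∈ B for all a ∈ A, then b = 0. -/
/-- If `f` has a pole along a valuation with values in a multiplicatively archimedean value monoid,
then so does `f ^ n * b` for some `n`, for every nonzero `b`. -/
theorem Valuation.exists_one_lt_map_pow_mul {K Γ₀ : Type*} [Field K]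
    [LinearOrderedCommGroupWithZero Γ₀] [MulArchimedean Γ₀] (v : Valuation K Γ₀)
    {f b : K} (hf : 1 < v f) (hb : b ≠ 0) : ∃ n : ℕ, 1 < v (f ^ n * b) := by
  obtain ⟨n, hn⟩ := MulArchimedean.arch (v b)⁻¹ hf
  refine ⟨n + 1, ?_⟩
  rw [map_mul, map_pow, ← inv_lt_iff_one_lt_mul₀ (v.pos_iff.mpr hb)]
  exact hn.trans_lt (pow_lt_pow_right₀ hf n.lt_succ_self)

/-- Let `K` be a field, `A` a subring of `K`, and `(vᵢ)` a family of
valuations `K → ℤₘ₀` (with value group `ℤ`). Let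
`B = {a ∈ A : vᵢ(a) ≤ 1 for all i}`. If `B ≠ A`, then `B` contains no nonzero
ideal of `A`: if `b ∈ A` satisfies `a·b ∈ B` for all `a ∈ A`, then `b = 0`. -/
theorem no_nonzero_ideal_in_valuation_ring_intersection
    (K : Type*) [Field K] (A : Subring K) (I : Type*)
    (v : I → Valuation K (WithZero (Multiplicative ℤ)))
    (B : Set K) (hB : B = {a : K | a ∈ A ∧ ∀ i : I, v i a ≤ 1})
    (hne : B ≠ (A : Set K)) :
    ∀ b ∈ A, (∀ a ∈ A, a * b ∈ B) → b = 0 := by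
  intro b _ hb
  by_contra hb0
  refine hne (hB.trans (Set.Subset.antisymm (fun a ha => ha.1) fun f hf => ⟨hf, fun i => ?_⟩))
  by_contra! hi
  obtain ⟨n, hn⟩ := (v i).exists_one_lt_map_pow_mul hi hb0
  have hmem := hb (f ^ n) (pow_mem hf n)
  rw [hB] at hmem
  exact (hmem.2 i).not_gt hn
end

section
/- Let S ⊆ ℝⁿ be a set that is unbounded, and suppose that the ring B(S) of polynomials bounded on S is Noetherian. Then the only ideal of ℝ[x₁,…,xₙ] contained in B(S) is the zero ideal; that is, if b ∈ ℝ[x₁,…,xₙ] satisfies f·b ∈ B(S) for every f ∈ ℝ[x₁,…,xₙ], then b = 0. -/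
/-- The `ℝ`-subalgebra `B(S)` of `ℝ[x₁,…,xₙ]` consisting of the polynomials whose
image on `S ⊆ ℝⁿ` is a bounded subset of `ℝ`. -/
noncomputable def polyBdd (n : ℕ) (S : Set (Fin n → ℝ)) :
    Subalgebra ℝ (MvPolynomial (Fin n) ℝ) where
  carrier := {f | Bornology.IsBounded ((fun x => MvPolynomial.eval x f) '' S)}
  add_mem' := by
    intro a b ha hb
    rw [Set.mem_setOf_eq, isBounded_iff_forall_norm_le] at *
    obtain ⟨Ca, hCa⟩ := ha
    obtain ⟨Cb, hCb⟩ := hb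
    refine ⟨Ca + Cb, ?_⟩
    rintro _ ⟨x, hx, rfl⟩
    simp only [map_add]
    calc ‖MvPolynomial.eval x a + MvPolynomial.eval x b‖
        ≤ ‖MvPolynomial.eval x a‖ + ‖MvPolynomial.eval x b‖ := norm_add_le _ _
      _ ≤ Ca + Cb := add_le_add (hCa _ ⟨x, hx, rfl⟩) (hCb _ ⟨x, hx, rfl⟩)
  mul_mem' := by
    intro a b ha hb
    rw [Set.mem_setOf_eq, isBounded_iff_forall_norm_le] at *
    obtain ⟨Ca, hCa⟩ := ha
    obtain ⟨Cb, hCb⟩ := hb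
    refine ⟨max Ca 0 * max Cb 0, ?_⟩
    rintro _ ⟨x, hx, rfl⟩
    simp only [map_mul, norm_mul]
    exact mul_le_mul (le_max_of_le_left (hCa _ ⟨x, hx, rfl⟩))
      (le_max_of_le_left (hCb _ ⟨x, hx, rfl⟩)) (norm_nonneg _) (le_max_right _ _)
  zero_mem' := by
    rw [Set.mem_setOf_eq, isBounded_iff_forall_norm_le]
    exact ⟨0, by rintro _ ⟨x, hx, rfl⟩; simp⟩
  one_mem' := by
    rw [Set.mem_setOf_eq, isBounded_iff_forall_norm_le]
    exact ⟨1, by rintro _ ⟨x, hx, rfl⟩; simp⟩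
  algebraMap_mem' := by
    intro r
    rw [Set.mem_setOf_eq, isBounded_iff_forall_norm_le]
    refine ⟨‖r‖, ?_⟩
    rintro _ ⟨x, hx, rfl⟩
    simp [MvPolynomial.algebraMap_eq]

theorem mem_polyBdd_iff {n : ℕ} {S : Set (Fin n → ℝ)} {f : MvPolynomial (Fin n) ℝ} :
    f ∈ polyBdd n S ↔ ∃ C : ℝ, ∀ x ∈ S, ‖MvPolynomial.eval x f‖ ≤ C := by
  change Bornology.IsBounded ((fun x => MvPolynomial.eval x f) '' S) ↔ _
  simp only [isBounded_iff_forall_norm_le, Set.forall_mem_image]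

/-- `B(S)` is integrally closed in the polynomial ring. -/
theorem mem_polyBdd_of_isIntegral {n : ℕ} {S : Set (Fin n → ℝ)} {f : MvPolynomial (Fin n) ℝ}
    (hf : IsIntegral (polyBdd n S) f) : f ∈ polyBdd n S := by
  obtain ⟨p, hp, hpf⟩ := hf
  choose C hC using fun i : ℕ => mem_polyBdd_iff.1 (p.coeff i).2
  refine mem_polyBdd_iff.2 ⟨(∑ i ∈ Finset.range p.natDegree, C i) + 1, fun x hx => ?_⟩
  let φ : polyBdd n S →+* ℝ := (MvPolynomial.eval x).comp (algebraMap _ _)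
  have hmonic : (p.map φ).Monic := hp.map φ
  have hroot : (p.map φ).IsRoot (MvPolynomial.eval x f) := by
    rw [Polynomial.IsRoot, Polynomial.eval_map, ← Polynomial.hom_eval₂, hpf, map_zero]
  refine (NNReal.coe_le_coe.2 (hroot.norm_lt_cauchyBound hmonic.ne_zero).le).trans ?_
  rw [Polynomial.cauchyBound, hmonic.leadingCoeff, hp.natDegree_map, nnnorm_one, div_one,
    NNReal.coe_add, NNReal.coe_one]
  gcongr
  have hsup : Finset.sup (Finset.range p.natDegree) (fun i => ‖(p.map φ).coeff i‖₊) ≤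
      ∑ i ∈ Finset.range p.natDegree, ‖(p.map φ).coeff i‖₊ :=
    Finset.sup_le fun i hi =>
      Finset.single_le_sum (f := fun i => ‖(p.map φ).coeff i‖₊) (fun _ _ => zero_le) hi
  refine (NNReal.coe_le_coe.2 hsup).trans ?_
  rw [NNReal.coe_sum]
  refine Finset.sum_le_sum fun i _ => ?_
  rw [Polynomial.coeff_map]
  exact hC i x hx

/-- If a Noetherian subalgebra of a domain contains a nonzero ideal of the domain, then the
domain is integral over it. -/
theorem Subalgebra.isIntegral_of_isNoetherianRing_of_mul_mem {R A : Type*} [CommRing R]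
    [CommRing A] [IsDomain A] [Algebra R A] (B : Subalgebra R A) [IsNoetherianRing B]
    {b : A} (hb : b ≠ 0) (h : ∀ f : A, f * b ∈ B) : Algebra.IsIntegral B A := by
  let m : A →ₗ[B] B :=
    { toFun := fun f => ⟨f * b, h f⟩
      map_add' := fun f g => Subtype.ext (add_mul f g b)
      map_smul' := fun c f => Subtype.ext (mul_assoc (c : A) f b) }
  have hm : Function.Injective m := fun f g hfg =>
    mul_right_cancel₀ hb (congrArg Subtype.val hfg)
  have : IsNoetherian B A := isNoetherian_of_injective m hm
  exact Algebra.IsIntegral.of_finite B A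

/-- If `S ⊆ ℝⁿ` is unbounded and the ring `B(S)` of polynomials
bounded on `S` is Noetherian, then the only ideal of `ℝ[x₁,…,xₙ]` contained in
`B(S)` is the zero ideal. -/
theorem conductor_trivial_of_noetherian
    (n : ℕ) (S : Set (Fin n → ℝ)) (hS : ¬ Bornology.IsBounded S)
    (hNoeth : IsNoetherianRing (polyBdd n S)) :
    ∀ b : MvPolynomial (Fin n) ℝ,
      (∀ f : MvPolynomial (Fin n) ℝ, f * b ∈ polyBdd n S) → b = 0 := by
  intro b hb
  by_contra hb0
  have hint := (polyBdd n S).isIntegral_of_isNoetherianRing_of_mul_mem hb0 hb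
  refine hS (Bornology.forall_isBounded_image_eval_iff.1 fun i => ?_)
  obtain ⟨C, hC⟩ := mem_polyBdd_iff.1
    (mem_polyBdd_of_isIntegral (hint.isIntegral (MvPolynomial.X i)))
  refine isBounded_iff_forall_norm_le.2 ⟨C, Set.forall_mem_image.2 fun x hx => ?_⟩
  simpa only [MvPolynomial.eval_X] using hC x hx
end
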